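/- Let n ≥ 3. There exists a constant C = C(n) > 0 such that for every set of finite perimeter E ⊂ ℝⁿ with |E| = |B_1| one has NL(B_1) − NL(E) ≤ C · (P(E) − P(B_1)). -/

import Mathlib

open MeasureTheory Metric Set

noncomputable section

/-- The divergence of a vector field on `ℝⁿ`. -/
def vdiv {n : ℕ} (φ : EuclideanSpace ℝ (Fin n) → EuclideanSpace ℝ (Fin n))
    (x : EuclideanSpace ℝ (Fin n)) : ℝ :=
  ∑ i, fderiv ℝ φ x (EuclideanSpace.single i 1) i

/-- The set of admissible values `∫_F div φ` in the variational definition of the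
perimeter: `φ` ranges over compactly supported `C¹` vector fields with `‖φ‖ ≤ 1`. -/
def perimVals {n : ℕ} (F : Set (EuclideanSpace ℝ (Fin n))) : Set ℝ :=
  { r | ∃ φ : EuclideanSpace ℝ (Fin n) → EuclideanSpace ℝ (Fin n),
      ContDiff ℝ 1 φ ∧ HasCompactSupport φ ∧ (∀ x, ‖φ x‖ ≤ 1) ∧
      r = ∫ x in F, vdiv φ x }

/-- The (distributional) perimeter `P(F)`. -/
def perimeter {n : ℕ} (F : Set (EuclideanSpace ℝ (Fin n))) : ℝ := sSup (perimVals F)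

/-- `F` is a set of finite perimeter: it is measurable and the variational
definition of the perimeter is finite. -/
def HasFinitePerimeter {n : ℕ} (F : Set (EuclideanSpace ℝ (Fin n))) : Prop :=
  MeasurableSet F ∧ BddAbove (perimVals F)

/-- The Newtonian interaction energy `NL(F) = ∫∫ χ_F(x)χ_F(y)|x-y|^{2-n}`. -/
def NL {n : ℕ} (F : Set (EuclideanSpace ℝ (Fin n))) : ℝ :=
  ∫ x in F, ∫ y in F, ‖x - y‖ ^ (2 - (n : ℝ))

/-- The function `f_E = χ_{B_1} - χ_E`. -/
def fE {n : ℕ} (E : Set (EuclideanSpace ℝ (Fin n))) (x : EuclideanSpace ℝ (Fin n)) : ℝ :=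
  (ball (0 : EuclideanSpace ℝ (Fin n)) 1).indicator 1 x - E.indicator 1 x

/-- The Newtonian potential `v(y) = ∫ (χ_{B_1} - χ_E)(x) |x-y|^{2-n} dx`. -/
def newtPot {n : ℕ} (E : Set (EuclideanSpace ℝ (Fin n))) (y : EuclideanSpace ℝ (Fin n)) : ℝ :=
  ∫ x, fE E x * ‖x - y‖ ^ (2 - (n : ℝ))

/-- The normalization constant `σ_{n,α}` of the Riesz potential. -/
def rieszConst (n : ℕ) (α : ℝ) : ℝ :=
  (Real.pi ^ ((n : ℝ) / 2) * 2 ^ α * Real.Gamma (α / 2) / Real.Gamma (((n : ℝ) - α) / 2))⁻¹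

/-- The Riesz potential `I_α f(x) = σ_{n,α} ∫ f(ξ)|x-ξ|^{α-n} dξ`. -/
def rieszPot {n : ℕ} (α : ℝ) (f : EuclideanSpace ℝ (Fin n) → ℝ)
    (x : EuclideanSpace ℝ (Fin n)) : ℝ :=
  rieszConst n α * ∫ ξ, f ξ * ‖x - ξ‖ ^ (α - (n : ℝ))

/-- The average of `g` over the sphere `∂B_r` with respect to the
`(n-1)`-dimensional Hausdorff measure. -/
def sphAvg {n : ℕ} (g : EuclideanSpace ℝ (Fin n) → ℝ) (r : ℝ) : ℝ :=
  (μH[(n : ℝ) - 1] (sphere (0 : EuclideanSpace ℝ (Fin n)) r)).toReal⁻¹ *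
    ∫ y in sphere (0 : EuclideanSpace ℝ (Fin n)) r, g y ∂μH[(n : ℝ) - 1]

/-- The average of `g` over the ball `B_r` with respect to the Lebesgue measure. -/
def ballAvg {n : ℕ} (g : EuclideanSpace ℝ (Fin n) → ℝ) (r : ℝ) : ℝ :=
  (volume (ball (0 : EuclideanSpace ℝ (Fin n)) r)).toReal⁻¹ *
    ∫ x in ball (0 : EuclideanSpace ℝ (Fin n)) r, g x

end

open MeasureTheory Metric Set

theorem geo_id (d : ℕ) (y : ℝ) :
    (1 + d * y^(d+1) - (d+1) * y^d) = (1-y)^2 * ∑ k ∈ Finset.range d, ((k:ℝ)+1) * y^k := by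
  induction d with
  | zero => simp
  | succ d ih => rw [Finset.sum_range_succ, mul_add, ← ih]; push_cast; ring

theorem geo_id1 (d : ℕ) (y : ℝ) :
    (1 - y^d) = (1-y) * ∑ k ∈ Finset.range d, y^k := by
  induction d with
  | zero => simp
  | succ d ih => rw [Finset.sum_range_succ, mul_add, ← ih]; ring

/-- h-bound, with `y^d * t = 1`. -/
theorem h_bound (d : ℕ) (hd : 1 ≤ d) (y t : ℝ) (hy : 0 < y) (ht : y^d * t = 1) :
    (t-1)^2 ≤ (t + d * y - (d+1)) * ((d:ℝ)^2 * max 1 t) := by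
  set S := ∑ k ∈ Finset.range d, y^k with hS
  set T := ∑ k ∈ Finset.range d, ((k:ℝ)+1) * y^k with hT
  have ht0 : 0 < t := by
    by_contra h
    have : y^d * t ≤ 0 := mul_nonpos_of_nonneg_of_nonpos (by positivity) (not_lt.1 h)
    linarith
  have hS0 : 0 ≤ S := Finset.sum_nonneg (fun k _ => by positivity)
  have hST : S ≤ T := Finset.sum_le_sum (fun k _ => by
    have : 0 ≤ y^k := by positivity
    nlinarith [Nat.cast_nonneg (α := ℝ) k])
  have e1 : t + d * y - (d+1) = t * ((1-y)^2 * T) := by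
    rw [← geo_id]
    have : t * (1 + d * y^(d+1) - (d+1) * y^d) = t + d * y * (y^d * t) - (d+1) * (y^d*t) := by ring
    rw [this, ht]; ring
  have e2 : t - 1 = t * ((1-y) * S) := by
    rw [← geo_id1]; linear_combination ht
  have d1 : (1:ℝ) ≤ d := by exact_mod_cast hd
  have hd0 : (0:ℝ) ≤ d := by linarith
  have key : t * S^2 ≤ T * (d:ℝ)^2 * max 1 t := by
    rcases le_total y 1 with h | h
    · have hSd : S ≤ d := by
        calc S ≤ ∑ k ∈ Finset.range d, (1:ℝ) := Finset.sum_le_sum (fun k _ => pow_le_one₀ hy.le h)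
          _ = d := by simp
      have : S^2 ≤ T * (d:ℝ)^2 := by nlinarith [mul_nonneg hS0 (sub_nonneg.2 hSd), mul_nonneg hS0 (sub_nonneg.2 d1), mul_nonneg (hS0.trans hST) (sub_nonneg.2 d1)]
      calc t * S^2 ≤ t * (T * (d:ℝ)^2) := by gcongr
        _ ≤ max 1 t * (T * (d:ℝ)^2) := by
            have : 0 ≤ T := hS0.trans hST
            gcongr; exact le_max_right _ _
        _ = _ := by ring
    · have hSd : S ≤ d * y^d := by
        calc S ≤ ∑ k ∈ Finset.range d, y^d := Finset.sum_le_sum (fun k hk => by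
              apply pow_le_pow_right₀ h (Finset.mem_range.1 hk).le)
          _ = d * y^d := by simp
      have h1 : t * S ≤ d := by
        calc t * S ≤ t * (d * y^d) := by gcongr
          _ = d * (y^d * t) := by ring
          _ = d := by rw [ht]; ring
      have hT0 : 0 ≤ T := hS0.trans hST
      calc t * S^2 = (t * S) * S := by ring
        _ ≤ d * T := by gcongr
        _ ≤ T * (d:ℝ)^2 * 1 := by nlinarith [mul_nonneg (mul_nonneg hT0 hd0) (sub_nonneg.2 d1)]
        _ ≤ _ := by gcongr; exact le_max_left _ _
  calc (t-1)^2 = t * (1-y)^2 * (t * S^2) := by rw [e2]; ring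
    _ ≤ t * (1-y)^2 * (T * (d:ℝ)^2 * max 1 t) := by gcongr
    _ = _ := by rw [e1]; ring

/-- Slice AM-GM. Let `m = ω b^d`. -/
theorem slice_amgm (d : ℕ) (hd : 1 ≤ d) (om b U N p : ℝ) (hom : 0 < om) (hb : 0 < b)
    (hU : 0 ≤ U) (hN : 0 ≤ N) (hp : 0 ≤ p) (hUN : U = 0 → N = 0)
    (hsl : om * (d * N)^d ≤ p^d * U) :
    (d+1) * N + N * (U/(om*b^d) - 1)^2 / ((d:ℝ)^2 * max 1 (U/(om*b^d))) ≤
      b * p + N / (om * b^d) * U := by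
  rcases hN.eq_or_lt with h | hN
  · subst h; simp; positivity
  have hU : 0 < U := lt_of_le_of_ne hU (fun h => hN.ne' (hUN h.symm))
  have d1 : (1:ℝ) ≤ d := by exact_mod_cast hd
  have hd0 : (0:ℝ) ≤ d := by linarith
  have hd0 : (0:ℝ) < d := by linarith
  set m := om * b^d with hm
  have hm0 : 0 < m := by positivity
  set t := U / m with ht
  have ht0 : 0 < t := by positivity
  set y := b * p / (d * N) with hy
  have hpy : b * p = d * N * y := by rw [hy]; field_simp
  have h1 : 1 ≤ y^d * t := by
    have : y^d * t = (p^d * U) / (om * (d*N)^d) := by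
      rw [hy, ht, hm, div_pow, mul_pow]; field_simp
    rw [this, le_div_iff₀ (by positivity)]; linarith
  have hy0 : 0 ≤ y := by positivity
  set z : ℝ := (1/t) ^ ((1:ℝ)/d) with hz
  have hz0 : 0 < z := by positivity
  have hzd : z^d = 1/t := by
    rw [hz, ← Real.rpow_natCast, ← Real.rpow_mul (by positivity)]
    rw [one_div_mul_cancel hd0.ne', Real.rpow_one]
  have hzy : z ≤ y := by
    by_contra hcon
    have : y^d < z^d := pow_lt_pow_left₀ (not_le.1 hcon) hy0 (by omega)
    rw [hzd, lt_div_iff₀ ht0] at this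
    linarith
  have hb := h_bound d hd z t hz0 (by rw [hzd]; field_simp)
  have hmx : 0 < (d:ℝ)^2 * max 1 t := by positivity
  have h2 : (t-1)^2 / ((d:ℝ)^2 * max 1 t) ≤ t + d * y - (d+1) := by
    rw [div_le_iff₀ hmx]
    refine hb.trans ?_
    gcongr
  have : N / m * U = N * t := by rw [ht]; field_simp
  rw [this, hpy, mul_div_assoc]
  nlinarith
open MeasureTheory Metric Set

noncomputable section

def bt (τ : ℝ → ℝ) (s : ℝ) : ℝ := √(1 - τ s ^ 2)
def mm (om : ℝ) (d : ℕ) (τ : ℝ → ℝ) (s : ℝ) : ℝ := om * bt τ s ^ d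

structure SD (d : ℕ) (om a b y : ℝ) (U N p τ : ℝ → ℝ) : Prop where
  hd : 1 ≤ d
  hom : 0 < om
  hay : a ≤ y
  hyb : y ≤ b
  cU : Continuous U
  cN : Continuous N
  cp : Continuous p
  U0 : ∀ s, 0 ≤ U s
  N0 : ∀ s, 0 ≤ N s
  p0 : ∀ s, 0 ≤ p s
  NU : ∀ s, N s ≤ U s
  sl : ∀ s, om * (d * N s)^d ≤ p s ^d * U s
  τ1 : ∀ s, |τ s| < 1
  τd : ∀ s, HasDerivAt τ (N s / mm om d τ s) s
  τy : τ y = 0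

variable {d : ℕ} {om a b y : ℝ} {U N p τ : ℝ → ℝ}

theorem SD.r0 (h : SD d om a b y U N p τ) (s : ℝ) : 0 < 1 - τ s ^ 2 := by
  have := h.τ1 s; rw [abs_lt] at this; nlinarith
theorem SD.b0 (h : SD d om a b y U N p τ) (s : ℝ) : 0 < bt τ s := Real.sqrt_pos.2 (h.r0 s)
theorem SD.bsq (h : SD d om a b y U N p τ) (s : ℝ) : bt τ s ^ 2 = 1 - τ s ^ 2 :=
  Real.sq_sqrt (h.r0 s).le
theorem SD.b1 (h : SD d om a b y U N p τ) (s : ℝ) : bt τ s ≤ 1 := by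
  have := h.bsq s; have := h.b0 s; nlinarith [sq_nonneg (τ s)]
theorem SD.m0 (h : SD d om a b y U N p τ) (s : ℝ) : 0 < mm om d τ s := by
  have := h.b0 s; have := h.hom; unfold mm; positivity
theorem SD.cτ (h : SD d om a b y U N p τ) : Continuous τ :=
  continuous_iff_continuousAt.2 fun s => (h.τd s).continuousAt
theorem SD.cb (h : SD d om a b y U N p τ) : Continuous (bt τ) := by
  unfold bt; have := h.cτ; fun_prop
theorem SD.cm (h : SD d om a b y U N p τ) : Continuous (mm om d τ) := by
  unfold mm; have := h.cb; fun_prop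
theorem SD.cNm (h : SD d om a b y U N p τ) : Continuous (fun s => N s / mm om d τ s) :=
  h.cN.div h.cm fun s => (h.m0 s).ne'
theorem SD.mono (h : SD d om a b y U N p τ) : Monotone τ :=
  monotone_of_hasDerivAt_nonneg (fun s => h.τd s) (fun s => div_nonneg (h.N0 s) (h.m0 s).le)
theorem SD.τpos (h : SD d om a b y U N p τ) {s : ℝ} (hs : y ≤ s) : 0 ≤ τ s := by
  rw [← h.τy]; exact h.mono hs
theorem SD.τneg (h : SD d om a b y U N p τ) {s : ℝ} (hs : s ≤ y) : τ s ≤ 0 := by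
  rw [← h.τy]; exact h.mono hs
theorem SD.bd (h : SD d om a b y U N p τ) (s : ℝ) :
    HasDerivAt (bt τ) (-(τ s * (N s / mm om d τ s) / bt τ s)) s := by
  have h1 : HasDerivAt (fun s => 1 - τ s ^ 2) (-(2 * τ s * (N s / mm om d τ s))) s := by
    have := ((h.τd s).pow 2).const_sub 1
    refine this.congr_deriv ?_; simp
  have := h1.sqrt (h.r0 s).ne'
  refine this.congr_deriv ?_
  have := h.b0 s
  change _ / (2 * bt τ s) = _
  field_simp
theorem SD.md (h : SD d om a b y U N p τ) (s : ℝ) :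
    HasDerivAt (mm om d τ) (-(d * τ s * N s / bt τ s ^ 2)) s := by
  have := ((h.bd s).pow d).const_mul om
  unfold mm
  refine this.congr_deriv ?_
  have h0 := h.b0 s
  have h2 := h.hom
  obtain ⟨e, rfl⟩ : ∃ e, d = e + 1 := ⟨d - 1, by have := h.hd; omega⟩
  unfold mm
  simp only [Nat.add_sub_cancel]
  field_simp
  ring

theorem poinc_half (K N φ φ' K' : ℝ → ℝ) (y b : ℝ) (hyb : y ≤ b)
    (cN : Continuous N) (cK' : Continuous K') (cφ' : Continuous φ')
    (hK : ∀ s, HasDerivAt K (K' s) s) (hφ : ∀ s, HasDerivAt φ (φ' s) s)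
    (hK' : ∀ s ∈ Icc y b, N s ≤ - K' s) (hφ0 : ∀ s, 0 ≤ φ s)
    (hend : K y * φ y ≤ K b * φ b) :
    ∫ s in y..b, N s * φ s ≤ ∫ s in y..b, K s * φ' s := by
  have cK : Continuous K := continuous_iff_continuousAt.2 fun s => (hK s).continuousAt
  have cφ : Continuous φ := continuous_iff_continuousAt.2 fun s => (hφ s).continuousAt
  have := intervalIntegral.integral_mul_deriv_eq_deriv_mul (a := y) (b := b)
    (fun s _ => hK s) (fun s _ => hφ s) (cK'.intervalIntegrable _ _) (cφ'.intervalIntegrable _ _)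
  have h2 : ∫ s in y..b, N s * φ s ≤ ∫ s in y..b, -(K' s * φ s) := by
    apply intervalIntegral.integral_mono_on hyb
    · exact (cN.mul cφ).intervalIntegrable _ _
    · exact (cK'.mul cφ).neg.intervalIntegrable _ _
    · intro s hs
      nlinarith [mul_le_mul_of_nonneg_right (hK' s hs) (hφ0 s)]
  rw [intervalIntegral.integral_neg] at h2
  linarith

theorem SD.poinc (h : SD d om a b y U N p τ) (φ φ' : ℝ → ℝ) (cφ' : Continuous φ')
    (hφ : ∀ s, HasDerivAt φ (φ' s) s) (hφ0 : ∀ s, 0 ≤ φ s) (hφy : φ y = 0) :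
    ∫ s in a..b, N s * φ s ≤ ∫ s in a..b, bt τ s ^ 2 * mm om d τ s * |φ' s| := by
  have cφ : Continuous φ := continuous_iff_continuousAt.2 fun s => (hφ s).continuousAt
  have cN := h.cN; have cb := h.cb; have cm := h.cm; have cτ := h.cτ
  have cNm := h.cNm
  have cR : Continuous (fun s => bt τ s ^ 2 * mm om d τ s * |φ' s|) := by fun_prop
  have cq : Continuous (fun s => d * τ s * N s / bt τ s ^ 2) :=
    Continuous.div (by fun_prop) (by fun_prop) (fun s => (pow_pos (h.b0 s) 2).ne')
  have hτ : ∀ s, -1 < τ s ∧ τ s < 1 := fun s => abs_lt.1 (h.τ1 s)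
  have right : ∫ s in y..b, N s * φ s ≤ ∫ s in y..b, bt τ s ^ 2 * mm om d τ s * |φ' s| := by
    have := poinc_half (fun s => (1 - τ s) * mm om d τ s) N φ φ'
      (fun s => -(N s / mm om d τ s) * mm om d τ s + (1 - τ s) * (-(d * τ s * N s / bt τ s ^ 2)))
      y b h.hyb cN (by fun_prop) cφ' (fun s => ((h.τd s).const_sub 1).mul (h.md s)) hφ
      (fun s hs => by
        have := h.τpos hs.1
        have h3 : 0 ≤ (1 - τ s) * (d * τ s * N s / bt τ s ^ 2) :=
          mul_nonneg (by linarith [hτ s]) (div_nonneg (mul_nonneg (by positivity) (h.N0 s)) (by positivity))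
        have h4 : N s / mm om d τ s * mm om d τ s = N s := div_mul_cancel₀ _ (h.m0 s).ne'
        linarith) hφ0 (by
        rw [hφy]; simp only [mul_zero]
        exact mul_nonneg (mul_nonneg (by linarith [hτ b]) (h.m0 b).le) (hφ0 b))
    refine this.trans ?_
    apply intervalIntegral.integral_mono_on h.hyb
    · exact Continuous.intervalIntegrable (by fun_prop) _ _
    · exact cR.intervalIntegrable _ _
    · intro s hs
      have h1 := h.τpos hs.1
      have h2 := h.bsq s
      have h3 : (1 - τ s) ≤ bt τ s ^ 2 := by nlinarith [hτ s]
      have h4 := (h.m0 s).le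
      calc _ ≤ (1 - τ s) * mm om d τ s * |φ' s| := by
            apply mul_le_mul_of_nonneg_left (le_abs_self _)
            exact mul_nonneg (by linarith [hτ s]) h4
        _ ≤ _ := by gcongr
  have left : ∫ s in a..y, N s * φ s ≤ ∫ s in a..y, bt τ s ^ 2 * mm om d τ s * |φ' s| := by
    have := poinc_half (fun s => -(1 + τ s) * mm om d τ s) N φ φ'
      (fun s => -(N s / mm om d τ s) * mm om d τ s + -(1 + τ s) * (-(d * τ s * N s / bt τ s ^ 2)))
      a y h.hay cN (by fun_prop) cφ' (fun s => (((h.τd s).const_add 1).neg).mul (h.md s)) hφ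
      (fun s hs => by
        have := h.τneg hs.2
        have h3 : 0 ≤ (1 + τ s) * (d * (-τ s) * N s / bt τ s ^ 2) :=
          mul_nonneg (by linarith [hτ s]) (div_nonneg (mul_nonneg (mul_nonneg (by positivity) (by linarith)) (h.N0 s)) (by positivity))
        have h4 : N s / mm om d τ s * mm om d τ s = N s := div_mul_cancel₀ _ (h.m0 s).ne'
        have h5 : (1 + τ s) * (d * (-τ s) * N s / bt τ s ^ 2) = -(1 + τ s) * (d * τ s * N s / bt τ s ^ 2) := by ring
        linarith) hφ0 (by
        rw [hφy]; simp only [mul_zero]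
        have := (mul_nonneg (mul_nonneg (by linarith [hτ a] : 0 ≤ 1 + τ a) (h.m0 a).le) (hφ0 a))
        linarith)
    refine this.trans ?_
    apply intervalIntegral.integral_mono_on h.hay
    · exact Continuous.intervalIntegrable (by fun_prop) _ _
    · exact cR.intervalIntegrable _ _
    · intro s hs
      have h1 := h.τneg hs.2
      have h2 := h.bsq s
      have h3 : (1 + τ s) ≤ bt τ s ^ 2 := by nlinarith [hτ s]
      have h4 := (h.m0 s).le
      calc _ = (1 + τ s) * mm om d τ s * (-φ' s) := by ring
        _ ≤ (1 + τ s) * mm om d τ s * |φ' s| := by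
            apply mul_le_mul_of_nonneg_left (neg_le_abs _)
            exact mul_nonneg (by linarith [hτ s]) h4
        _ ≤ _ := by gcongr
  have cL : Continuous (fun s => N s * φ s) := cN.mul cφ
  rw [← intervalIntegral.integral_add_adjacent_intervals (cL.intervalIntegrable a y) (cL.intervalIntegrable y b),
    ← intervalIntegral.integral_add_adjacent_intervals (cR.intervalIntegrable a y) (cR.intervalIntegrable y b)]
  linarith

end
open MeasureTheory Metric Set

theorem lin3 {a b : ℝ} (hab : a ≤ b) (c1 c2 c3 : ℝ) {f f1 f2 f3 : ℝ → ℝ} (cf : Continuous f)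
    (h1 : Continuous f1) (h2 : Continuous f2) (h3 : Continuous f3)
    (H : ∀ s ∈ Icc a b, f s ≤ c1 * f1 s + c2 * f2 s + c3 * f3 s) :
    ∫ s in a..b, f s ≤ c1 * (∫ s in a..b, f1 s) + c2 * (∫ s in a..b, f2 s)
      + c3 * (∫ s in a..b, f3 s) := by
  have i1 : IntervalIntegrable (fun s => c1 * f1 s) volume a b :=
    Continuous.intervalIntegrable (by fun_prop) _ _
  have i2 : IntervalIntegrable (fun s => c2 * f2 s) volume a b :=
    Continuous.intervalIntegrable (by fun_prop) _ _
  have i3 : IntervalIntegrable (fun s => c3 * f3 s) volume a b :=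
    Continuous.intervalIntegrable (by fun_prop) _ _
  have := intervalIntegral.integral_mono_on hab (cf.intervalIntegrable _ _) ((i1.add i2).add i3) H
  rwa [intervalIntegral.integral_add (i1.add i2) i3, intervalIntegral.integral_add i1 i2,
    intervalIntegral.integral_const_mul, intervalIntegral.integral_const_mul,
    intervalIntegral.integral_const_mul] at this

theorem abs_arctan_le (x : ℝ) : |Real.arctan x| ≤ 2 := by
  have h1 := Real.arctan_lt_pi_div_two x
  have h2 := Real.neg_pi_div_two_lt_arctan x
  have := Real.pi_lt_four
  rw [abs_le]; constructor <;> linarith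

theorem young_pos {A Bb q g ψ : ℝ} (hA : 0 ≤ A) (hB : 0 ≤ Bb) (hq : 0 ≤ q) :
    Bb^2 * A * (2 * |ψ| * q * g) ≤ 4 * (q * g^2 * Bb * A) + (1/4) * (Bb^3 * A * ψ^2 * q) := by
  have : 0 ≤ A * Bb * q * (2 * g - Bb * |ψ| / 2)^2 := by positivity
  have e : |ψ|^2 = ψ^2 := sq_abs ψ
  rw [← e]
  nlinarith

noncomputable section
variable {d : ℕ} {om a b y : ℝ} {U N p τ : ℝ → ℝ}

def gp (om : ℝ) (d : ℕ) (N τ : ℝ → ℝ) (s : ℝ) : ℝ := max 0 (1 - N s / mm om d τ s)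
def gm (om : ℝ) (d : ℕ) (N τ : ℝ → ℝ) (s : ℝ) : ℝ := max 0 (N s / mm om d τ s - 1)
def Hs (om : ℝ) (d : ℕ) (U N τ : ℝ → ℝ) (s : ℝ) : ℝ :=
  N s * (U s / mm om d τ s - 1)^2 / ((d:ℝ)^2 * max 1 (U s / mm om d τ s))

theorem SD.cgp (h : SD d om a b y U N p τ) : Continuous (gp om d N τ) := by
  unfold gp; have := h.cNm; fun_prop
theorem SD.cgm (h : SD d om a b y U N p τ) : Continuous (gm om d N τ) := by
  unfold gm; have := h.cNm; fun_prop
theorem SD.cHs (h : SD d om a b y U N p τ) : Continuous (Hs om d U N τ) := by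
  have c : Continuous (fun s => U s / mm om d τ s) := h.cU.div h.cm fun s => (h.m0 s).ne'
  have cN := h.cN
  have : (0:ℝ) < d := by exact_mod_cast h.hd
  unfold Hs
  exact Continuous.div (by fun_prop) (by fun_prop) (fun s => by positivity)
theorem SD.Hs0 (h : SD d om a b y U N p τ) (s : ℝ) : 0 ≤ Hs om d U N τ s := by
  have := h.N0 s; unfold Hs; positivity

/-- sign/primitive facts for `∫_y^s g` with `g ≥ 0`. -/
theorem prim_facts {g : ℝ → ℝ} (cg : Continuous g) (g0 : ∀ s, 0 ≤ g s) (y : ℝ) :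
    (∀ s, HasDerivAt (fun s => ∫ r in y..s, g r) (g s) s) ∧
    (∀ s, y ≤ s → 0 ≤ ∫ r in y..s, g r) ∧ (∀ s, s ≤ y → ∫ r in y..s, g r ≤ 0) ∧
    (∫ r in y..y, g r) = 0 := by
  refine ⟨fun s => (cg.integral_hasStrictDerivAt y s).hasDerivAt, fun s hs => ?_, fun s hs => ?_, by simp⟩
  · exact intervalIntegral.integral_nonneg hs (fun _ _ => g0 _)
  · rw [intervalIntegral.integral_symm]
    have := intervalIntegral.integral_nonneg (μ := volume) hs (f := g) (fun _ _ => g0 _)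
    linarith

/-- Poincaré applied to `arctan(J)^2`. -/
theorem SD.poincA (h : SD d om a b y U N p τ) {g : ℝ → ℝ} (cg : Continuous g) (g0 : ∀ s, 0 ≤ g s) :
    ∫ s in a..b, N s * Real.arctan (∫ r in y..s, g r) ^ 2 ≤
      ∫ s in a..b, bt τ s ^ 2 * mm om d τ s *
        (2 * |Real.arctan (∫ r in y..s, g r)| * (1 / (1 + (∫ r in y..s, g r)^2)) * g s) := by
  obtain ⟨hd, -, -, hy⟩ := prim_facts cg g0 y
  set J : ℝ → ℝ := fun s => ∫ r in y..s, g r with hJ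
  have cJ : Continuous J := continuous_iff_continuousAt.2 fun s => (hd s).continuousAt
  have cq : Continuous (fun s => 1 / (1 + J s ^2)) :=
    Continuous.div (by fun_prop) (by fun_prop) (fun s => by positivity)
  have cA : Continuous (fun s => Real.arctan (J s)) := Real.continuous_arctan.comp cJ
  have := h.poinc (fun s => Real.arctan (J s) ^ 2)
    (fun s => 2 * Real.arctan (J s) * (1 / (1 + J s ^2) * g s))
    (by fun_prop) (fun s => by
      have := ((hd s).arctan).pow 2
      refine this.congr_deriv ?_
      simp [hJ]) (fun s => by positivity) (by simp [hJ])
  refine this.trans (le_of_eq ?_)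
  apply intervalIntegral.integral_congr
  intro s _
  simp only
  rw [abs_mul, abs_mul, abs_mul, abs_of_nonneg (g0 s), abs_of_nonneg (by positivity : 0 ≤ 1 / (1 + J s ^2))]
  simp only [abs_two, mul_assoc, hJ]

theorem SD.gp1 (h : SD d om a b y U N p τ) (s : ℝ) : gp om d N τ s ≤ 1 := by
  unfold gp
  have : 0 ≤ N s / mm om d τ s := div_nonneg (h.N0 s) (h.m0 s).le
  simp [this]

theorem SD.Q10 (h : SD d om a b y U N p τ) (J : ℝ → ℝ)
    (hJ : J = fun s => ∫ r in y..s, gp om d N τ r) :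
    ∫ s in a..b, N s * Real.arctan (J s) ^ 2 ≤
      10 * ∫ s in a..b, (1 / (1 + J s^2)) * gp om d N τ s ^ 2 * bt τ s * mm om d τ s := by
  have hab := h.hay.trans h.hyb
  have g0 : ∀ s, 0 ≤ gp om d N τ s := fun s => le_max_left _ _
  have P := h.poincA h.cgp g0
  obtain ⟨hd, -, -, hy⟩ := prim_facts h.cgp g0 y
  rw [← hJ] at hd
  have cJ : Continuous J := continuous_iff_continuousAt.2 fun s => (hd s).continuousAt
  have cq : Continuous (fun s => 1 / (1 + J s ^2)) :=
    Continuous.div (by fun_prop) (by fun_prop) (fun s => by positivity)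
  have cA : Continuous (fun s => Real.arctan (J s)) := Real.continuous_arctan.comp cJ
  have cN := h.cN; have cb := h.cb; have cm := h.cm; have cg := h.cgp
  have hJs : ∀ s, ∫ r in y..s, gp om d N τ r = J s := fun s => by rw [hJ]
  simp only [hJs] at P
  set V := ∫ s in a..b, (1 / (1 + J s^2)) * gp om d N τ s ^ 2 * bt τ s * mm om d τ s with hV
  set Q := ∫ s in a..b, N s * Real.arctan (J s) ^ 2
  set Z := ∫ s in a..b, bt τ s ^3 * mm om d τ s * Real.arctan (J s) ^ 2 * (1 / (1 + J s^2))
  have q0 : ∀ s, 0 ≤ 1 / (1 + J s^2) := fun s => by positivity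
  have q1 : ∀ s, 1 / (1 + J s^2) ≤ 1 := fun s => by
    rw [div_le_one (by positivity)]; nlinarith [sq_nonneg (J s)]
  have e1 := lin3 hab 4 (1/4) 0 (f := fun s => bt τ s ^ 2 * mm om d τ s *
        (2 * |Real.arctan (J s)| * (1 / (1 + (J s)^2)) * gp om d N τ s))
      (f1 := fun s => (1 / (1 + J s^2)) * gp om d N τ s ^ 2 * bt τ s * mm om d τ s)
      (f2 := fun s => bt τ s ^3 * mm om d τ s * Real.arctan (J s) ^ 2 * (1 / (1 + J s^2)))
      (f3 := fun _ => 0) (by fun_prop) (by fun_prop) (by fun_prop) (by fun_prop)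
      (fun s _ => by
        have := young_pos (ψ := Real.arctan (J s)) (g := gp om d N τ s) (h.m0 s).le (h.b0 s).le (q0 s)
        linarith)
  have e2 := lin3 hab 1 2 (1/2)
      (f := fun s => bt τ s ^3 * mm om d τ s * Real.arctan (J s) ^ 2 * (1 / (1 + J s^2)))
      (f1 := fun s => N s * Real.arctan (J s) ^ 2)
      (f2 := fun s => (1 / (1 + J s^2)) * gp om d N τ s ^ 2 * bt τ s * mm om d τ s)
      (f3 := fun s => bt τ s ^3 * mm om d τ s * Real.arctan (J s) ^ 2 * (1 / (1 + J s^2)))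
       (by fun_prop) (by fun_prop) (by fun_prop) (by fun_prop)
      (fun s _ => by
        have m0 := h.m0 s
        have b0 := h.b0 s
        have b1 := h.b1 s
        have hg := g0 s
        set g := gp om d N τ s with hgdef
        set q := 1 / (1 + J s^2)
        have hq0 := q0 s
        have hq1 := q1 s
        set m := mm om d τ s with hm
        set B := bt τ s
        set A := Real.arctan (J s)
        have hA : |A| ≤ 2 := abs_arctan_le _
        have hA0 := abs_nonneg A
        have hA2 : |A|^2 = A^2 := sq_abs A
        have hmN : m ≤ N s + m * g := by
          have : 1 - N s / m ≤ g := le_max_right _ _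
          have h2 : N s / m * m = N s := div_mul_cancel₀ _ m0.ne'
          nlinarith
        have hB3 : B^3 ≤ 1 := pow_le_one₀ b0.le b1
        have hB31 : B^3 ≤ B := by nlinarith [pow_pos b0 3, mul_nonneg b0.le (sub_nonneg.2 (pow_le_one₀ (n := 2) b0.le b1))]
        have s1 : B^3 * m * A^2 * q ≤ B^3 * (N s + m * g) * A^2 * q := by gcongr
        have s2 : B^3 * N s * A^2 * q ≤ 1 * N s * A^2 * 1 := by
          have := h.N0 s
          gcongr
        have s3 : g * A^2 ≤ 2 * g^2 + A^2/2 := by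
          nlinarith [sq_nonneg (2 * g - |A|), mul_nonneg (mul_nonneg hg hA0) (sub_nonneg.2 hA)]
        have s4 : B^3 * m * q * (g * A^2) ≤ B^3 * m * q * (2 * g^2 + A^2/2) := by gcongr
        have s5 : B^3 * m * q * (2 * g^2) ≤ B * m * q * (2 * g^2) := by gcongr
        nlinarith)
  simp only [intervalIntegral.integral_zero] at e1
  linarith

theorem SD.Hs_gm (h : SD d om a b y U N p τ) (s : ℝ) :
    N s * gm om d N τ s ^ 2 / (1 + gm om d N τ s) ≤ d^2 * Hs om d U N τ s := by
  have m0 := h.m0 s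
  have hN := h.N0 s
  have hNU := h.NU s
  have d0 : (0:ℝ) < d := by exact_mod_cast h.hd
  have hH := h.Hs0 s
  unfold gm
  rcases le_total (N s / mm om d τ s - 1) 0 with hc | hc
  · rw [max_eq_left hc]; simp; positivity
  rw [max_eq_right hc]
  unfold Hs
  set v := N s / mm om d τ s
  have hv : v ≤ U s / mm om d τ s := div_le_div_of_nonneg_right hNU m0.le
  set t := U s / mm om d τ s
  rw [max_eq_right (by linarith : (1:ℝ) ≤ t)]
  have e : (d:ℝ)^2 * (N s * (t-1)^2 / (d^2 * t)) = N s * ((t-1)^2 / t) := by field_simp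
  rw [e, mul_div_assoc]
  have hv1 : 1 ≤ v := by linarith
  refine mul_le_mul_of_nonneg_left ?_ hN
  rw [add_sub_cancel, div_le_div_iff₀ (by linarith) (by linarith)]
  nlinarith [mul_nonneg (sub_nonneg.2 hv) (sub_nonneg.2 (one_le_mul_of_one_le_of_one_le hv1 (hv1.trans hv)))]

theorem psi_gm {g A : ℝ} (hg : 0 ≤ g) (hA : |A| ≤ 2) : |A| * g ≤ (1/4) * A^2 + 4 * (g^2/(1+g)) := by
  have hA2 : |A|^2 = A^2 := sq_abs A
  have hA0 := abs_nonneg A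
  rcases le_total g 1 with h | h
  · have : g^2 / 2 ≤ g^2/(1+g) := by gcongr; linarith
    nlinarith [sq_nonneg (|A|/2 - g), sq_nonneg g]
  · have : g / 2 ≤ g^2/(1+g) := by
      rw [div_le_div_iff₀ (by norm_num) (by linarith)]; nlinarith
    nlinarith [sq_nonneg A]

theorem SD.Qm (h : SD d om a b y U N p τ) (J : ℝ → ℝ)
    (hJ : J = fun s => ∫ r in y..s, gm om d N τ r) :
    ∫ s in a..b, N s * Real.arctan (J s) ^ 2 ≤ 16 * d^2 * ∫ s in a..b, Hs om d U N τ s := by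
  have hab := h.hay.trans h.hyb
  have g0 : ∀ s, 0 ≤ gm om d N τ s := fun s => le_max_left _ _
  have P := h.poincA h.cgm g0
  obtain ⟨hd, -, -, hy⟩ := prim_facts h.cgm g0 y
  rw [← hJ] at hd
  have cJ : Continuous J := continuous_iff_continuousAt.2 fun s => (hd s).continuousAt
  have cq : Continuous (fun s => 1 / (1 + J s ^2)) :=
    Continuous.div (by fun_prop) (by fun_prop) (fun s => by positivity)
  have cA : Continuous (fun s => Real.arctan (J s)) := Real.continuous_arctan.comp cJ
  have cN := h.cN; have cb := h.cb; have cm := h.cm; have cg := h.cgm; have cH := h.cHs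
  have hJs : ∀ s, ∫ r in y..s, gm om d N τ r = J s := fun s => by rw [hJ]
  simp only [hJs] at P
  have e1 := lin3 hab (1/2) (8 * d^2) 0 (f := fun s => bt τ s ^ 2 * mm om d τ s *
        (2 * |Real.arctan (J s)| * (1 / (1 + (J s)^2)) * gm om d N τ s))
      (f1 := fun s => N s * Real.arctan (J s) ^ 2)
      (f2 := fun s => Hs om d U N τ s)
      (f3 := fun _ => 0) (by fun_prop) (by fun_prop) (by fun_prop) (by fun_prop)
      (fun s _ => by
        have m0 := h.m0 s
        have b0 := h.b0 s
        have b1 := h.b1 s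
        have hg := g0 s
        have hN := h.N0 s
        have hk := h.Hs_gm s
        have hps := psi_gm hg (abs_arctan_le (J s))
        have q1 : 1 / (1 + J s^2) ≤ 1 := by
          rw [div_le_one (by positivity)]; nlinarith [sq_nonneg (J s)]
        have hmg : mm om d τ s * gm om d N τ s ≤ N s * gm om d N τ s := by
          unfold gm
          rcases le_total (N s / mm om d τ s - 1) 0 with hc | hc
          · rw [max_eq_left hc]; simp
          · rw [max_eq_right hc]
            have : mm om d τ s ≤ N s := by
              rw [sub_nonneg, le_div_iff₀ m0] at hc; linarith
            gcongr
        have hA0 := abs_nonneg (Real.arctan (J s))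
        calc bt τ s ^ 2 * mm om d τ s * (2 * |Real.arctan (J s)| * (1 / (1 + (J s)^2)) * gm om d N τ s)
            ≤ 1 * mm om d τ s * (2 * |Real.arctan (J s)| * 1 * gm om d N τ s) := by
              gcongr
              exact pow_le_one₀ b0.le b1
          _ = 2 * |Real.arctan (J s)| * (mm om d τ s * gm om d N τ s) := by ring
          _ ≤ 2 * |Real.arctan (J s)| * (N s * gm om d N τ s) := by gcongr
          _ = 2 * N s * (|Real.arctan (J s)| * gm om d N τ s) := by ring
          _ ≤ 2 * N s * ((1/4) * (Real.arctan (J s))^2 + 4 * (gm om d N τ s^2/(1+gm om d N τ s))) := by gcongr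
          _ = 1/2 * (N s * Real.arctan (J s) ^ 2) + 8 * (N s * gm om d N τ s ^ 2 / (1 + gm om d N τ s)) := by ring
          _ ≤ _ := by linarith)
  simp only [intervalIntegral.integral_zero] at e1
  linarith
end
open MeasureTheory Metric Set

theorem ptwise {n T B m N U p c σ σ' c' ε A g q : ℝ} (hn : 0 ≤ n) (hB : 0 < B) (hB1 : B ≤ 1)
    (hT : |T| ≤ 1) (hm : 0 < m) (hN : 0 ≤ N) (hNU : N ≤ U) (am : n * N ≤ B * p + N / m * U)
    (hc : 1/2 ≤ c) (hc1 : c ≤ 1) (hcs : c^2 = 1 - σ^2) (hσ : σ = -ε * A) (hA : |A| ≤ 2)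
    (hTσ : T * σ ≤ 0) (hg : 0 ≤ g) (hg1 : g ≤ 1) (hq : 0 ≤ q) (hq1 : q ≤ 1)
    (hgm : g * (m - N) = m * g^2) (hσ' : σ' = -ε * (q * g)) (hc' : c' = -(σ * σ') / c) (hε : 0 < ε) :
    n * N + ε * (q * g^2 * B * m) - (n+1) * ε^2 * (N * A^2) - ε^2 * (N * g^2)
      - (ε + 4*ε^2) * (U - N) + (-(n * N * T / B) * σ + B * m * σ')
    ≤ (N / m * c + T * c' + (-(T * (N/m) / B) * σ + B * σ')) * U + (B * c - T * σ) * p := by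
  have e : (N / m * c + T * c' + (-(T * (N/m) / B) * σ + B * σ')) * U + (B * c - T * σ) * p
      = U * T * c' + U * B * σ' + (c - T * σ / B) * (B * p + N / m * U) := by
    field_simp; ring
  have hk : 0 ≤ c - T * σ / B := by
    have : T * σ / B ≤ 0 := div_nonpos_of_nonpos_of_nonneg hTσ hB.le
    linarith
  have h1 := mul_le_mul_of_nonneg_left am hk
  have h2 : (c - T * σ / B) * (n * N) = n * N * c + (-(n * N * T / B) * σ) := by ring
  have h3 : 1 - c ≤ ε^2 * A^2 := by
    have : σ^2 = ε^2 * A^2 := by rw [hσ]; ring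
    nlinarith
  have h4 : n * N * (1 - c) ≤ n * N * (ε^2 * A^2) := mul_le_mul_of_nonneg_left h3 (mul_nonneg hn hN)
  have h5 : U * B * σ' = B * m * σ' + (ε * (q * g^2 * B * m) - ε * q * g * B * (U - N)) := by
    rw [hσ']; linear_combination ε * q * B * hgm
  have h6 : q * g * B * (U - N) ≤ 1 * 1 * 1 * (U - N) := by
    have : 0 ≤ U - N := by linarith
    gcongr
  have hA0 := abs_nonneg A
  have hA2 : |A|^2 = A^2 := sq_abs A
  have h7 : |c'| ≤ ε^2 * (2 * |A| * g) := by
    have : c' = -(ε^2 * (A * q * g)) / c := by rw [hc', hσ, hσ']; ring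
    rw [this, abs_div, abs_neg, abs_mul, abs_mul, abs_mul, abs_of_nonneg hq, abs_of_nonneg hg,
      abs_of_nonneg (sq_nonneg ε), abs_of_pos (by linarith : 0 < c), div_le_iff₀ (by linarith)]
    calc ε^2 * (|A| * q * g) ≤ ε^2 * (|A| * 1 * g) := by gcongr
      _ = ε^2 * (2 * |A| * g) * (1/2) := by ring
      _ ≤ _ := by gcongr
  have h8 : U * |T * c'| ≤ U * (1 * (ε^2 * (2 * |A| * g))) := by
    rw [abs_mul]
    have : 0 ≤ U := hN.trans hNU
    gcongr
  have h9 : -(U * |T * c'|) ≤ U * T * c' := by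
    have := mul_le_mul_of_nonneg_left (neg_abs_le (T * c')) (hN.trans hNU)
    linarith
  have h10 : U * (2 * |A| * g) ≤ N * A^2 + N * g^2 + 4 * (U - N) := by
    have a1 : 2 * |A| * g ≤ A^2 + g^2 := by nlinarith [sq_nonneg (|A| - g)]
    have a2 : 2 * |A| * g ≤ 4 := by
      calc 2 * |A| * g ≤ 2 * 2 * 1 := by gcongr
        _ = 4 := by norm_num
    have := mul_le_mul_of_nonneg_left a1 hN
    have := mul_le_mul_of_nonneg_left a2 (sub_nonneg.2 hNU)
    linarith
  have h11 := mul_le_mul_of_nonneg_left h10 (sq_nonneg ε)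
  have h12 := mul_le_mul_of_nonneg_left h6 hε.le
  rw [e]
  linarith

theorem Ng2_le {d m N U g : ℝ} (hd : 0 < d) (hm : 0 < m) (hN : 0 ≤ N) (hNU : N ≤ U)
    (hg : g = max 0 (1 - N/m)) :
    N * g^2 ≤ 2 * d^2 * (N * (U/m-1)^2 / (d^2 * max 1 (U/m))) + 2 * (U - N) := by
  have e : 2 * d^2 * (N * (U/m-1)^2 / (d^2 * max 1 (U/m))) = 2 * (N * (U/m-1)^2 / max 1 (U/m)) := by
    have : 0 < max 1 (U/m) := by positivity
    field_simp
  rw [e]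
  have hH : 0 ≤ N * (U/m-1)^2 / max 1 (U/m) := by positivity
  rcases le_total (1 - N/m) 0 with h | h
  · rw [hg, max_eq_left h]; simp; linarith
  rw [max_eq_right h] at hg
  have hv : N / m ≤ 1 := by linarith
  set v := N / m with hvd
  have hNv : N = v * m := by rw [hvd]; field_simp
  have hv0 : 0 ≤ v := by positivity
  set t := U / m with htd
  have hUt : U = t * m := by rw [htd]; field_simp
  have hvt : v ≤ t := by rw [hNv, hUt] at hNU; exact le_of_mul_le_mul_right hNU hm
  rcases le_total t 1 with h1 | h1
  · rw [max_eq_left h1, div_one, hg]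
    have a1 : (1-v)^2 ≤ 2*(t-1)^2 + 2*(t-v)^2 := by nlinarith [sq_nonneg (t-1+(t-v))]
    have a2 : N * (t-v)^2 ≤ U - N := by
      rw [hNv, hUt]
      have : v * (t-v)^2 ≤ t - v := by nlinarith [mul_nonneg hv0 (sub_nonneg.2 hvt)]
      nlinarith
    nlinarith
  · have a1 : N * g^2 ≤ U - N := by
      rw [hg, hNv, hUt]
      have : v * (1-v)^2 ≤ t - v := by nlinarith [mul_nonneg hv0 (sub_nonneg.2 hv), mul_nonneg (mul_nonneg hv0 (sub_nonneg.2 hv)) hv0]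
      nlinarith
    linarith

noncomputable section
variable {d : ℕ} {om a b y : ℝ} {U N p τ : ℝ → ℝ}

def HH (a b : ℝ) (U p : ℝ → ℝ) (Pt : ℝ) : Prop :=
  ∀ α α' β : ℝ → ℝ, (∀ s, HasDerivAt α (α' s) s) → Continuous α' → Continuous β → (∀ s, 0 ≤ β s) →
    (∀ s, α s ^2 + β s ^2 ≤ 1) → ∫ s in a..b, (α' s * U s + β s * p s) ≤ Pt

theorem SD.amgm (h : SD d om a b y U N p τ) (s : ℝ) :
    (d+1) * N s + Hs om d U N τ s ≤ bt τ s * p s + N s / mm om d τ s * U s :=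
  slice_amgm d h.hd om (bt τ s) (U s) (N s) (p s) h.hom (h.b0 s) (h.U0 s) (h.N0 s) (h.p0 s)
    (fun h0 => le_antisymm (h0 ▸ h.NU s) (h.N0 s)) (h.sl s)

theorem SD.intHs (h : SD d om a b y U N p τ) {Pt : ℝ} (H : HH a b U p Pt) :
    ∫ s in a..b, Hs om d U N τ s ≤ Pt - (d+1) * ∫ s in a..b, N s := by
  have hab := h.hay.trans h.hyb
  have h1 := H τ (fun s => N s / mm om d τ s) (bt τ) h.τd h.cNm h.cb (fun s => (h.b0 s).le)
    (fun s => by rw [h.bsq]; linarith)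
  have cNm := h.cNm; have cU := h.cU; have cp := h.cp; have cb := h.cb
  have h2 := lin3 hab 1 (-(d+1)) 0 h.cHs
    (f1 := fun s => N s / mm om d τ s * U s + bt τ s * p s) (f3 := fun _ => 0)
    (by fun_prop) h.cN continuous_const (fun s _ => by have := h.amgm s; linarith)
  simp only [intervalIntegral.integral_zero] at h2
  linarith

set_option maxHeartbeats 800000 in
theorem SD.Vbd (h : SD d om a b y U N p τ) {Pt : ℝ} (H : HH a b U p Pt) (J : ℝ → ℝ)
    (hJ : J = fun s => ∫ r in y..s, gp om d N τ r) :
    ∫ s in a..b, (1 / (1 + J s^2)) * gp om d N τ s ^ 2 * bt τ s * mm om d τ s ≤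
      (100 * (d+2)^3) * ((Pt - (d+1) * ∫ s in a..b, N s) + (∫ s in a..b, (U s - N s))
        + om * (bt τ a ^ (d+1) + bt τ b ^ (d+1))) := by
  have hab := h.hay.trans h.hyb
  have g0 : ∀ s, 0 ≤ gp om d N τ s := fun s => le_max_left _ _
  obtain ⟨Jd, Jp, Jn, Jy⟩ := prim_facts h.cgp g0 y
  simp only [← hJ] at Jd
  have hJs : ∀ s, ∫ r in y..s, gp om d N τ r = J s := fun s => by rw [hJ]
  simp only [hJs] at Jp Jn
  have cJ : Continuous J := continuous_iff_continuousAt.2 fun s => (Jd s).continuousAt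
  set q : ℝ → ℝ := fun s => 1 / (1 + J s^2) with hq
  have cq : Continuous q :=
    Continuous.div (by fun_prop) (by fun_prop) (fun s => by positivity)
  set A : ℝ → ℝ := fun s => Real.arctan (J s) with hA
  have cA : Continuous A := Real.continuous_arctan.comp cJ
  have cN := h.cN; have cb := h.cb; have cm := h.cm; have cg := h.cgp; have cU := h.cU
  have cp := h.cp; have cNm := h.cNm; have cτ := h.cτ
  have q0 : ∀ s, 0 ≤ q s := fun s => by simp only [hq]; positivity
  have q1 : ∀ s, q s ≤ 1 := fun s => by
    simp only [hq]
    rw [div_le_one (by positivity)]; nlinarith [sq_nonneg (J s)]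
  have d1 : (1:ℝ) ≤ d := by exact_mod_cast h.hd
  set ε : ℝ := 1 / (20 * (d+2)) with hε
  have hε0 : 0 < ε := by positivity
  have hεd : 20 * (d+2) * ε = 1 := by rw [hε]; field_simp
  have hε1 : ε ≤ 1/60 := by nlinarith
  set σ : ℝ → ℝ := fun s => -ε * A s with hσ
  set σ' : ℝ → ℝ := fun s => -ε * (q s * gp om d N τ s) with hσ'
  have σd : ∀ s, HasDerivAt σ (σ' s) s := fun s => ((Jd s).arctan).const_mul (-ε)
  have A2 : ∀ s, |A s| ≤ 2 := fun s => abs_arctan_le _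
  have hσ2 : ∀ s, σ s ^ 2 ≤ 1/4 := fun s => by
    have := abs_le.1 (A2 s)
    have h4 : A s ^ 2 ≤ 4 := by nlinarith
    have : σ s ^2 = ε^2 * A s ^2 := by simp only [hσ]; ring
    rw [this]; nlinarith
  set c : ℝ → ℝ := fun s => √(1 - σ s ^2) with hc
  set c' : ℝ → ℝ := fun s => -(σ s * σ' s) / c s with hc'
  have csq : ∀ s, c s ^2 = 1 - σ s^2 := fun s => Real.sq_sqrt (by linarith [hσ2 s])
  have c0 : ∀ s, 0 ≤ c s := fun s => Real.sqrt_nonneg _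
  have ch : ∀ s, 1/2 ≤ c s := fun s => by
    have := csq s; have := hσ2 s; have := c0 s; nlinarith
  have c1 : ∀ s, c s ≤ 1 := fun s => by
    have := csq s; have := c0 s; nlinarith [sq_nonneg (σ s)]
  have cd : ∀ s, HasDerivAt c (c' s) s := fun s => by
    have h1 : HasDerivAt (fun s => 1 - σ s ^ 2) (-(2 * σ s * σ' s)) s := by
      refine (((σd s).pow 2).const_sub 1).congr_deriv ?_; simp
    refine (h1.sqrt (by linarith [hσ2 s])).congr_deriv ?_
    change _ / (2 * c s) = _
    have := ch s
    simp only [hc']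
    field_simp
  have cσ : Continuous σ := continuous_iff_continuousAt.2 fun s => (σd s).continuousAt
  have cc : Continuous c := continuous_iff_continuousAt.2 fun s => (cd s).continuousAt
  have cσ' : Continuous σ' := by fun_prop
  have cc' : Continuous c' := Continuous.div (by fun_prop) cc (fun s => by have := ch s; positivity)
  have cbd : Continuous (fun s => -(τ s * (N s / mm om d τ s) / bt τ s)) :=
    (Continuous.div (by fun_prop) cb (fun s => (h.b0 s).ne')).neg
  have cX : Continuous (fun s => -((d+1) * N s * τ s / bt τ s)) :=
    (Continuous.div (by fun_prop) cb (fun s => (h.b0 s).ne')).neg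
  have hTσ : ∀ s, τ s * σ s ≤ 0 := fun s => by
    have : 0 ≤ τ s * A s := by
      rcases le_total y s with hs | hs
      · exact mul_nonneg (h.τpos hs) (Real.arctan_nonneg.2 (Jp s hs))
      · exact mul_nonneg_of_nonpos_of_nonpos (h.τneg hs) (by
          have := Real.arctan_nonneg.2 (neg_nonneg.2 (Jn s hs))
          rw [Real.arctan_neg] at this; linarith)
    simp only [hσ]; nlinarith
  have HB := H (fun s => τ s * c s + bt τ s * σ s)
    (fun s => (N s / mm om d τ s * c s + τ s * c' s) + (-(τ s * (N s / mm om d τ s) / bt τ s) * σ s + bt τ s * σ' s))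
    (fun s => bt τ s * c s - τ s * σ s)
    (fun s => ((h.τd s).mul (cd s)).add ((h.bd s).mul (σd s))) (by fun_prop) (by fun_prop)
    (fun s => by
      have := mul_nonneg (h.b0 s).le (c0 s)
      linarith [hTσ s])
    (fun s => by
      have h1 := csq s; have h2 := h.bsq s
      have : (τ s * c s + bt τ s * σ s)^2 + (bt τ s * c s - τ s * σ s)^2
        = (τ s^2 + bt τ s ^2) * (c s^2 + σ s^2) := by ring
      rw [this, h1, h2]; ring_nf; exact le_refl _)
  -- boundary primitive
  have Xd : ∀ s, HasDerivAt (fun s => om * bt τ s ^(d+1) * σ s)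
      (-((d+1) * N s * τ s / bt τ s) * σ s + bt τ s * mm om d τ s * σ' s) s := fun s => by
    refine ((((h.bd s).pow (d+1)).const_mul om).mul (σd s)).congr_deriv ?_
    have hb := h.b0 s
    have hom := h.hom
    simp only [mm, Pi.pow_apply]
    push_cast
    try simp only [Nat.add_sub_cancel]
    field_simp
    ring
  have cXX : Continuous (fun s => -((d+1) * N s * τ s / bt τ s) * σ s + bt τ s * mm om d τ s * σ' s) := by
    fun_prop
  have IX := intervalIntegral.integral_eq_sub_of_hasDerivAt (a := a) (b := b) (fun s _ => Xd s)
    (cXX.intervalIntegrable _ _)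
  have hσb : ∀ s, |σ s| ≤ 2 * ε := fun s => by
    simp only [hσ]; rw [abs_mul, abs_neg, abs_of_pos hε0]; nlinarith [A2 s]
  have hom := h.hom
  have hXb : -(2 * ε * (om * bt τ b ^ (d+1))) ≤ om * bt τ b ^ (d+1) * σ b := by
    have := (abs_le.1 (hσb b)).1
    have hb := h.b0 b
    have := mul_le_mul_of_nonneg_left this (by positivity : 0 ≤ om * bt τ b ^ (d+1))
    linarith
  have hXa : om * bt τ a ^ (d+1) * σ a ≤ (2 * ε * (om * bt τ a ^ (d+1))) := by
    have := (abs_le.1 (hσb a)).2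
    have hb := h.b0 a
    have := mul_le_mul_of_nonneg_left this (by positivity : 0 ≤ om * bt τ a ^ (d+1))
    linarith
  have cH := h.cHs
  -- combine
  set F := fun s => ((N s / mm om d τ s * c s + τ s * c' s) + (-(τ s * (N s / mm om d τ s) / bt τ s) * σ s + bt τ s * σ' s)) * U s
    + (bt τ s * c s - τ s * σ s) * p s with hF
  have cF : Continuous F := by fun_prop
  set Y := fun s => (-((d+1) * N s * τ s / bt τ s) * σ s + bt τ s * mm om d τ s * σ' s) with hY
  have step1 := lin3 hab 1 (-1) (-(d+1)) (f := fun s => ε * (q s * gp om d N τ s ^ 2 * bt τ s * mm om d τ s)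
      - ((d+2) * ε^2) * (N s * A s ^2) - (2 * d^2 * ε^2) * Hs om d U N τ s - (ε + 6 * ε^2) * (U s - N s))
      (f1 := F) (f2 := Y) (f3 := N) (by fun_prop) cF cXX cN (fun s _ => by
        have := ptwise (n := d+1) (T := τ s) (B := bt τ s) (m := mm om d τ s) (N := N s) (U := U s) (p := p s)
          (c := c s) (σ := σ s) (σ' := σ' s) (c' := c' s) (ε := ε) (A := A s) (g := gp om d N τ s) (q := q s)
          (by positivity) (h.b0 s) (h.b1 s) (h.τ1 s).le (h.m0 s) (h.N0 s) (h.NU s)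
          (by have := h.amgm s; have := h.Hs0 s; linarith) (ch s) (c1 s) (csq s) rfl (A2 s) (hTσ s)
          (g0 s) (h.gp1 s) (q0 s) (q1 s) (by
            have hm := h.m0 s
            unfold gp
            rcases le_total (1 - N s / mm om d τ s) 0 with h | h
            · rw [max_eq_left h]; simp
            · rw [max_eq_right h]; field_simp) rfl rfl hε0
        have n2 := Ng2_le (d := d) (by linarith) (h.m0 s) (h.N0 s) (h.NU s) (g := gp om d N τ s) rfl
        have n3 := mul_le_mul_of_nonneg_left n2 (sq_nonneg ε)
        simp only [hF, hY]
        change _ ≤ ε^2 * (2 * d^2 * Hs om d U N τ s + _) at n3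
        linarith)
  have step2 := lin3 hab 1 ((d+2) * ε^2) 1
      (f := fun s => ε * (q s * gp om d N τ s ^ 2 * bt τ s * mm om d τ s))
      (f1 := fun s => ε * (q s * gp om d N τ s ^ 2 * bt τ s * mm om d τ s)
      - ((d+2) * ε^2) * (N s * A s ^2) - (2 * d^2 * ε^2) * Hs om d U N τ s - (ε + 6 * ε^2) * (U s - N s))
      (f2 := fun s => N s * A s ^ 2)
      (f3 := fun s => (2 * d^2 * ε^2) * Hs om d U N τ s + (ε + 6 * ε^2) * (U s - N s))
      (by fun_prop) (by fun_prop) (by fun_prop) (by fun_prop) (fun s _ => by linarith)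
  have step3 := lin3 hab (2 * d^2 * ε^2) (ε + 6 * ε^2) 0
      (f := fun s => (2 * d^2 * ε^2) * Hs om d U N τ s + (ε + 6 * ε^2) * (U s - N s))
      (f1 := Hs om d U N τ) (f2 := fun s => U s - N s) (f3 := fun _ => 0)
      (by fun_prop) (by fun_prop) (by fun_prop) (by fun_prop) (fun s _ => by linarith)
  have hQ := h.Q10 J hJ
  have hHs := h.intHs H
  rw [intervalIntegral.integral_const_mul] at step2
  set V := ∫ s in a..b, q s * gp om d N τ s ^ 2 * bt τ s * mm om d τ s with hV
  set R := ∫ s in a..b, (U s - N s)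
  set IH := ∫ s in a..b, Hs om d U N τ s
  set IN := ∫ s in a..b, N s
  change _ ≤ 10 * V at hQ
  have R0 : 0 ≤ R := intervalIntegral.integral_nonneg hab (fun s _ => by linarith [h.NU s])
  have H0 : 0 ≤ IH := intervalIntegral.integral_nonneg hab (fun s _ => h.Hs0 s)
  rw [IX] at step1
  set Ea := om * bt τ a ^ (d+1) with hEa
  set Eb := om * bt τ b ^ (d+1)
  have Ea0 : 0 ≤ Ea := by have := (h.b0 a).le; positivity
  have Eb0 : 0 ≤ Eb := by have := (h.b0 b).le; positivity
  have hQ2 := mul_le_mul_of_nonneg_left hQ (by positivity : 0 ≤ (d+2) * ε^2)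
  simp only [zero_mul, add_zero] at step3
  have e5 : (d+2) * ε^2 * (10 * V) = ε * V / 2 := by
    have : (d+2) * ε^2 * (10 * V) = (20 * (d+2) * ε) * (ε * V / 2) := by ring
    rw [this, hεd, one_mul]
  have e6 : 2 * (d:ℝ)^2 * ε^2 ≤ 1/100 := by
    have h1 : d * ε ≤ 1/20 := by linarith
    have h0 : 0 ≤ d * ε := by positivity
    calc 2 * (d:ℝ)^2 * ε^2 = 2 * (d * ε)^2 := by ring
      _ ≤ 2 * (1/20)^2 := by gcongr
      _ ≤ _ := by norm_num
  have e7 : ε + 6 * ε^2 ≤ 1/2 := by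
    calc ε + 6 * ε^2 ≤ 1/60 + 6 * (1/60)^2 := by gcongr
      _ ≤ _ := by norm_num
  have main : ε * V / 2 ≤ (1 + 1/100) * (Pt - (d+1)*IN) + 1/2 * R + 2*ε*(Ea+Eb) := by
    have l1 := mul_le_mul_of_nonneg_right e6 H0
    have l2 := mul_le_mul_of_nonneg_right e7 R0
    linarith
  have main2 : ε * V ≤ 3 * ((Pt - (d+1)*IN) + R + (Ea+Eb)) := by
    have l1 := mul_nonneg (sub_nonneg.2 hε1) (add_nonneg Ea0 Eb0)
    linarith
  have : V ≤ 20 * (d+2) * (3 * ((Pt - (d+1)*IN) + R + (Ea+Eb))) := by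
    calc V = 20 * (d+2) * (ε * V) := by linear_combination (-V) * hεd
      _ ≤ _ := by gcongr
  have h8 : 0 ≤ (Pt - (d+1)*IN) + R + (Ea+Eb) := by linarith
  calc V ≤ _ := this
    _ = (60 * (d+2)) * ((Pt - (d+1)*IN) + R + (Ea+Eb)) := by ring
    _ ≤ (100 * (d+2)^3) * ((Pt - (d+1)*IN) + R + (Ea+Eb)) := by
      refine mul_le_mul_of_nonneg_right ?_ h8
      have : (d:ℝ)+2 ≤ (d+2)^3 := le_self_pow₀ (by linarith) (by norm_num)
      linarith
    _ = _ := by rw [mul_add om]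
end
open MeasureTheory Metric Set

theorem UNgm_le {d m N U g : ℝ} (hd : 0 < d) (hm : 0 < m) (hN : 0 ≤ N) (hNU : N ≤ U)
    (hg : g = max 0 (N/m - 1)) :
    (U - N) * g ≤ 4 * d^2 * (N * (U/m-1)^2 / (d^2 * max 1 (U/m))) + (U - N) := by
  have e : 4 * d^2 * (N * (U/m-1)^2 / (d^2 * max 1 (U/m))) = 4 * (N * (U/m-1)^2 / max 1 (U/m)) := by
    have : 0 < max 1 (U/m) := by positivity
    field_simp
  rw [e]
  have hH : 0 ≤ N * (U/m-1)^2 / max 1 (U/m) := by positivity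
  have hvt : N / m ≤ U / m := div_le_div_of_nonneg_right hNU hm.le
  rcases le_total g 1 with h | h
  · nlinarith
  have hg' : g = N/m - 1 := by
    rcases le_total (N/m - 1) 0 with h' | h'
    · rw [max_eq_left h'] at hg; linarith
    · rw [hg, max_eq_right h']
  set v := N / m with hvd
  have hNv : N = v * m := by rw [hvd]; field_simp
  set t := U / m with htd
  have hUt : U = t * m := by rw [htd]; field_simp
  rw [max_eq_right (by linarith : (1:ℝ) ≤ t)]
  have : t ≤ 4 * ((t-1)^2 / t) := by
    rw [← mul_div_assoc, le_div_iff₀ (by linarith)]; nlinarith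
  have h2 := mul_le_mul_of_nonneg_left this hN
  have h3 : (U - N) * g ≤ N * t := by
    rw [hg', hNv, hUt]
    have : (t - v) * (v - 1) ≤ v * t := by nlinarith
    nlinarith
  have h4 : N * (t-1)^2 / t = N * ((t-1)^2 / t) := by ring
  rw [h4]
  linarith

theorem arctan_sq_le {w j k : ℝ} (h : (0 ≤ j ∧ 0 ≤ k) ∨ (j ≤ 0 ∧ k ≤ 0)) (hw : w = j - k) :
    Real.arctan w ^ 2 ≤ Real.arctan j ^ 2 + Real.arctan k ^ 2 := by
  have key : ∀ j k : ℝ, 0 ≤ j → 0 ≤ k → Real.arctan (j - k) ^ 2 ≤ Real.arctan j ^ 2 + Real.arctan k ^ 2 := by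
    intro j k hj hk
    have h1 : Real.arctan (j - k) ≤ Real.arctan j := Real.arctan_strictMono.monotone (by linarith)
    have h2 : Real.arctan (-k) ≤ Real.arctan (j - k) := Real.arctan_strictMono.monotone (by linarith)
    rw [Real.arctan_neg] at h2
    have h3 := Real.arctan_nonneg.2 hj
    have h4 := Real.arctan_nonneg.2 hk
    rcases le_total 0 (Real.arctan (j-k)) with h | h <;> nlinarith
  subst hw
  rcases h with ⟨h1, h2⟩ | ⟨h1, h2⟩
  · exact key j k h1 h2
  · have := key (-j) (-k) (by linarith) (by linarith)
    have e : -j - -k = -(j - k) := by ring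
    rw [e, Real.arctan_neg, Real.arctan_neg, Real.arctan_neg] at this
    nlinarith

noncomputable section
variable {d : ℕ} {om a b y : ℝ} {U N p τ : ℝ → ℝ}

def GG (y : ℝ) (τ : ℝ → ℝ) (s : ℝ) : ℝ := Real.arctan (s - y - τ s) ^ 2 / 4
def GG' (om : ℝ) (d : ℕ) (y : ℝ) (N τ : ℝ → ℝ) (s : ℝ) : ℝ :=
  Real.arctan (s - y - τ s) / 2 * (1 / (1 + (s - y - τ s)^2) * (1 - N s / mm om d τ s))

def CD (d : ℕ) : ℝ := 2 * (10 * (100 * ((d:ℝ)+2)^3) + 16 * d^2) + 7 * d^2 + 3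

theorem SD.GGd (h : SD d om a b y U N p τ) (s : ℝ) :
    HasDerivAt (GG y τ) (GG' om d y N τ s) s := by
  have h1 : HasDerivAt (fun s => s - y - τ s) (1 - N s / mm om d τ s) s :=
    ((hasDerivAt_id s).sub_const y).sub (h.τd s)
  refine (((h1.arctan).pow 2).div_const 4).congr_deriv ?_
  simp [GG']; ring
theorem SD.cGG (h : SD d om a b y U N p τ) : Continuous (GG y τ) :=
  continuous_iff_continuousAt.2 fun s => (h.GGd s).continuousAt
theorem SD.cGG' (h : SD d om a b y U N p τ) : Continuous (GG' om d y N τ) := by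
  have cNm := h.cNm; have cτ := h.cτ
  have cA : Continuous (fun s => Real.arctan (s - y - τ s)) := Real.continuous_arctan.comp (by fun_prop)
  have cq : Continuous (fun s => 1 / (1 + (s - y - τ s)^2)) :=
    Continuous.div (by fun_prop) (by fun_prop) (fun s => by positivity)
  unfold GG'
  fun_prop

set_option maxHeartbeats 800000 in
theorem SD.lemD (h : SD d om a b y U N p τ) {Pt : ℝ} (H : HH a b U p Pt) :
    (∫ s in a..b, (GG y τ s * N s + |GG' om d y N τ s| * U s)) ≤
      CD d * ((Pt - (d+1) * ∫ s in a..b, N s) + (∫ s in a..b, (U s - N s))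
        + om * (bt τ a ^ (d+1) + bt τ b ^ (d+1))) := by
  have hab := h.hay.trans h.hyb
  have g0 : ∀ s, 0 ≤ gp om d N τ s := fun s => le_max_left _ _
  have gm0 : ∀ s, 0 ≤ gm om d N τ s := fun s => le_max_left _ _
  obtain ⟨Jd, Jp, Jn, Jy⟩ := prim_facts h.cgp g0 y
  obtain ⟨Kd, Kp, Kn, Ky⟩ := prim_facts h.cgm gm0 y
  have V := h.Vbd H _ rfl
  have Q := h.Q10 _ rfl
  have Qm := h.Qm _ rfl
  have IH := h.intHs H
  set J : ℝ → ℝ := fun s => ∫ r in y..s, gp om d N τ r with hJ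
  set K : ℝ → ℝ := fun s => ∫ r in y..s, gm om d N τ r with hK
  have cJ : Continuous J := continuous_iff_continuousAt.2 fun s => (Jd s).continuousAt
  have cK : Continuous K := continuous_iff_continuousAt.2 fun s => (Kd s).continuousAt
  have cN := h.cN; have cU := h.cU; have cH := h.cHs; have cG := h.cGG; have cG' := h.cGG'
  have cτ := h.cτ; have cNm := h.cNm
  have cgp := h.cgp; have cgm := h.cgm
  have cAJ : Continuous (fun s => Real.arctan (J s)) := Real.continuous_arctan.comp cJ
  have cAK : Continuous (fun s => Real.arctan (K s)) := Real.continuous_arctan.comp cK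
  have cAw : Continuous (fun s => Real.arctan (s - y - τ s)) := Real.continuous_arctan.comp (by fun_prop)
  have hgg : ∀ s, gp om d N τ s - gm om d N τ s = 1 - N s / mm om d τ s := fun s => by
    unfold gp gm
    rcases le_total (N s / mm om d τ s) 1 with h | h
    · rw [max_eq_right (by linarith), max_eq_left (by linarith)]; ring
    · rw [max_eq_left (by linarith), max_eq_right (by linarith)]; ring
  have hgga : ∀ s, |1 - N s / mm om d τ s| = gp om d N τ s + gm om d N τ s := fun s => by
    unfold gp gm
    rcases le_total (N s / mm om d τ s) 1 with h | h
    · rw [max_eq_right (by linarith), max_eq_left (by linarith), abs_of_nonneg (by linarith)]; ring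
    · rw [max_eq_left (by linarith), max_eq_right (by linarith), abs_of_nonpos (by linarith)]; ring
  have hw : ∀ s, s - y - τ s = J s - K s := fun s => by
    simp only [hJ, hK]
    rw [← intervalIntegral.integral_sub (cgp.intervalIntegrable _ _) (cgm.intervalIntegrable _ _)]
    simp only [hgg]
    rw [intervalIntegral.integral_sub (by simp) (cNm.intervalIntegrable _ _),
      intervalIntegral.integral_eq_sub_of_hasDerivAt (fun s _ => h.τd s) (cNm.intervalIntegrable _ _), h.τy]
    simp
  have hψ : ∀ s, Real.arctan (s - y - τ s)^2 ≤ Real.arctan (J s)^2 + Real.arctan (K s)^2 := fun s => by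
    apply arctan_sq_le _ (hw s)
    rcases le_total y s with hs | hs
    · exact Or.inl ⟨Jp s hs, Kp s hs⟩
    · exact Or.inr ⟨Jn s hs, Kn s hs⟩
  have d0 : (0:ℝ) < d := by exact_mod_cast h.hd
  have s1 := lin3 hab 1 1 0 (f := fun s => N s * Real.arctan (s - y - τ s)^2)
    (f1 := fun s => N s * Real.arctan (J s)^2) (f2 := fun s => N s * Real.arctan (K s)^2) (f3 := fun _ => 0)
    (by fun_prop) (by fun_prop) (by fun_prop) (by fun_prop) (fun s _ => by
      have := mul_le_mul_of_nonneg_left (hψ s) (h.N0 s); linarith)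
  have s2 := lin3 hab 2 (7 * d^2) 3 (f := fun s => GG y τ s * N s + |GG' om d y N τ s| * U s)
    (f1 := fun s => N s * Real.arctan (s - y - τ s)^2) (f2 := Hs om d U N τ) (f3 := fun s => U s - N s)
    (by fun_prop) (by fun_prop) cH (by fun_prop) (fun s _ => by
      have hN := h.N0 s
      have hNU := h.NU s
      have hUN : 0 ≤ U s - N s := by linarith
      have n1 := Ng2_le d0 (h.m0 s) hN hNU (g := gp om d N τ s) rfl
      have n2 := UNgm_le d0 (h.m0 s) hN hNU (g := gm om d N τ s) rfl
      change _ ≤ 2 * (d:ℝ)^2 * Hs om d U N τ s + _ at n1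
      change _ ≤ 4 * (d:ℝ)^2 * Hs om d U N τ s + _ at n2
      have n3 := h.Hs_gm s
      have n4 := psi_gm (gm0 s) (abs_arctan_le (s - y - τ s))
      have n5 := abs_arctan_le (s - y - τ s)
      have hgp1 := h.gp1 s
      have hgp0 := g0 s
      have hgm0 := gm0 s
      have hH0 := mul_nonneg (sq_nonneg (d:ℝ)) (h.Hs0 s)
      set g := gp om d N τ s
      set k := gm om d N τ s
      set H := Hs om d U N τ s
      set A := Real.arctan (s - y - τ s) with hA
      have hA0 := abs_nonneg A
      have hA2 : |A|^2 = A^2 := sq_abs A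
      have b1 : |GG' om d y N τ s| ≤ |A| / 2 * (g + k) := by
        unfold GG'
        rw [abs_mul, abs_mul, hgga, abs_div, abs_two,
          abs_of_nonneg (by positivity : 0 ≤ 1 / (1 + (s - y - τ s)^2))]
        have : 1 / (1 + (s - y - τ s)^2) ≤ 1 := by
          rw [div_le_one (by positivity)]; nlinarith [sq_nonneg (s - y - τ s)]
        have : 1 / (1 + (s - y - τ s)^2) * (g + k) ≤ 1 * (g + k) := by gcongr
        rw [one_mul] at this
        exact mul_le_mul_of_nonneg_left this (by positivity)
      have b2 := mul_le_mul_of_nonneg_right b1 (h.U0 s)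
      have c1 : N s * (|A| * g) ≤ 1/2 * (N s * A^2) + 1/2 * (N s * g^2) := by
        have : |A| * g ≤ 1/2 * A^2 + 1/2 * g^2 := by nlinarith [sq_nonneg (|A| - g)]
        have := mul_le_mul_of_nonneg_left this hN
        linarith
      have c2 : N s * (|A| * k) ≤ 1/4 * (N s * A^2) + 4 * (N s * k^2 / (1 + k)) := by
        have := mul_le_mul_of_nonneg_left n4 hN
        have e : N s * (k^2 / (1+k)) = N s * k^2 / (1 + k) := by ring
        linarith
      have c3 : (U s - N s) * (|A| * g) ≤ 2 * (U s - N s) := by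
        have : |A| * g ≤ 2 * 1 := by gcongr
        have := mul_le_mul_of_nonneg_left this hUN
        linarith
      have c4 : (U s - N s) * (|A| * k) ≤ 2 * ((U s - N s) * k) := by
        have := mul_le_mul_of_nonneg_right n5 (mul_nonneg hUN hgm0)
        linarith
      have hNA : 0 ≤ N s * A^2 := by positivity
      have c5 : GG y τ s * N s = N s * A^2 / 4 := by unfold GG; rw [← hA]; ring
      rw [c5]
      linarith)
  set IN := ∫ s in a..b, N s
  set R := ∫ s in a..b, (U s - N s)
  set E := om * (bt τ a ^ (d+1) + bt τ b ^ (d+1))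
  have R0 : 0 ≤ R := intervalIntegral.integral_nonneg hab (fun s _ => by linarith [h.NU s])
  have E0 : 0 ≤ E := by
    have := (h.b0 a).le; have := (h.b0 b).le; have := h.hom; positivity
  have H0 : 0 ≤ ∫ s in a..b, Hs om d U N τ s :=
    intervalIntegral.integral_nonneg hab (fun s _ => h.Hs0 s)
  simp only [zero_mul, add_zero, one_mul] at s1
  have t1 : ∫ s in a..b, Hs om d U N τ s ≤ (Pt - (d+1) * IN) + R + E := by linarith
  set DD := (Pt - (d+1) * IN) + R + E
  have t2 : R ≤ DD := by linarith
  have t3 := mul_le_mul_of_nonneg_left t1 (by positivity : 0 ≤ 16 * (d:ℝ)^2)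
  have t4 := mul_le_mul_of_nonneg_left t1 (by positivity : 0 ≤ 7 * (d:ℝ)^2)
  unfold CD
  linarith
end
open MeasureTheory Metric Set

theorem end_bound (d : ℕ) {om t : ℝ} (hom : 0 < om) (ht : 0 ≤ t) (ht1 : t < 1) :
    om * √(1 - t^2) ^ (d+2) ≤ 2^(d+2) * ∫ x in t..1, om * √(1 - x^2)^d := by
  have cf : Continuous (fun x : ℝ => om * √(1 - x^2)^d) := by fun_prop
  set r := (1+t)/2 with hr
  have h1 : ∫ x in t..r, om * √(1 - x^2)^d ≤ ∫ x in t..1, om * √(1 - x^2)^d := by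
    rw [← intervalIntegral.integral_add_adjacent_intervals (cf.intervalIntegrable t r) (cf.intervalIntegrable r 1)]
    have : 0 ≤ ∫ x in r..1, om * √(1 - x^2)^d :=
      intervalIntegral.integral_nonneg (by linarith) (fun x _ => by positivity)
    linarith
  have hb : √(1 - t^2) ^2 = 1 - t^2 := Real.sq_sqrt (by nlinarith)
  have h2 : ∫ x in t..r, om * (√(1 - t^2)/2)^d ≤ ∫ x in t..r, om * √(1 - x^2)^d := by
    apply intervalIntegral.integral_mono_on (by linarith) (by simp) (cf.intervalIntegrable _ _)
    intro x hx
    gcongr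
    apply Real.le_sqrt_of_sq_le
    rw [div_pow, hb]
    have : x^2 ≤ r^2 := by
      have := hx.1; have := hx.2; have : 0 ≤ x := by linarith
      gcongr
    have h3 : r^2 = (1+2*t+t^2)/4 := by rw [hr]; ring
    nlinarith
  rw [intervalIntegral.integral_const, smul_eq_mul] at h2
  have h3 : √(1 - t^2)^2/4 ≤ r - t := by rw [hb, hr]; nlinarith
  have h4 : √(1 - t^2)^2/4 * (om * (√(1 - t^2)/2)^d) ≤ (r-t) * (om * (√(1 - t^2)/2)^d) := by gcongr
  have h5 : 2^(d+2) * (√(1 - t^2)^2/4 * (om * (√(1 - t^2)/2)^d)) = om * √(1 - t^2) ^ (d+2) := by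
    rw [div_pow]; field_simp; ring
  rw [← h5]
  gcongr
  linarith

theorem refl_m (d : ℕ) (om x : ℝ) :
    ∫ t in (-1)..x, om * √(1 - t^2)^d = ∫ t in (-x)..1, om * √(1 - t^2)^d := by
  have := intervalIntegral.integral_comp_neg (a := -1) (b := x) (fun t => om * √(1 - t^2)^d)
  simp only [neg_sq, neg_neg] at this
  exact this

theorem pow_split {B η : ℝ} (d : ℕ) (hB : 0 ≤ B) (hB1 : B ≤ 1) (hη : 0 < η) :
    B^(d+1) ≤ η + B^(d+2) / η := by
  rcases le_total B η with h | h
  · have : B^(d+1) ≤ B := by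
      calc B^(d+1) ≤ B^1 := pow_le_pow_of_le_one hB hB1 (by omega)
        _ = B := pow_one B
    have : 0 ≤ B^(d+2)/η := by positivity
    linarith
  · have : B^(d+1) ≤ B^(d+2)/η := by
      rw [le_div_iff₀ hη, pow_succ B (d+1)]; gcongr
    linarith

theorem transport (d : ℕ) {om a b δ : ℝ} (hom : 0 < om) (hab : a ≤ b) (N : ℝ → ℝ)
    (cN : Continuous N) (N0 : ∀ s, 0 ≤ N s) (Nz : ∀ s, s ∉ Icc a b → N s = 0) (hδ : 0 < δ)
    (hT : (∫ s in a..b, N s) + 2 * δ = ∫ t in (-1)..1, om * √(1 - t^2)^d) :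
    ∃ (τ : ℝ → ℝ) (y : ℝ), a ≤ y ∧ y ≤ b ∧ (∀ s, |τ s| < 1) ∧
      (∀ s, HasDerivAt τ (N s / mm om d τ s) s) ∧ τ y = 0 ∧
      ∀ η, 0 < η → η ≤ 1 → om * (bt τ a ^ (d+1) + bt τ b ^ (d+1)) ≤ 2 * om * η + 2^(d+3) * δ / η := by
  set m0 : ℝ → ℝ := fun t => om * √(1 - t^2)^d with hm0
  have cm : Continuous m0 := by fun_prop
  have m0nn : ∀ t, 0 ≤ m0 t := fun t => by simp only [hm0]; positivity
  have mpos : ∀ t, -1 < t → t < 1 → 0 < m0 t := fun t h1 h2 => by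
    have : 0 < √(1 - t^2) := Real.sqrt_pos.2 (by nlinarith)
    simp only [hm0]; positivity
  set F : ℝ → ℝ := fun t => ∫ x in (-1)..t, m0 x with hF
  have Fd : ∀ t, HasStrictDerivAt F (m0 t) t := fun t => cm.integral_hasStrictDerivAt _ t
  have cF : Continuous F := continuous_iff_continuousAt.2 fun t => (Fd t).hasDerivAt.continuousAt
  have Fsub : ∀ x z, F z - F x = ∫ t in x..z, m0 t := fun x z =>
    intervalIntegral.integral_interval_sub_left (cm.intervalIntegrable _ _) (cm.intervalIntegrable _ _)
  have Fmono : StrictMonoOn F (Icc (-1) 1) := by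
    intro x hx z hz hxz
    have : 0 < ∫ t in x..z, m0 t := by
      apply intervalIntegral.intervalIntegral_pos_of_pos_on (cm.intervalIntegrable _ _) _ hxz
      intro t ht
      exact mpos t (lt_of_le_of_lt hx.1 ht.1) (lt_of_lt_of_le ht.2 hz.2)
    have := Fsub x z
    linarith
  have F1 : F (-1) = 0 := by simp [hF]
  set T := ∫ t in (-1)..1, m0 t
  have FT : F 1 = T := rfl
  set v : ℝ → ℝ := fun s => δ + ∫ r in a..s, N r with hv
  have vd : ∀ s, HasDerivAt v (N s) s := fun s =>
    ((cN.integral_hasStrictDerivAt a s).hasDerivAt).const_add δ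
  have vmono : Monotone v := monotone_of_hasDerivAt_nonneg vd N0
  have va : v a = δ := by simp [hv]
  have vb : v b = T - δ := by simp only [hv]; linarith
  have vlo : ∀ s, δ ≤ v s := fun s => by
    rcases le_total a s with h | h
    · rw [← va]; exact vmono h
    · have : ∫ r in a..s, N r = 0 := by
        rw [intervalIntegral.integral_congr_ae (g := fun _ => 0)]; simp
        rw [uIoc_of_ge h]
        have : ∀ᵐ x : ℝ, x ≠ a := by simp [ae_iff]
        filter_upwards [this] with x hxa hx
        exact Nz x (fun hc => hxa (le_antisymm hx.2 hc.1))
      simp only [hv, this]; linarith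
  have vhi : ∀ s, v s ≤ T - δ := fun s => by
    rcases le_total s b with h | h
    · rw [← vb]; exact vmono h
    · have : ∫ r in b..s, N r = 0 := by
        rw [intervalIntegral.integral_congr_ae (g := fun _ => 0)]; simp
        rw [uIoc_of_le h]
        refine Filter.Eventually.of_forall fun x hx => Nz x (fun hc => ?_)
        exact absurd hx.1 (not_lt.2 hc.2)
      have h2 := intervalIntegral.integral_add_adjacent_intervals (cN.intervalIntegrable (μ := volume) a b) (cN.intervalIntegrable b s)
      simp only [hv] at vb ⊢
      linarith
  have ex : ∀ s, ∃ t, t ∈ Ioo (-1:ℝ) 1 ∧ F t = v s := fun s => by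
    have := intermediate_value_Ioo (by norm_num : (-1:ℝ) ≤ 1) cF.continuousOn
    have := this (show v s ∈ Ioo (F (-1)) (F 1) by
      rw [F1, FT]; exact ⟨by linarith [vlo s], by linarith [vhi s]⟩)
    obtain ⟨t, ht, h⟩ := this
    exact ⟨t, ht, h⟩
  choose τ hτ hFτ using ex
  have hbt : ∀ s, mm om d τ s = m0 (τ s) := fun s => rfl
  have τd : ∀ s, HasDerivAt τ (N s / mm om d τ s) s := fun s0 => by
    have hpos := mpos (τ s0) (hτ s0).1 (hτ s0).2
    have hL := (Fd (τ s0)).to_localInverse hpos.ne'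
    set L := (Fd (τ s0)).localInverse F _ _ hpos.ne'
    have hLr : ∀ᶠ z in nhds (F (τ s0)), F (L z) = z :=
      HasStrictDerivAt.eventually_right_inverse (Fd (τ s0)) hpos.ne'
    have hLs : L (F (τ s0)) = τ s0 := HasStrictFDerivAt.localInverse_apply_image ..
    have hv0 : HasDerivAt (fun s => L (v s)) ((m0 (τ s0))⁻¹ * N s0) s0 := by
      have h1 : HasDerivAt L (m0 (τ s0))⁻¹ (v s0) := by rw [← hFτ]; exact hL.hasDerivAt
      exact h1.comp s0 (vd s0)
    have hcont : Filter.Tendsto v (nhds s0) (nhds (F (τ s0))) := by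
      rw [hFτ]; exact (vd s0).continuousAt
    have hLc : ∀ᶠ s in nhds s0, L (v s) ∈ Ioo (-1:ℝ) 1 := by
      have : ContinuousAt (fun s => L (v s)) s0 := hv0.continuousAt
      apply this.eventually_mem
      rw [← hFτ, hLs]
      exact Ioo_mem_nhds (hτ s0).1 (hτ s0).2
    have heq : τ =ᶠ[nhds s0] fun s => L (v s) := by
      filter_upwards [hcont.eventually hLr, hLc] with s h1 h2
      apply Fmono.injOn (Ioo_subset_Icc_self (hτ s)) (Ioo_subset_Icc_self h2)
      rw [hFτ, h1]
    refine (hv0.congr_of_eventuallyEq heq).congr_deriv ?_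
    rw [hbt]; field_simp
  have F0 : F 0 = T / 2 := by
    have h1 : F 0 = ∫ t in (-0:ℝ)..1, m0 t := refl_m d om 0
    have h2 := Fsub 0 1
    rw [neg_zero] at h1
    linarith
  have NN : 0 ≤ ∫ s in a..b, N s := intervalIntegral.integral_nonneg hab (fun s _ => N0 s)
  have τa : τ a ≤ 0 := by
    by_contra hc
    have := Fmono (by simp) (Ioo_subset_Icc_self (hτ a)) (not_le.1 hc)
    rw [hFτ, va, F0] at this; linarith
  have τb : 0 ≤ τ b := by
    by_contra hc
    have := Fmono (Ioo_subset_Icc_self (hτ b)) (by simp) (not_le.1 hc)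
    rw [hFτ, vb, F0] at this; linarith
  have cτ : Continuous τ := continuous_iff_continuousAt.2 fun s => (τd s).continuousAt
  obtain ⟨y, hy, hy0⟩ := intermediate_value_Icc hab cτ.continuousOn ⟨τa, τb⟩
  refine ⟨τ, y, hy.1, hy.2, fun s => abs_lt.2 (hτ s), τd, hy0, fun η hη hη1 => ?_⟩
  have Eb := end_bound d hom τb (hτ b).2
  have Ea := end_bound d hom (neg_nonneg.2 τa) (by linarith [(hτ a).1])
  rw [neg_sq] at Ea
  have i1 : ∫ x in τ b..1, om * √(1 - x^2)^d = δ := by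
    have := Fsub (τ b) 1
    rw [hFτ, vb, FT] at this
    change ∫ x in τ b..1, m0 x = δ
    linarith
  have i2 : ∫ x in (-τ a)..1, om * √(1 - x^2)^d = δ := by
    rw [← refl_m]
    change F (τ a) = δ
    rw [hFτ, va]
  rw [i1] at Eb
  rw [i2] at Ea
  have fin : ∀ B : ℝ, 0 ≤ B → B ≤ 1 → om * B^(d+2) ≤ 2^(d+2) * δ → om * B^(d+1) ≤ om * η + 2^(d+2)*δ/η := by
    intro B h0 h1 h2
    have := mul_le_mul_of_nonneg_left (pow_split d h0 h1 hη) hom.le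
    have h3 : om * (η + B^(d+2)/η) = om * η + (om * B^(d+2))/η := by ring
    have h4 : (om * B^(d+2))/η ≤ 2^(d+2)*δ/η := by gcongr
    linarith
  have bl : ∀ s, bt τ s ≤ 1 := fun s => by
    unfold bt; rw [Real.sqrt_le_iff]; constructor <;> nlinarith [sq_nonneg (τ s)]
  have fa := fin (bt τ a) (Real.sqrt_nonneg _) (bl a) Ea
  have fb := fin (bt τ b) (Real.sqrt_nonneg _) (bl b) Eb
  have : (2:ℝ)^(d+3) * δ / η = 2 * (2^(d+2) * δ / η) := by ring
  rw [this]
  linarith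
open MeasureTheory Metric Set

noncomputable section

abbrev Eu (n : ℕ) := EuclideanSpace ℝ (Fin n)

def om (n : ℕ) : ℝ := (volume (ball (0 : Eu n) 1)).toReal

theorem om_pos (n : ℕ) : 0 < om n :=
  ENNReal.toReal_pos (measure_ball_pos volume _ one_pos).ne' measure_ball_lt_top.ne

def pd {n : ℕ} (u : Eu n → ℝ) (j : Fin n) (x : Eu n) : ℝ := fderiv ℝ u x (EuclideanSpace.single j 1)
def gn {n : ℕ} (u : Eu n → ℝ) (x : Eu n) : ℝ := √(∑ j, pd u j x ^ 2)

def insL {d : ℕ} (i : Fin (d+1)) : Eu d →L[ℝ] Eu (d+1) :=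
  LinearMap.toContinuousLinearMap
    { toFun := fun x => WithLp.toLp 2 (i.insertNth (0:ℝ) (fun j => x j) : Fin (d+1) → ℝ)
      map_add' := fun x y => by
        ext j
        refine Fin.succAboveCases i ?_ (fun j => ?_) j <;> simp
      map_smul' := fun c x => by
        ext j
        refine Fin.succAboveCases i ?_ (fun j => ?_) j <;> simp }

def ins {d : ℕ} (i : Fin (d+1)) (s : ℝ) (x : Eu d) : Eu (d+1) := insL i x + EuclideanSpace.single i s

variable {d : ℕ} (i : Fin (d+1))

theorem insL_same (x : Eu d) : insL i x i = 0 := by simp [insL]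
theorem insL_succ (x : Eu d) (j : Fin d) : insL i x (i.succAbove j) = x j := by simp [insL]
@[simp] theorem ins_same (s : ℝ) (x : Eu d) : ins i s x i = s := by simp [ins, insL_same]
@[simp] theorem ins_succ (s : ℝ) (x : Eu d) (j : Fin d) : ins i s x (i.succAbove j) = x j := by
  simp [ins, insL_succ]

theorem ins_eq (s : ℝ) (x : Eu d) :
    ins i s x = WithLp.toLp 2 (i.insertNth s (fun j => x j) : Fin (d+1) → ℝ) := by
  ext j
  refine Fin.succAboveCases i ?_ (fun j => ?_) j <;> simp

theorem ins_norm (s : ℝ) (x : Eu d) : ‖ins i s x‖^2 = s^2 + ‖x‖^2 := by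
  rw [EuclideanSpace.norm_sq_eq, EuclideanSpace.norm_sq_eq, Fin.sum_univ_succAbove _ i]
  simp

theorem ins_cont : Continuous (fun z : ℝ × Eu d => ins i z.1 z.2) := by
  unfold ins
  have h1 : Continuous (fun z : ℝ × Eu d => EuclideanSpace.single i z.1) := by
    have : (fun z : ℝ × Eu d => EuclideanSpace.single i z.1)
        = fun z => z.1 • EuclideanSpace.single i (1:ℝ) := by
      ext z; simp
    rw [this]; fun_prop
  exact ((insL i).continuous.comp continuous_snd).add h1

theorem ins_mp : MeasurePreserving (fun z : ℝ × Eu d => ins i z.1 z.2)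
    ((volume : Measure ℝ).prod (volume : Measure (Eu d))) volume := by
  have h1 : MeasurePreserving (fun z : ℝ × Eu d => (z.1, WithLp.ofLp z.2))
      ((volume : Measure ℝ).prod (volume : Measure (Eu d))) (volume.prod volume) :=
    (MeasurePreserving.id volume).prod (PiLp.volume_preserving_ofLp (Fin d))
  have h2 := (volume_preserving_piFinSuccAbove (fun _ : Fin (d+1) => ℝ) i).symm
  have h3 := PiLp.volume_preserving_toLp (Fin (d+1))
  have h4 := h3.comp (h2.comp h1)
  convert! h4 using 1
  ext z : 1
  rw [ins_eq]; rfl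

theorem ins_emb : MeasurableEmbedding (fun z : ℝ × Eu d => ins i z.1 z.2) := by
  have h : Function.Injective (fun z : ℝ × Eu d => ins i z.1 z.2) := by
    rintro ⟨s, x⟩ ⟨t, y⟩ h
    simp only at h
    have h1 : s = t := by have := congrArg (fun w => w i) h; simpa using this
    have h2 : x = y := by
      ext j; have := congrArg (fun w => w (i.succAbove j)) h; simpa using this
    rw [h1, h2]
  exact (ins_cont i).measurable.measurableEmbedding h

def SI (f : Eu (d+1) → ℝ) (s : ℝ) : ℝ := ∫ x : Eu d, f (ins i s x)

theorem SI_fub {f : Eu (d+1) → ℝ} (hf : Integrable f) : ∫ x, f x = ∫ s, SI i f s := by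
  have h1 := (ins_mp i).integral_comp (ins_emb i) f
  rw [← h1, integral_prod]
  · rfl
  · exact ((ins_mp i).integrable_comp_emb (ins_emb i)).2 hf

def CC {n : ℕ} (f : Eu n → ℝ) : Prop := Continuous f ∧ ∃ R : ℝ, 0 < R ∧ ∀ x, R ≤ ‖x‖ → f x = 0

theorem CC.hcs {n : ℕ} {f : Eu n → ℝ} (h : CC f) : HasCompactSupport f := by
  obtain ⟨_, R, _, hR⟩ := h
  refine HasCompactSupport.intro (isCompact_closedBall (0 : Eu n) R) (fun x hx => hR x ?_)
  simp at hx; exact hx.le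

theorem CC.int {n : ℕ} {f : Eu n → ℝ} (h : CC f) : Integrable f :=
  h.1.integrable_of_hasCompactSupport h.hcs

theorem CC.of_hcs {n : ℕ} {f : Eu n → ℝ} (hc : Continuous f) (h : HasCompactSupport f) : CC f := by
  refine ⟨hc, ?_⟩
  obtain ⟨R, hR⟩ := h.isCompact.isBounded.subset_closedBall (0 : Eu n)
  refine ⟨max R 0 + 1, by positivity, fun x hx => ?_⟩
  by_contra hne
  have := hR (subset_tsupport f hne)
  simp at this
  linarith [le_max_left R 0]

theorem CC.mulc {n : ℕ} {f φ : Eu n → ℝ} (h : CC f) (hφ : Continuous φ) : CC (fun x => φ x * f x) := by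
  obtain ⟨hc, R, h0, hR⟩ := h
  exact ⟨hφ.mul hc, R, h0, fun x hx => by simp only [hR x hx, mul_zero]⟩

variable {i}

theorem SI_zero {f : Eu (d+1) → ℝ} {R : ℝ} (h0 : 0 < R) (hR : ∀ x, R ≤ ‖x‖ → f x = 0) {s : ℝ} (hs : R ≤ |s|) :
    SI i f s = 0 := by
  unfold SI
  rw [integral_congr_ae (g := fun _ => 0)]; simp
  refine Filter.Eventually.of_forall fun x => hR _ ?_
  have := ins_norm i s x
  apply (sq_le_sq₀ h0.le (norm_nonneg _)).1
  rw [this]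
  have h2 : R^2 ≤ |s|^2 := by gcongr
  rw [sq_abs] at h2
  nlinarith [sq_nonneg ‖x‖]

theorem CC.slice {f : Eu (d+1) → ℝ} (h : CC f) (i : Fin (d+1)) (s : ℝ) : CC (fun x => f (ins i s x)) := by
  obtain ⟨hc, R, h0, hR⟩ := h
  refine ⟨hc.comp ((ins_cont i).comp (by fun_prop : Continuous (fun x : Eu d => (s, x)))), R, h0, fun x hx => hR _ ?_⟩
  have := ins_norm i s x
  apply (sq_le_sq₀ h0.le (norm_nonneg _)).1
  rw [this]
  have h2 : R^2 ≤ ‖x‖^2 := by gcongr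
  nlinarith [sq_nonneg s]

theorem SI_cont {f : Eu (d+1) → ℝ} (h : CC f) : Continuous (SI i f) := by
  obtain ⟨hc, R, h0, hR⟩ := id h
  have : SI i f = fun s => ∫ x in closedBall (0 : Eu d) R, f (ins i s x) := by
    ext s
    unfold SI
    rw [setIntegral_eq_integral_of_forall_compl_eq_zero]
    intro x hx
    apply hR
    simp at hx
    have := ins_norm i s x
    apply (sq_le_sq₀ h0.le (norm_nonneg _)).1
    rw [this]
    have h2 : R^2 ≤ ‖x‖^2 := by gcongr
    nlinarith [sq_nonneg s]
  rw [this]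
  exact continuous_parametric_integral_of_continuous (f := fun s x => f (ins i s x))
    (hc.comp (ins_cont i)) (isCompact_closedBall _ _)

/-- weighted Fubini -/
theorem SI_w {f : Eu (d+1) → ℝ} (h : CC f) {φ : ℝ → ℝ} (hφ : Continuous φ) {R : ℝ} (h0 : 0 < R)
    (hR : ∀ x, R ≤ ‖x‖ → f x = 0) :
    ∫ x, φ (x i) * f x = ∫ s in (-R)..R, φ s * SI i f s := by
  have hc : Continuous (fun x : Eu (d+1) => φ (x i)) := hφ.comp (by fun_prop)
  rw [SI_fub i (h.mulc hc).int]
  have : ∀ s, SI i (fun x => φ (x i) * f x) s = φ s * SI i f s := fun s => by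
    unfold SI
    simp only [ins_same]
    rw [integral_const_mul]
  simp only [this]
  rw [intervalIntegral.integral_eq_integral_of_support_subset]
  intro s hs
  by_contra hn
  apply hs
  have : R ≤ |s| := by
    by_contra hc
    have := abs_lt.1 (not_le.1 hc)
    exact hn ⟨this.1, this.2.le⟩
  simp [SI_zero h0 hR this]

theorem SI_w1 {f : Eu (d+1) → ℝ} (h : CC f) {R : ℝ} (h0 : 0 < R)
    (hR : ∀ x, R ≤ ‖x‖ → f x = 0) : ∫ x, f x = ∫ s in (-R)..R, SI i f s := by
  have := SI_w (i := i) h (φ := fun _ => 1) continuous_const h0 hR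
  simpa using this

/-! Gradients -/
theorem gn_nonneg {n : ℕ} (u : Eu n → ℝ) (x : Eu n) : 0 ≤ gn u x := Real.sqrt_nonneg _
theorem gn_sq {n : ℕ} (u : Eu n → ℝ) (x : Eu n) : gn u x ^ 2 = ∑ j, pd u j x ^ 2 :=
  Real.sq_sqrt (Finset.sum_nonneg fun _ _ => sq_nonneg _)

theorem pd_cont {n : ℕ} {u : Eu n → ℝ} (hu : ContDiff ℝ 1 u) (j : Fin n) : Continuous (pd u j) := by
  unfold pd
  exact (hu.continuous_fderiv one_ne_zero).clm_apply continuous_const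
theorem gn_cont {n : ℕ} {u : Eu n → ℝ} (hu : ContDiff ℝ 1 u) : Continuous (gn u) := by
  unfold gn
  have := fun j => pd_cont hu j
  fun_prop

theorem pd_zero {n : ℕ} {u : Eu n → ℝ} {R : ℝ} (hR : ∀ x, R ≤ ‖x‖ → u x = 0) (j : Fin n) (x : Eu n)
    (hx : R < ‖x‖) : pd u j x = 0 := by
  have : u =ᶠ[nhds x] fun _ => 0 := by
    have : {x : Eu n | R < ‖x‖} ∈ nhds x := (isOpen_lt continuous_const continuous_norm).mem_nhds hx
    filter_upwards [this] with z hz using hR z (le_of_lt hz)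
  unfold pd
  rw [this.fderiv_eq]; simp

theorem pd_CC {n : ℕ} {u : Eu n → ℝ} (hu : ContDiff ℝ 1 u) (h : CC u) (j : Fin n) : CC (pd u j) := by
  obtain ⟨_, R, h0, hR⟩ := h
  exact ⟨pd_cont hu j, R + 1, by linarith, fun x hx => pd_zero hR j x (by linarith)⟩
theorem gn_CC {n : ℕ} {u : Eu n → ℝ} (hu : ContDiff ℝ 1 u) (h : CC u) : CC (gn u) := by
  obtain ⟨_, R, h0, hR⟩ := h
  refine ⟨gn_cont hu, R + 1, by linarith, fun x hx => ?_⟩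
  unfold gn
  simp [pd_zero hR _ x (by linarith)]

/-- integration by parts -/
theorem ibp {n : ℕ} {u X : Eu n → ℝ} (hu : ContDiff ℝ 1 u) (h : CC u) (hX : ContDiff ℝ 1 X) (j : Fin n) :
    ∫ x, X x * pd u j x = - ∫ x, pd X j x * u x := by
  apply integral_mul_fderiv_eq_neg_fderiv_mul_of_integrable
  · exact (h.mulc (pd_cont hX j)).int
  · exact ((pd_CC hu h j).mulc hX.continuous).int
  · exact (h.mulc hX.continuous).int
  · exact fun x _ => (hX.differentiable one_ne_zero) x
  · exact fun x _ => (hu.differentiable one_ne_zero) x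

theorem slice_fd {u : Eu (d+1) → ℝ} (hu : ContDiff ℝ 1 u) (s : ℝ) (x : Eu d) :
    HasFDerivAt (fun x => u (ins i s x)) ((fderiv ℝ u (ins i s x)).comp (insL i)) x := by
  have h1 : HasFDerivAt (fun x => ins i s x) (insL i) x := (insL i).hasFDerivAt.add_const _
  exact ((hu.differentiable one_ne_zero) (ins i s x)).hasFDerivAt.comp x h1

theorem insL_single (j : Fin d) : insL i (EuclideanSpace.single j (1:ℝ)) = EuclideanSpace.single (i.succAbove j) 1 := by
  ext k
  refine Fin.succAboveCases i ?_ (fun k => ?_) k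
  · rw [insL_same]; simp [Fin.ne_succAbove]
  · rw [insL_succ]; simp [Pi.single_apply]

theorem slice_pd {u : Eu (d+1) → ℝ} (hu : ContDiff ℝ 1 u) (s : ℝ) (x : Eu d) (j : Fin d) :
    pd (fun x => u (ins i s x)) j x = pd u (i.succAbove j) (ins i s x) := by
  unfold pd
  rw [(slice_fd hu s x).fderiv]
  simp [insL_single]

theorem slice_C1 {u : Eu (d+1) → ℝ} (hu : ContDiff ℝ 1 u) (s : ℝ) :
    ContDiff ℝ 1 (fun x => u (ins i s x)) := by
  apply hu.comp
  unfold ins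
  exact (insL i).contDiff.add contDiff_const

/-- tangential gradient norm -/
def tg (i : Fin (d+1)) (u : Eu (d+1) → ℝ) (x : Eu (d+1)) : ℝ := √(∑ j, pd u (i.succAbove j) x ^ 2)

theorem tg_slice {u : Eu (d+1) → ℝ} (hu : ContDiff ℝ 1 u) (s : ℝ) (x : Eu d) :
    gn (fun x => u (ins i s x)) x = tg i u (ins i s x) := by
  unfold gn tg; simp only [slice_pd hu]
theorem tg_nonneg (u : Eu (d+1) → ℝ) (x : Eu (d+1)) : 0 ≤ tg i u x := Real.sqrt_nonneg _
theorem tg_sq (u : Eu (d+1) → ℝ) (x : Eu (d+1)) : pd u i x ^2 + tg i u x ^ 2 = gn u x ^2 := by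
  rw [gn_sq, Fin.sum_univ_succAbove _ i, tg, Real.sq_sqrt (Finset.sum_nonneg fun _ _ => sq_nonneg _)]
theorem tg_CC {u : Eu (d+1) → ℝ} (hu : ContDiff ℝ 1 u) (h : CC u) : CC (tg i u) := by
  obtain ⟨_, R, h0, hR⟩ := h
  refine ⟨?_, R + 1, by linarith, fun x hx => ?_⟩
  · unfold tg
    have := fun j => pd_cont hu j
    fun_prop
  · unfold tg
    simp [pd_zero hR _ x (by linarith)]

theorem om_succ (d : ℕ) (hd : 1 ≤ d) : om (d+1) = ∫ t in (-1)..1, om d * √(1-t^2)^d := by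
  have : Nonempty (Fin d) := ⟨⟨0, hd⟩⟩
  have h1 : om (d+1) = ∫ x : Eu (d+1), (ball (0 : Eu (d+1)) 1).indicator (fun _ => (1:ℝ)) x := by
    rw [integral_indicator measurableSet_ball]; simp [om, Measure.real]
  have hint : Integrable ((ball (0 : Eu (d+1)) 1).indicator (fun _ => (1:ℝ))) := by
    rw [integrable_indicator_iff measurableSet_ball]
    exact integrableOn_const measure_ball_lt_top.ne
  have h2 : ∀ s, SI (0 : Fin (d+1)) ((ball (0 : Eu (d+1)) 1).indicator (fun _ => (1:ℝ))) s
      = om d * √(1-s^2)^d := by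
    intro s
    unfold SI
    have : ∀ x : Eu d, (ball (0 : Eu (d+1)) 1).indicator (fun _ => (1:ℝ)) (ins 0 s x)
        = (ball (0 : Eu d) √(1-s^2)).indicator (fun _ => (1:ℝ)) x := by
      intro x
      have h3 : ins (0 : Fin (d+1)) s x ∈ ball (0 : Eu (d+1)) 1 ↔ x ∈ ball (0 : Eu d) √(1-s^2) := by
        rw [mem_ball_zero_iff, mem_ball_zero_iff, Real.lt_sqrt (norm_nonneg _), ← sq_lt_one_iff₀ (norm_nonneg _),
          ins_norm]
        constructor <;> intro h <;> linarith
      by_cases h : x ∈ ball (0 : Eu d) √(1-s^2)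
      · rw [indicator_of_mem h, indicator_of_mem (h3.2 h)]
      · rw [indicator_of_notMem h, indicator_of_notMem (fun h' => h (h3.1 h'))]
    simp only [this]
    rw [integral_indicator measurableSet_ball]
    simp only [integral_const, smul_eq_mul, mul_one, measureReal_restrict_apply_univ]
    rw [Measure.real, Measure.addHaar_ball _ _ (Real.sqrt_nonneg _), ENNReal.toReal_mul,
      ENNReal.toReal_ofReal (by positivity), om]
    simp [mul_comm]
  rw [h1, SI_fub 0 hint]
  simp only [h2]
  rw [intervalIntegral.integral_eq_integral_of_support_subset]
  intro s hs
  by_contra hn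
  apply hs
  have h3 : 1 - s^2 ≤ 0 := by
    by_contra hc
    have : |s| < 1 := by rw [← sq_lt_one_iff_abs_lt_one]; linarith
    have := abs_lt.1 this
    exact hn ⟨this.1, this.2.le⟩
  simp only
  rw [Real.sqrt_eq_zero_of_nonpos h3, zero_pow (by omega), mul_zero]

end
open MeasureTheory Metric Set

noncomputable section

variable {d : ℕ} {i : Fin (d+1)}

theorem cs2 {a b c e : ℝ} (h : a^2+b^2 ≤ 1) (he : 0 ≤ e) {g : ℝ} (hg : 0 ≤ g) (h2 : c^2+e^2 = g^2) :
    -a*c + b*e ≤ g := by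
  apply abs_le_of_sq_le_sq' _ hg |>.2
  nlinarith [sq_nonneg (a*e+b*c), mul_nonneg (sub_nonneg.2 h) (sq_nonneg g)]

theorem pd_fi {α α' : ℝ → ℝ} (h : ∀ s, HasDerivAt α (α' s) s) (j : Fin (d+1)) (x : Eu (d+1)) :
    pd (fun x : Eu (d+1) => α (x j)) j x = α' (x j) := by
  unfold pd
  have h1 : HasFDerivAt (fun x : Eu (d+1) => x j) (EuclideanSpace.proj j : Eu (d+1) →L[ℝ] ℝ) x :=
    (EuclideanSpace.proj j : Eu (d+1) →L[ℝ] ℝ).hasFDerivAt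
  have := (h (x j)).comp_hasFDerivAt x h1
  have h2 : HasFDerivAt (fun x : Eu (d+1) => α (x j)) (α' (x j) • (EuclideanSpace.proj j : Eu (d+1) →L[ℝ] ℝ)) x := this
  rw [h2.fderiv]
  simp

theorem C1_of {α α' : ℝ → ℝ} (h : ∀ s, HasDerivAt α (α' s) s) (c : Continuous α') : ContDiff ℝ 1 α := by
  rw [contDiff_one_iff_deriv]
  refine ⟨fun s => (h s).differentiableAt, ?_⟩
  have : deriv α = α' := funext fun s => (h s).deriv
  rw [this]; exact c

theorem coord_C1 (j : Fin (d+1)) : ContDiff ℝ 1 (fun x : Eu (d+1) => x j) :=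
  (EuclideanSpace.proj j : Eu (d+1) →L[ℝ] ℝ).contDiff

structure UD {n : ℕ} (u : Eu n → ℝ) (R : ℝ) : Prop where
  C1 : ContDiff ℝ 1 u
  u0 : ∀ x, 0 ≤ u x
  R0 : 0 < R
  hR : ∀ x, R - 1 ≤ ‖x‖ → u x = 0

theorem UD.cc {n : ℕ} {u : Eu n → ℝ} {R : ℝ} (h : UD u R) : CC u :=
  ⟨h.C1.continuous, R, h.R0, fun x hx => h.hR x (by linarith)⟩
theorem UD.of {n : ℕ} {u : Eu n → ℝ} (h : ContDiff ℝ 1 u) (h2 : CC u) (h3 : ∀ x, 0 ≤ u x) : ∃ R, UD u R := by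
  obtain ⟨_, R, h0, hR⟩ := h2
  exact ⟨R+1, h, h3, by linarith, fun x hx => hR x (by linarith)⟩
theorem UD.pz {n : ℕ} {u : Eu n → ℝ} {R : ℝ} (h : UD u R) (j : Fin n) {x : Eu n} (hx : R ≤ ‖x‖) :
    pd u j x = 0 := pd_zero h.hR j x (by linarith)
theorem UD.gz {n : ℕ} {u : Eu n → ℝ} {R : ℝ} (h : UD u R) {x : Eu n} (hx : R ≤ ‖x‖) :
    gn u x = 0 := by unfold gn; simp [h.pz _ hx]
theorem UD.tz {u : Eu (d+1) → ℝ} {R : ℝ} (h : UD u R) {x : Eu (d+1)} (hx : R ≤ ‖x‖) :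
    tg i u x = 0 := by unfold tg; simp [h.pz _ hx]
theorem UD.pwz {n : ℕ} {u : Eu n → ℝ} {R : ℝ} (h : UD u R) {q : ℝ} (hq : 0 < q) {x : Eu n} (hx : R ≤ ‖x‖) :
    u x ^ q = 0 := by rw [h.hR x (by linarith), Real.zero_rpow hq.ne']
theorem UD.pwCC {n : ℕ} {u : Eu n → ℝ} {R : ℝ} (h : UD u R) {q : ℝ} (hq : 0 < q) : CC (fun x => u x ^ q) :=
  ⟨h.C1.continuous.rpow_const (fun _ => Or.inr hq.le), R, h.R0, fun x hx => h.pwz hq hx⟩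

theorem UD.ibpα {u : Eu (d+1) → ℝ} {R : ℝ} (h : UD u R) {α α' : ℝ → ℝ} (hα : ∀ s, HasDerivAt α (α' s) s)
    (cα : Continuous α') : ∫ x, -α (x i) * pd u i x = ∫ s in (-R)..R, α' s * SI i u s := by
  have C := C1_of hα cα
  have h1 := ibp h.C1 h.cc (X := fun x => α (x i)) (C.comp (coord_C1 i)) i
  simp only [pd_fi hα] at h1
  have h2 := SI_w (i := i) h.cc cα h.R0 (fun x hx => h.hR x (by linarith))
  rw [← h2]
  simp only [neg_mul]
  rw [integral_neg, h1, neg_neg]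

theorem UD.HH {u : Eu (d+1) → ℝ} {R : ℝ} (h : UD u R) :
    HH (-R) R (SI i u) (SI i (tg i u)) (∫ x, gn u x) := by
  intro α α' β hα cα cβ β0 hab
  have ca : Continuous α := (C1_of hα cα).continuous
  have e1 := h.ibpα (i := i) hα cα
  have e2 := SI_w (i := i) (tg_CC (i := i) h.C1 h.cc) cβ h.R0 (fun x hx => h.tz hx)
  have cU : Continuous (SI i u) := SI_cont h.cc
  have cp : Continuous (SI i (tg i u)) := SI_cont (tg_CC h.C1 h.cc)
  rw [intervalIntegral.integral_add (Continuous.intervalIntegrable (by fun_prop) _ _)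
    (Continuous.intervalIntegrable (by fun_prop) _ _), ← e1, ← e2, ← integral_add]
  · apply integral_mono
    · refine Integrable.add ?_ ?_
      · exact ((pd_CC h.C1 h.cc i).mulc (φ := fun x => -α (x i)) (by fun_prop)).int
      · exact ((tg_CC (i := i) h.C1 h.cc).mulc (φ := fun x => β (x i)) (by fun_prop)).int
    · exact (gn_CC h.C1 h.cc).int
    · intro x
      exact cs2 (hab (x i)) (tg_nonneg _ _) (gn_nonneg _ _) (tg_sq _ _)
  · exact ((pd_CC h.C1 h.cc i).mulc (φ := fun x => -α (x i)) (by fun_prop)).int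
  · exact ((tg_CC (i := i) h.C1 h.cc).mulc (φ := fun x => β (x i)) (by fun_prop)).int

def Iso (d : ℕ) : Prop := ∀ u : Eu d → ℝ, ContDiff ℝ 1 u → CC u → (∀ x, 0 ≤ u x) →
  om d * (d * ∫ x, u x ^ (1 + 1/(d:ℝ)))^d ≤ (∫ x, gn u x)^d * ∫ x, u x

theorem SI_nonneg {f : Eu (d+1) → ℝ} (h : ∀ x, 0 ≤ f x) (s : ℝ) : 0 ≤ SI i f s :=
  integral_nonneg fun _ => h _

theorem UD.slice_iso (I : Iso d) {u : Eu (d+1) → ℝ} {R : ℝ} (h : UD u R) (s : ℝ) :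
    om d * (d * SI i (fun x => u x ^ (1 + 1/(d:ℝ))) s)^d ≤ (SI i (tg i u) s)^d * SI i u s := by
  have := I (fun x => u (ins i s x)) (slice_C1 h.C1 s) (h.cc.slice i s) (fun x => h.u0 _)
  simp only [tg_slice h.C1] at this
  exact this

theorem UD.U0N0 {u : Eu (d+1) → ℝ} {R : ℝ} (h : UD u R) {q : ℝ} (hq : 0 < q) {s : ℝ} (hs : SI i u s = 0) :
    SI i (fun x => u x ^ q) s = 0 := by
  unfold SI at *
  have h2 := (h.cc.slice i s)
  have h3 := (integral_eq_zero_iff_of_nonneg (fun x => h.u0 _) h2.int).1 hs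
  rw [integral_congr_ae (g := fun _ => 0)]; simp
  filter_upwards [h3] with x hx
  simp at hx; simp [hx, hq.ne']

theorem UD.isoμ (hd : 1 ≤ d) (I : Iso d) {u : Eu (d+1) → ℝ} {R : ℝ} (h : UD u R) {μ : ℝ} (hμ : 0 < μ)
    (hA : μ^(d+1) * (∫ x, u x ^ (1 + 1/(d:ℝ))) < om (d+1)) :
    (d+1) * μ * (∫ x, u x ^ (1 + 1/(d:ℝ))) ≤ ∫ x, gn u x := by
  have hq : (0:ℝ) < 1 + 1/(d:ℝ) := by positivity
  have e := SI_w1 (i := 0) (h.pwCC hq) h.R0 (fun x hx => h.pwz hq hx)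
  set A := ∫ x, u x ^ (1 + 1/(d:ℝ))
  set N := SI (0 : Fin (d+1)) (fun x => u x ^ (1 + 1/(d:ℝ))) with hN
  set U := SI (0 : Fin (d+1)) u with hU
  set p := SI (0 : Fin (d+1)) (tg 0 u) with hp
  have cN : Continuous N := SI_cont (h.pwCC hq)
  have cU : Continuous U := SI_cont h.cc
  have cp : Continuous p := SI_cont (tg_CC h.C1 h.cc)
  have N0 : ∀ s, 0 ≤ N s := SI_nonneg fun x => Real.rpow_nonneg (h.u0 x) _
  have U0 : ∀ s, 0 ≤ U s := SI_nonneg h.u0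
  have p0 : ∀ s, 0 ≤ p s := SI_nonneg (tg_nonneg u)
  obtain ⟨τ, y, -, -, h1, h2, -, -⟩ := transport d (om_pos d) (a := -R) (b := R) (δ := (om (d+1) - μ^(d+1) * A)/2)
    (by linarith [h.R0]) (fun s => μ^(d+1) * N s) (by fun_prop) (fun s => by have := N0 s; positivity)
    (fun s hs => by
      have : R ≤ |s| := by
        by_contra hc
        have := abs_lt.1 (not_le.1 hc)
        exact hs ⟨this.1.le, this.2.le⟩
      have : N s = 0 := SI_zero h.R0 (fun x hx => h.pwz hq hx) this
      simp [this]) (by linarith)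
    (by rw [intervalIntegral.integral_const_mul, ← e, ← om_succ d hd]; ring)
  have hR := h.R0
  have r0 : ∀ s, 0 < 1 - τ s ^ 2 := fun s => by
    have := h1 s; rw [abs_lt] at this; nlinarith
  have b0 : ∀ s, 0 < bt τ s := fun s => Real.sqrt_pos.2 (r0 s)
  have bsq : ∀ s, bt τ s ^ 2 = 1 - τ s ^ 2 := fun s => Real.sq_sqrt (r0 s).le
  have cτ : Continuous τ := continuous_iff_continuousAt.2 fun s => (h2 s).continuousAt
  have cb : Continuous (bt τ) := by unfold bt; fun_prop
  have cm : Continuous (mm (om d) d τ) := by unfold mm; fun_prop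
  have m0 : ∀ s, 0 < mm (om d) d τ s := fun s => by
    have := b0 s; have := om_pos d; unfold mm; positivity
  have cNm : Continuous (fun s => μ^(d+1) * N s / mm (om d) d τ s) :=
    Continuous.div (by fun_prop) cm fun s => (m0 s).ne'
  have H := h.HH (i := 0) τ _ (bt τ) h2 cNm cb (fun s => (b0 s).le) (fun s => by rw [bsq]; linarith)
  refine le_trans ?_ H
  rw [e, ← intervalIntegral.integral_const_mul]
  apply intervalIntegral.integral_mono_on (by linarith) (Continuous.intervalIntegrable (by fun_prop) _ _)
    (((cNm.mul cU).add (cb.mul cp)).intervalIntegrable _ _)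
  intro s _
  have hs := slice_amgm d hd (om d) (bt τ s) (μ^d * U s) (μ^(d+1) * N s) (μ^d * p s) (om_pos d) (b0 s)
    (by have := U0 s; positivity) (by have := N0 s; positivity) (by have := p0 s; positivity)
    (fun h0 => by
      have : U s = 0 := by
        rcases mul_eq_zero.1 h0 with h | h
        · exact absurd h (by positivity)
        · exact h
      rw [hN, h.U0N0 hq this, mul_zero])
    (by
      have := h.slice_iso (i := 0) I s
      have h3 : om d * (d * (μ^(d+1) * N s))^d = (μ^d)^(d+1) * (om d * (d * N s)^d) := by
        rw [← pow_mul]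
        simp only [mul_pow]; ring
      have h4 : (μ^d * p s)^d * (μ^d * U s) = (μ^d)^(d+1) * ((p s)^d * U s) := by
        simp only [mul_pow]; ring
      rw [h3, h4]
      gcongr)
  have hs2 : (d+1) * (μ^(d+1) * N s) ≤ bt τ s * (μ^d * p s) + μ^(d+1) * N s / (om d * bt τ s ^ d) * (μ^d * U s) := by
    refine le_trans ?_ hs
    have : 0 ≤ (μ^(d+1) * N s) * ((μ^d * U s) / (om d * bt τ s ^ d) - 1)^2 / ((d:ℝ)^2 * max 1 ((μ^d * U s) / (om d * bt τ s ^ d))) := by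
      have := N0 s; positivity
    linarith
  have h5 : μ^d * ((d+1) * μ * N s) ≤ μ^d * (μ^(d+1) * N s / mm (om d) d τ s * U s + bt τ s * p s) := by
    unfold mm
    calc _ = (d+1) * (μ^(d+1) * N s) := by ring
      _ ≤ _ := hs2
      _ = _ := by ring
  exact le_of_mul_le_mul_left h5 (by positivity)

theorem UD.iso1 (hd : 1 ≤ d) (I : Iso d) {u : Eu (d+1) → ℝ} {R : ℝ} (h : UD u R) :
    om (d+1) * ((d:ℝ)+1)^(d+1) * (∫ x, u x ^ (1 + 1/(d:ℝ)))^d ≤ (∫ x, gn u x)^(d+1) := by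
  have P0 : 0 ≤ ∫ x, gn u x := integral_nonneg fun x => gn_nonneg u x
  have A0 : 0 ≤ ∫ x, u x ^ (1 + 1/(d:ℝ)) := integral_nonneg fun x => Real.rpow_nonneg (h.u0 x) _
  have key := fun μ hμ => h.isoμ hd I (μ := μ) hμ
  set A := ∫ x, u x ^ (1 + 1/(d:ℝ))
  set P := ∫ x, gn u x
  rcases A0.eq_or_lt with hA | hA
  · rw [← hA, zero_pow (by omega), mul_zero]; positivity
  by_contra hc
  have om0 := om_pos (d+1)
  set K := ((d:ℝ)+1)^(d+1) * A^d with hK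
  have K0 : 0 < K := by positivity
  have hc : P^(d+1) < om (d+1) * K := by rw [hK, ← mul_assoc]; linarith
  have h1 : P^(d+1) / K < om (d+1) := by rwa [div_lt_iff₀ K0]
  set q := (P^(d+1)/K + om (d+1))/2 with hq
  have q0 : 0 < q := by positivity
  have h2 : P^(d+1) < q * K := by rw [← div_lt_iff₀ K0]; linarith
  set μ := (q/A)^(1/((d+1:ℕ):ℝ)) with hμ
  have μ0 : 0 < μ := by positivity
  have hμ2 : μ^(d+1) = q/A := by
    rw [hμ, one_div, Real.rpow_inv_natCast_pow (by positivity) (by omega)]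
  have h3 := key μ μ0 (by rw [hμ2, div_mul_cancel₀ _ hA.ne']; linarith)
  have h4 : ((d+1) * μ * A)^(d+1) ≤ P^(d+1) := by gcongr
  have h5 : ((d+1) * μ * A)^(d+1) = q * K := by
    rw [mul_pow, mul_pow, hμ2, hK, pow_succ A]; field_simp
  linarith

end
open MeasureTheory Metric Set

noncomputable section

variable {d : ℕ} {i : Fin (d+1)}

theorem om_one : om 1 = 2 := by
  unfold om
  rw [EuclideanSpace.volume_ball]
  have : Real.Gamma (((Fintype.card (Fin 1) : ℕ):ℝ) / 2 + 1) = √Real.pi / 2 := by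
    simp only [Fintype.card_fin, Nat.cast_one]
    rw [Real.Gamma_add_one (by norm_num), Real.Gamma_one_half_eq]; ring
  rw [this]
  have h2 : 0 < √Real.pi := Real.sqrt_pos.2 Real.pi_pos
  simp
  rw [ENNReal.toReal_ofReal (by positivity)]
  field_simp

theorem vol_Eu0 : (volume : Measure (Eu 0)) univ = 1 := by
  have := (PiLp.volume_preserving_ofLp (Fin 0)).measure_preimage (s := univ) MeasurableSet.univ.nullMeasurableSet
  rw [preimage_univ] at this
  rw [this]; simp [volume_pi]

theorem SI_Eu1 (f : Eu (0+1) → ℝ) (s : ℝ) : SI 0 f s = f (EuclideanSpace.single 0 s) := by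
  unfold SI
  have : ∀ x : Eu 0, f (ins 0 s x) = f (EuclideanSpace.single 0 s) := fun x => by
    rw [Subsingleton.elim x 0]; simp [ins]
  simp only [this]
  simp [Measure.real, vol_Eu0]

theorem UD.sup1 {u : Eu (0+1) → ℝ} {R : ℝ} (h : UD u R) (x : Eu (0+1)) : 2 * u x ≤ ∫ z, gn u z := by
  have hR := h.R0
  rcases le_or_gt R ‖x‖ with hx | hx
  · rw [h.hR x (by linarith)]
    have : 0 ≤ ∫ x, gn u x := integral_nonneg fun x => gn_nonneg u x
    linarith
  have e := SI_w1 (i := 0) (gn_CC h.C1 h.cc) h.R0 (fun x hx => h.gz hx)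
  simp only [SI_Eu1] at e
  set g : ℝ → ℝ := fun s => u (EuclideanSpace.single 0 s) with hg
  set g' : ℝ → ℝ := fun s => pd u 0 (EuclideanSpace.single 0 s) with hg'
  have es : ∀ s : ℝ, (EuclideanSpace.single 0 s : Eu (0+1)) = s • EuclideanSpace.single 0 1 := fun s => by ext; simp
  have gd : ∀ s, HasDerivAt g (g' s) s := by
    intro s
    have h1 : HasDerivAt (fun s : ℝ => (EuclideanSpace.single 0 s : Eu (0+1))) (EuclideanSpace.single 0 1) s := by
      have := (hasDerivAt_id s).smul_const (EuclideanSpace.single 0 1 : Eu (0+1))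
      simp only [id, one_smul, ← es] at this
      exact this
    exact ((h.C1.differentiable one_ne_zero) _).hasFDerivAt.comp_hasDerivAt s h1
  have cg' : Continuous g' := by
    refine (pd_cont h.C1 0).comp ?_
    have e' : (fun s : ℝ => (EuclideanSpace.single 0 s : Eu (0+1))) = fun s => s • EuclideanSpace.single 0 1 := funext es
    have c' : Continuous (fun s : ℝ => s • (EuclideanSpace.single 0 1 : Eu (0+1))) := by fun_prop
    rw [← e'] at c'; exact c'
  have eg : ∀ s, gn u (EuclideanSpace.single 0 s) = |g' s| := fun s => by
    unfold gn; simp [Real.sqrt_sq_eq_abs, hg']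
  simp only [eg] at e
  have gz : ∀ s, R ≤ |s| → g s = 0 := fun s hs => h.hR _ (by simp; linarith)
  have ex : x = EuclideanSpace.single 0 (x 0) := by
    ext j
    have hj : j = 0 := Subsingleton.elim (α := Fin 1) j 0
    rw [hj]; simp
  set t := x 0
  have ht : |t| < R := by
    have : ‖x‖ = |t| := by conv_lhs => rw [ex]
                           simp
    linarith
  have ht := abs_lt.1 ht
  have f1 := intervalIntegral.integral_eq_sub_of_hasDerivAt (a := -R) (b := t) (fun s _ => gd s) (cg'.intervalIntegrable _ _)
  have f2 := intervalIntegral.integral_eq_sub_of_hasDerivAt (a := t) (b := R) (fun s _ => gd s) (cg'.intervalIntegrable _ _)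
  rw [gz (-R) (by simp [abs_of_pos hR])] at f1
  rw [gz R (by simp [abs_of_pos hR])] at f2
  have g1 := intervalIntegral.abs_integral_le_integral_abs (f := g') (μ := volume) (a := -R) (b := t) ht.1.le
  have g2 := intervalIntegral.abs_integral_le_integral_abs (f := g') (μ := volume) (a := t) (b := R) ht.2.le
  have g3 := intervalIntegral.integral_add_adjacent_intervals (f := fun s => |g' s|) (μ := volume) (a := -R) (b := t) (c := R)
    (cg'.abs.intervalIntegrable _ _) (cg'.abs.intervalIntegrable _ _)
  rw [e]
  have : u x = g t := by rw [ex]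
  rw [this]
  have := le_abs_self (∫ s in (-R)..t, g' s)
  have := neg_abs_le (∫ s in t..R, g' s)
  linarith

theorem Iso_one : Iso 1 := by
  intro u hu hc h0
  obtain ⟨R, h⟩ := UD.of hu hc h0
  rw [om_one]
  simp only [Nat.cast_one, pow_one, one_mul, div_one]
  have e : (1:ℝ)+1 = (2:ℕ) := by norm_num
  simp only [e, Real.rpow_natCast]
  rw [← integral_const_mul, ← integral_const_mul]
  apply integral_mono
  · have : (fun x => 2 * u x^2) = fun x => (2 * u x) * u x := by ext x; ring
    rw [this]
    exact (hc.mulc (φ := fun x => 2 * u x) (by have := hu.continuous; fun_prop)).int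
  · exact hc.int.const_mul _
  · intro x
    have := h.sup1 x
    have h0 := h0 x
    simp only
    calc 2 * u x^2 = (2 * u x) * u x := by ring
      _ ≤ _ := by gcongr

theorem Iso_succ (hd : 1 ≤ d) (I : Iso d) : Iso (d+1) := by
  intro u hu hc h0
  obtain ⟨R, h⟩ := UD.of hu hc h0
  have h1 := h.iso1 hd I
  have d0 : (0:ℝ) < d := by exact_mod_cast hd
  have hpq : Real.HolderConjugate ((d:ℝ)+1) (1 + 1/(d:ℝ)) := by
    rw [Real.holderConjugate_iff]
    refine ⟨by linarith, ?_⟩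
    field_simp
    ring
  have hq : (0:ℝ) < 1 + 1/(d:ℝ) := by positivity
  have hr : (0:ℝ) < 1 / ((d:ℝ)+1) := by positivity
  have m1 : MemLp (fun x => u x ^ (1/((d:ℝ)+1))) (ENNReal.ofReal ((d:ℝ)+1)) volume :=
    (h.pwCC hr).1.memLp_of_hasCompactSupport (h.pwCC hr).hcs
  have m2 : MemLp u (ENNReal.ofReal (1 + 1/(d:ℝ))) volume :=
    hc.1.memLp_of_hasCompactSupport hc.hcs
  have H := integral_mul_le_Lp_mul_Lq_of_nonneg hpq (Filter.Eventually.of_forall fun x => Real.rpow_nonneg (h0 x) _)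
    (Filter.Eventually.of_forall h0) m1 m2
  have e1 : ∀ x, u x ^ (1/((d:ℝ)+1)) * u x = u x ^ (1 + 1 / ((d+1:ℕ):ℝ)) := fun x => by
    rcases (h0 x).eq_or_lt with hx | hx
    · rw [← hx, mul_zero, Real.zero_rpow (by positivity)]
    · rw [← Real.rpow_add_one hx.ne']; push_cast; rw [add_comm]
  have e2 : ∀ x, (u x ^ (1/((d:ℝ)+1)))^((d:ℝ)+1) = u x := fun x => by
    rw [← Real.rpow_mul (h0 x), one_div_mul_cancel (by positivity), Real.rpow_one]
  simp only [e1, e2] at H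
  have A0 : 0 ≤ ∫ x, u x ^ (1 + 1/(d:ℝ)) := integral_nonneg fun x => Real.rpow_nonneg (h.u0 x) _
  have B0 : 0 ≤ ∫ x, u x ^ (1 + 1/((d+1:ℕ):ℝ)) := integral_nonneg fun x => Real.rpow_nonneg (h.u0 x) _
  have V0 : 0 ≤ ∫ x, u x := integral_nonneg h0
  set A := ∫ x, u x ^ (1 + 1/(d:ℝ))
  set B := ∫ x, u x ^ (1 + 1/((d+1:ℕ):ℝ))
  set V := ∫ x, u x
  set P := ∫ x, gn u x
  have H2 : B^(d+1) ≤ V * A^d := by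
    calc B^(d+1) ≤ (V ^ (1/((d:ℝ)+1)) * A^(1/(1+1/(d:ℝ))))^(d+1) := by gcongr
      _ = V * A^d := by
        rw [mul_pow]
        congr 1
        · rw [← Real.rpow_natCast, ← Real.rpow_mul V0]; push_cast
          rw [one_div_mul_cancel (by positivity), Real.rpow_one]
        · rw [← Real.rpow_natCast, ← Real.rpow_mul A0, ← Real.rpow_natCast]
          congr 1; push_cast; field_simp
  have om0 := om_pos (d+1)
  calc om (d+1) * (((d+1:ℕ):ℝ) * B)^(d+1) = om (d+1) * ((d:ℝ)+1)^(d+1) * B^(d+1) := by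
        rw [mul_pow]; push_cast; ring
    _ ≤ om (d+1) * ((d:ℝ)+1)^(d+1) * (V * A^d) := by gcongr
    _ = (om (d+1) * ((d:ℝ)+1)^(d+1) * A^d) * V := by ring
    _ ≤ P^(d+1) * V := by gcongr

theorem Iso_all (d : ℕ) (hd : 1 ≤ d) : Iso d := by
  induction d, hd using Nat.le_induction with
  | base => exact Iso_one
  | succ d hd ih => exact Iso_succ hd ih

end
open MeasureTheory Metric Set

noncomputable section

variable {d : ℕ} {i : Fin (d+1)}

/-- the data for the quantitative theorem -/
structure QD (d : ℕ) (u : Eu (d+1) → ℝ) (R δ : ℝ) : Prop where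
  ud : UD u R
  hd : 1 ≤ d
  u1 : ∀ x, u x ≤ 1
  hV : ∫ x, u x ≤ om (d+1)
  δ0 : 0 < δ
  hT : (∫ x, u x ^ (1 + 1/(d:ℝ))) + 2*δ = om (d+1)

theorem int3 {n : ℕ} {f g h : Eu n → ℝ} (hf : Integrable f) (hg : Integrable g) (hh : Integrable h) :
    Integrable (fun x => f x + g x - h x) ∧ ∫ x, (f x + g x - h x) = (∫ x, f x) + (∫ x, g x) - ∫ x, h x := by
  have i1 : Integrable (fun x => f x + g x) := hf.add hg
  exact ⟨i1.sub hh, by rw [integral_sub i1 hh, integral_add hf hg]⟩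

def NN (d : ℕ) (u : Eu (d+1) → ℝ) (x : Eu (d+1)) : ℝ := u x ^ (1 + 1/(d:ℝ))

theorem CD_nonneg (d : ℕ) : 0 ≤ CD d := by unfold CD; positivity

theorem QD.NN_CC {u : Eu (d+1) → ℝ} {R δ : ℝ} (h : QD d u R δ) : CC (NN d u) :=
  h.ud.pwCC (by positivity)

theorem QD.ex {u : Eu (d+1) → ℝ} {R δ : ℝ} (h : QD d u R δ) (i : Fin (d+1)) :
    ∃ (τ : ℝ → ℝ) (y : ℝ), SD d (om d) (-R) R y (SI i u) (SI i (NN d u)) (SI i (tg i u)) τ ∧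
      ∀ η, 0 < η → η ≤ 1 → om d * (bt τ (-R) ^ (d+1) + bt τ R ^ (d+1)) ≤ 2 * om d * η + 2^(d+3) * δ / η := by
  have hq : (0:ℝ) < 1 + 1/(d:ℝ) := by positivity
  have e := SI_w1 (i := i) h.NN_CC h.ud.R0 (fun x hx => h.ud.pwz hq hx)
  have cN : Continuous (SI i (NN d u)) := SI_cont h.NN_CC
  have N0 : ∀ s, 0 ≤ SI i (NN d u) s := SI_nonneg fun x => Real.rpow_nonneg (h.ud.u0 x) _
  obtain ⟨τ, y, h1, h2, h3, h4, h5, h6⟩ := transport d (om_pos d) (a := -R) (b := R) (δ := δ)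
    (by linarith [h.ud.R0]) (SI i (NN d u)) cN N0
    (fun s hs => by
      have : R ≤ |s| := by
        by_contra hc
        have := abs_lt.1 (not_le.1 hc)
        exact hs ⟨this.1.le, this.2.le⟩
      exact SI_zero h.ud.R0 (fun x hx => h.ud.pwz hq hx) this) h.δ0
    (by rw [← e, ← om_succ d h.hd]; exact h.hT)
  refine ⟨τ, y, ⟨h.hd, om_pos d, h1, h2, SI_cont h.ud.cc, cN, SI_cont (tg_CC h.ud.C1 h.ud.cc), SI_nonneg h.ud.u0, N0,
    SI_nonneg (tg_nonneg u), ?_, h.ud.slice_iso (Iso_all d h.hd), h3, h4, h5⟩, h6⟩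
  intro s
  apply integral_mono (h.NN_CC.slice i s).int (h.ud.cc.slice i s).int
  intro x
  have := Real.rpow_le_rpow_of_exponent_ge' (h.ud.u0 (ins i s x)) (h.u1 (ins i s x)) zero_le_one
    (by linarith [show (0:ℝ) ≤ 1/(d:ℝ) by positivity] : (1:ℝ) ≤ 1 + 1/(d:ℝ))
  simpa [NN] using this

/-- total deficit -/
def DD (d : ℕ) (u : Eu (d+1) → ℝ) (δ η : ℝ) : ℝ :=
  ((∫ x, gn u x) - (d+1) * ∫ x, NN d u x) + 2*δ + (2 * om d * η + 2^(d+3) * δ / η)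

def ff1 (τ : ℝ → ℝ) (i : Fin (d+1)) (u : Eu (d+1) → ℝ) (x : Eu (d+1)) : ℝ :=
  gn u x + τ (x i) * pd u i x - bt τ (x i) * tg i u x

theorem QD.F1 {u : Eu (d+1) → ℝ} {R δ : ℝ} (h : QD d u R δ) {τ : ℝ → ℝ} {y : ℝ}
    (S : SD d (om d) (-R) R y (SI i u) (SI i (NN d u)) (SI i (tg i u)) τ) :
    CC (ff1 τ i u) ∧ ∫ x, ff1 τ i u x ≤ (∫ x, gn u x) - (d+1) * ∫ x, NN d u x := by
  have hq : (0:ℝ) < 1 + 1/(d:ℝ) := by positivity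
  have eN := SI_w1 (i := i) h.NN_CC h.ud.R0 (fun x hx => h.ud.pwz hq hx)
  have ct := S.cτ; have cb := S.cb
  have c1 := gn_CC h.ud.C1 h.ud.cc
  have c2 := (pd_CC h.ud.C1 h.ud.cc i).mulc (φ := fun x => τ (x i)) (by fun_prop)
  have c3 := (tg_CC (i := i) h.ud.C1 h.ud.cc).mulc (φ := fun x => bt τ (x i)) (by fun_prop)
  have hcont : Continuous (ff1 τ i u) := by
    have := c1.1; have := c2.1; have := c3.1
    unfold ff1; fun_prop
  refine ⟨⟨hcont, R, h.ud.R0, fun x hx => ?_⟩, ?_⟩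
  · simp [ff1, h.ud.gz hx, h.ud.pz _ hx, h.ud.tz hx]
  have e1 := h.ud.ibpα (i := i) S.τd S.cNm
  have e2 := SI_w (i := i) (tg_CC (i := i) h.ud.C1 h.ud.cc) cb h.ud.R0 (fun x hx => h.ud.tz hx)
  have e3 : ∫ x, ff1 τ i u x = (∫ x, gn u x) + (∫ x, τ (x i) * pd u i x) - ∫ x, bt τ (x i) * tg i u x := by
    exact (int3 c1.int c2.int c3.int).2
  simp only [neg_mul] at e1
  rw [integral_neg] at e1
  have cNm := S.cNm; have cU := S.cU; have cp := S.cp; have cN := S.cN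
  have h2 := lin3 (by linarith [h.ud.R0] : -R ≤ R) 1 1 0 (f := fun s => (d+1) * SI i (NN d u) s)
    (f1 := fun s => SI i (NN d u) s / mm (om d) d τ s * SI i u s) (f2 := fun s => bt τ s * SI i (tg i u) s)
    (f3 := fun _ => 0) (by fun_prop) (cNm.mul cU) (by fun_prop) continuous_const
    (fun s _ => by have := S.amgm s; have := S.Hs0 s; linarith)
  rw [intervalIntegral.integral_const_mul] at h2
  rw [e3, e2, eN]
  linarith

theorem GG_nonneg (y : ℝ) (τ : ℝ → ℝ) (s : ℝ) : 0 ≤ GG y τ s := by unfold GG; positivity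
theorem GG_le_one (y : ℝ) (τ : ℝ → ℝ) (s : ℝ) : GG y τ s ≤ 1 := by
  unfold GG
  have h1 := Real.arctan_lt_pi_div_two (s - y - τ s)
  have h2 := Real.neg_pi_div_two_lt_arctan (s - y - τ s)
  have h3 := Real.pi_lt_four
  have : Real.arctan (s - y - τ s) ^ 2 ≤ 2^2 := sq_le_sq' (by linarith) (by linarith)
  linarith

theorem QD.F3 {u : Eu (d+1) → ℝ} {R δ : ℝ} (h : QD d u R δ) {τ : ℝ → ℝ} {y : ℝ}
    (S : SD d (om d) (-R) R y (SI i u) (SI i (NN d u)) (SI i (tg i u)) τ) :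
    CC (fun x => GG y τ (x i) * gn u x) ∧ ∫ x, GG y τ (x i) * gn u x ≤
      ((∫ x, gn u x) - (d+1) * ∫ x, NN d u x) + (d+1) * (∫ s in (-R)..R, (GG y τ s * SI i (NN d u) s + |GG' (om d) d y (SI i (NN d u)) τ s| * SI i u s)) := by
  have hq : (0:ℝ) < 1 + 1/(d:ℝ) := by positivity
  have eN := SI_w1 (i := i) h.NN_CC h.ud.R0 (fun x hx => h.ud.pwz hq hx)
  have ct := S.cτ; have cb := S.cb; have cG := S.cGG; have cG' := S.cGG'
  have c1 := gn_CC h.ud.C1 h.ud.cc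
  have c4 := c1.mulc (φ := fun x => GG y τ (x i)) (by fun_prop)
  refine ⟨c4, ?_⟩
  have cNm := S.cNm; have cU := S.cU; have cp := S.cp; have cN := S.cN
  set α : ℝ → ℝ := fun s => (1 - GG y τ s) * τ s with hα
  set α' : ℝ → ℝ := fun s => -GG' (om d) d y (SI i (NN d u)) τ s * τ s + (1 - GG y τ s) * (SI i (NN d u) s / mm (om d) d τ s) with hα'
  set β : ℝ → ℝ := fun s => (1 - GG y τ s) * bt τ s with hβ
  have αd : ∀ s, HasDerivAt α (α' s) s := fun s => ((S.GGd s).const_sub 1).mul (S.τd s)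
  have ca : Continuous α := by fun_prop
  have ca' : Continuous α' := (cG'.neg.mul ct).add ((continuous_const.sub cG).mul cNm)
  have cβ : Continuous β := by fun_prop
  have c2 := (pd_CC h.ud.C1 h.ud.cc i).mulc (φ := fun x => -α (x i)) (by fun_prop)
  have c3 := (tg_CC (i := i) h.ud.C1 h.ud.cc).mulc (φ := fun x => β (x i)) (by fun_prop)
  have e1 := h.ud.ibpα (i := i) αd ca'
  have e2 := SI_w (i := i) (tg_CC (i := i) h.ud.C1 h.ud.cc) cβ h.ud.R0 (fun x hx => h.ud.tz hx)
  have h1 : ∫ x, GG y τ (x i) * gn u x ≤ (∫ x, gn u x) - (∫ x, -α (x i) * pd u i x) - ∫ x, β (x i) * tg i u x := by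
    have hi := int3 c1.int c2.int.neg c3.int
    have e : ∫ x, (-fun x => -α (x i) * pd u i x) x = - ∫ x, -α (x i) * pd u i x := integral_neg _
    rw [sub_eq_add_neg (∫ x, gn u x), ← e, ← hi.2]
    apply integral_mono c4.int hi.1
    intro x
    have hh := cs2 (a := τ (x i)) (b := bt τ (x i)) (by rw [S.bsq]; linarith) (tg_nonneg (i := i) u x) (gn_nonneg u x) (tg_sq u x)
    have g1 := GG_le_one y τ (x i)
    have := mul_le_mul_of_nonneg_left hh (sub_nonneg.2 g1)
    simp only [hα, hβ, Pi.neg_apply]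
    linarith
  have h2 := lin3 (by linarith [h.ud.R0] : -R ≤ R) 1 1 (d+1) (f := fun s => (d+1) * SI i (NN d u) s)
    (f1 := fun s => α' s * SI i u s) (f2 := fun s => β s * SI i (tg i u) s)
    (f3 := fun s => (GG y τ s * SI i (NN d u) s + |GG' (om d) d y (SI i (NN d u)) τ s| * SI i u s))
    (by fun_prop) (by fun_prop) (by fun_prop) (by fun_prop)
    (fun s _ => by
      have a1 := S.amgm s; have a2 := S.Hs0 s
      have g1 := GG_le_one y τ s
      have a3 := mul_le_mul_of_nonneg_left (le_trans (le_add_of_nonneg_right a2) a1) (sub_nonneg.2 g1)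
      have a4 : GG' (om d) d y (SI i (NN d u)) τ s * τ s ≤ |GG' (om d) d y (SI i (NN d u)) τ s| := by
        refine (le_abs_self _).trans ?_
        rw [abs_mul]
        exact mul_le_of_le_one_right (abs_nonneg _) (S.τ1 s).le
      have a5 := mul_le_mul_of_nonneg_right a4 (S.U0 s)
      have a6 : 0 ≤ d * (|GG' (om d) d y (SI i (NN d u)) τ s| * SI i u s) := by
        have := S.U0 s; positivity
      simp only [hα', hβ]
      linarith)
  rw [intervalIntegral.integral_const_mul] at h2
  rw [e1, e2] at h1
  rw [eN]
  linarith

theorem QD.Du {u : Eu (d+1) → ℝ} {R δ : ℝ} (h : QD d u R δ) {τ : ℝ → ℝ} {y : ℝ}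
    (S : SD d (om d) (-R) R y (SI i u) (SI i (NN d u)) (SI i (tg i u)) τ) :
    0 ≤ (∫ x, gn u x) - (d+1) * ∫ x, NN d u x := by
  have hq : (0:ℝ) < 1 + 1/(d:ℝ) := by positivity
  have eN := SI_w1 (i := i) h.NN_CC h.ud.R0 (fun x hx => h.ud.pwz hq hx)
  rw [eN]
  refine le_trans ?_ (S.intHs h.ud.HH)
  exact intervalIntegral.integral_nonneg (by linarith [h.ud.R0]) fun s _ => S.Hs0 s

/-- combined per-coordinate -/
theorem QD.coord {u : Eu (d+1) → ℝ} {R δ : ℝ} (h : QD d u R δ) {η : ℝ} (h0 : 0 < η) (h1 : η ≤ 1) (i : Fin (d+1)) :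
    ∃ (τ : ℝ → ℝ) (y : ℝ), (∀ s, |τ s| < 1) ∧ CC (ff1 τ i u) ∧ (∫ x, ff1 τ i u x ≤ DD d u δ η) ∧
      CC (fun x => GG y τ (x i) * gn u x) ∧ (∫ x, GG y τ (x i) * gn u x ≤ (1 + (d+1) * CD d) * DD d u δ η) := by
  obtain ⟨τ, y, S, hη⟩ := h.ex i
  obtain ⟨c1, F1⟩ := h.F1 S
  obtain ⟨c3, F3⟩ := h.F3 S
  have Du := h.Du S
  have hη := hη η h0 h1
  have L := S.lemD h.ud.HH
  have hq : (0:ℝ) < 1 + 1/(d:ℝ) := by positivity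
  have eN := SI_w1 (i := i) h.NN_CC h.ud.R0 (fun x hx => h.ud.pwz hq hx)
  have eU := SI_w1 (i := i) h.ud.cc h.ud.R0 (fun x hx => h.ud.hR x (by linarith))
  have hT : (∫ x, NN d u x) + 2*δ = om (d+1) := h.hT
  rw [intervalIntegral.integral_sub (S.cU.intervalIntegrable _ _) (S.cN.intervalIntegrable _ _), ← eN, ← eU] at L
  have hV := h.hV
  have hc := CD_nonneg d
  have δ0 := h.δ0
  have om0 := om_pos d
  have hp : 0 ≤ 2 * om d * η + 2^(d+3) * δ / η := by positivity
  have D1 : (∫ x, gn u x) - (d+1) * ∫ x, NN d u x ≤ DD d u δ η := by unfold DD; linarith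
  refine ⟨τ, y, S.τ1, c1, by linarith, c3, F3.trans ?_⟩
  have L2 := L.trans (mul_le_mul_of_nonneg_left (b := _) (c := DD d u δ η) (by unfold DD; linarith) hc)
  have := mul_le_mul_of_nonneg_left L2 (by positivity : (0:ℝ) ≤ (d:ℝ)+1)
  linarith

end
open MeasureTheory Metric Set

noncomputable section

variable {d : ℕ} {i : Fin (d+1)}

theorem w_arctan (w : ℝ) : w^2/(1+w^2) ≤ Real.arctan w ^ 2 := by
  have h : Real.sin (Real.arctan w) ^ 2 ≤ Real.arctan w ^ 2 := Real.sin_sq_le_sq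
  rw [Real.sin_arctan, div_pow, Real.sq_sqrt (by positivity)] at h
  exact h

theorem pt_e {g P t τ b : ℝ} (hg : 0 < g) (h : P^2+t^2 = g^2) (hb : b^2 = 1-τ^2) :
    (P + g*τ)^2/g ≤ 2*(g+τ*P-b*t) := by
  rw [div_le_iff₀ hg]
  have : 2*(g+τ*P-b*t)*g - (P+g*τ)^2 = (b*g-t)^2 := by
    linear_combination (-1)*h - g^2*hb
  nlinarith [sq_nonneg (b*g-t)]

theorem pt_Z {n : ℕ} (g : ℝ) (hg : 0 ≤ g) (P z τ b t w G : Fin n → ℝ) (hP : ∑ i, P i^2 = g^2)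
    (hτ : ∀ i, |τ i| < 1) (hb : ∀ i, b i^2 = 1 - τ i^2) (ht : ∀ i, P i^2 + t i^2 = g^2)
    (hw : ∀ i, z i = w i + τ i) (hG : ∀ i, w i^2/(1+w i^2) ≤ 4 * G i) :
    g + ∑ i, P i * (2 * z i/(1 + ∑ j, z j^2)) ≤ ∑ i, (4 * (g + τ i * P i - b i * t i) + 24 * (G i * g)) := by
  rcases hg.eq_or_lt with h0 | h0
  · subst h0
    have hP0 : ∀ i, P i = 0 := fun i => by
      have := ht i; nlinarith [sq_nonneg (P i), sq_nonneg (t i)]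
    have ht0 : ∀ i, t i = 0 := fun i => by
      have := ht i; nlinarith [sq_nonneg (P i), sq_nonneg (t i)]
    simp [hP0, ht0]
  set S := ∑ j, z j^2 with hS
  have S0 : 0 ≤ S := Finset.sum_nonneg fun _ _ => sq_nonneg _
  have e : g + ∑ i, P i * (2 * z i/(1 + S)) = ∑ i, (P i + g * z i)^2/g/(1+S) := by
    have e1 : ∑ i, (P i + g * z i)^2 = g^2 + 2 * g * ∑ i, P i * z i + g^2 * S := by
      rw [hS, ← hP, Finset.mul_sum, Finset.mul_sum, ← Finset.sum_add_distrib, ← Finset.sum_add_distrib, hP]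
      exact Finset.sum_congr rfl fun i _ => by ring
    have e2 : ∑ i, P i * (2 * z i/(1 + S)) = 2 * (∑ i, P i * z i)/(1+S) := by
      rw [Finset.mul_sum, Finset.sum_div]
      exact Finset.sum_congr rfl fun i _ => by ring
    rw [← Finset.sum_div, ← Finset.sum_div, e1, e2]
    field_simp
    ring
  rw [e]
  apply Finset.sum_le_sum
  intro i _
  have h1 := pt_e h0 (ht i) (hb i)
  have e0 : 0 ≤ g + τ i * P i - b i * t i := by
    have : 0 ≤ (P i + g * τ i)^2/g := by positivity
    linarith
  have hz : z i^2 ≤ S := Finset.single_le_sum (f := fun j => z j^2) (fun _ _ => sq_nonneg _) (Finset.mem_univ i)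
  have h2 : (P i + g * z i)^2/g ≤ 4 * (g + τ i * P i - b i * t i) + 2 * g * w i^2 := by
    have : (P i + g * z i)^2/g ≤ 2 * ((P i + g * τ i)^2/g) + 2 * g * w i^2 := by
      rw [hw i, ← mul_div_assoc, div_add' _ _ _ h0.ne', div_le_div_iff_of_pos_right h0]
      nlinarith [sq_nonneg (P i + g * τ i - g * w i)]
    linarith
  have hτ2 : τ i^2 ≤ 1 := by have := abs_lt.1 (hτ i); nlinarith
  have h3 : w i^2/(1+S) ≤ 3 * (w i^2/(1+w i^2)) := by
    rw [← mul_div_assoc, div_le_div_iff₀ (by positivity) (by positivity)]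
    have : 1 + w i^2 ≤ 3 * (1 + S) := by
      have : w i = z i - τ i := by rw [hw i]; ring
      rw [this]; nlinarith [sq_nonneg (z i + τ i)]
    calc w i^2 * (1+w i^2) ≤ w i^2 * (3 * (1+S)) := by gcongr
      _ = _ := by ring
  calc (P i + g * z i)^2/g/(1+S) ≤ (4 * (g + τ i * P i - b i * t i) + 2 * g * w i^2)/(1+S) := by gcongr
    _ = 4 * (g + τ i * P i - b i * t i)/(1+S) + 2 * g * (w i^2/(1+S)) := by ring
    _ ≤ 4 * (g + τ i * P i - b i * t i) + 2 * g * (3 * (4 * G i)) := by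
      have := hG i
      gcongr
      · apply div_le_self (by positivity) (by linarith)
      · linarith
    _ = _ := by ring

def Zi {n : ℕ} (y : Eu n) (i : Fin n) (x : Eu n) : ℝ := 2 * (x i - y i)/(1+‖x-y‖^2)
def ff (n : ℕ) (t : ℝ) : ℝ := (2*n-4)/(1+t) + 4/(1+t)^2

theorem Zi_C1 {n : ℕ} (y : Eu n) (i : Fin n) : ContDiff ℝ 1 (Zi y i) := by
  unfold Zi
  have h1 : ContDiff ℝ 1 (fun x : Eu n => x i) := (EuclideanSpace.proj i : Eu n →L[ℝ] ℝ).contDiff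
  have h2 : ContDiff ℝ 1 (fun x : Eu n => 1 + ‖x-y‖^2) := contDiff_const.add ((contDiff_id.sub contDiff_const).norm_sq ℝ)
  exact ContDiff.div (contDiff_const.mul (h1.sub contDiff_const)) h2 (fun x => by positivity)

theorem Zi_pd {n : ℕ} (y : Eu n) (i : Fin n) (x : Eu n) :
    pd (Zi y i) i x = 2/(1+‖x-y‖^2) - 4 * (x i - y i)^2/(1+‖x-y‖^2)^2 := by
  have hl : HasDerivAt (fun t : ℝ => Zi y i (x + t • EuclideanSpace.single i 1)) (pd (Zi y i) i x) 0 := by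
    have h1 : HasDerivAt (fun t : ℝ => x + t • (EuclideanSpace.single i 1 : Eu n)) (EuclideanSpace.single i 1) 0 := by
      have := ((hasDerivAt_id (0:ℝ)).smul_const (EuclideanSpace.single i 1 : Eu n)).const_add x
      simpa using this
    have h2 : HasFDerivAt (Zi y i) (fderiv ℝ (Zi y i) x) (x + (0:ℝ) • (EuclideanSpace.single i 1 : Eu n)) := by
      rw [zero_smul, add_zero]
      exact ((Zi_C1 y i).differentiable one_ne_zero x).hasFDerivAt
    exact h2.comp_hasDerivAt 0 h1
  have hn : ∀ t : ℝ, ‖x + t • (EuclideanSpace.single i 1 : Eu n) - y‖^2 = ‖x-y‖^2 + 2*t*(x i - y i) + t^2 := fun t => by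
    have : x + t • (EuclideanSpace.single i 1 : Eu n) - y = (x - y) + t • EuclideanSpace.single i 1 := by abel
    rw [this, norm_add_sq_real, norm_smul, inner_smul_right, EuclideanSpace.inner_single_right]
    simp; ring
  have e : (fun t : ℝ => Zi y i (x + t • EuclideanSpace.single i 1)) =
      fun t => 2 * (x i - y i + t)/(1 + (‖x-y‖^2 + 2*t*(x i - y i) + t^2)) := by
    ext t
    unfold Zi
    rw [hn]; simp; ring
  rw [e] at hl
  have h3 : HasDerivAt (fun t : ℝ => 2 * (x i - y i + t)) 2 0 := by
    have := ((hasDerivAt_id (0:ℝ)).const_add (x i - y i)).const_mul 2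
    simpa using this
  have h4 : HasDerivAt (fun t : ℝ => 1 + (‖x-y‖^2 + 2*t*(x i - y i) + t^2)) (2*(x i - y i)) 0 := by
    have a1 := (((hasDerivAt_id (0:ℝ)).const_mul 2).mul_const (x i - y i)).const_add (‖x-y‖^2)
    have a2 := ((a1.add ((hasDerivAt_id (0:ℝ)).pow 2)).const_add 1)
    simpa using a2
  have h5 := h3.div h4 (by simp; positivity)
  rw [hl.unique h5]
  simp
  field_simp
  ring

theorem Zi_div {n : ℕ} (y x : Eu n) : ∑ i, pd (Zi y i) i x = ff n (‖x-y‖^2) := by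
  simp only [Zi_pd]
  have : ∑ i, (2/(1+‖x-y‖^2) - 4 * (x i - y i)^2/(1+‖x-y‖^2)^2) = n * (2/(1+‖x-y‖^2)) - 4 * ‖x-y‖^2/(1+‖x-y‖^2)^2 := by
    rw [Finset.sum_sub_distrib]
    congr 1
    · simp
    · rw [← Finset.sum_div, ← Finset.mul_sum]
      congr 2
      rw [EuclideanSpace.norm_sq_eq]; simp
  rw [this, ff]
  field_simp
  ring

theorem ff_cont (n : ℕ) (y : Eu n) : Continuous (fun x : Eu n => ff n (‖x-y‖^2)) := by
  unfold ff
  have : ∀ x : Eu n, 1 + ‖x-y‖^2 ≠ 0 := fun x => by positivity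
  have h2 : ∀ x : Eu n, (1 + ‖x-y‖^2)^2 ≠ 0 := fun x => by positivity
  fun_prop (disch := assumption)

def CQ (d : ℕ) : ℝ := (d+1) * (4 + 24 * (1 + (d+1) * CD d))

theorem QD.main {u : Eu (d+1) → ℝ} {R δ : ℝ} (h : QD d u R δ) {η : ℝ} (h0 : 0 < η) (h1 : η ≤ 1) :
    ∃ y : Eu (d+1), (∫ x, gn u x) - ∫ x, ff (d+1) (‖x-y‖^2) * u x ≤ CQ d * DD d u δ η := by
  choose τ y hτ c1 F1 c3 F3 using fun i => h.coord h0 h1 i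
  refine ⟨WithLp.toLp 2 y, ?_⟩
  set yy : Eu (d+1) := WithLp.toLp 2 y with hyy
  have cg := gn_CC h.ud.C1 h.ud.cc
  have cp := fun i => (pd_CC h.ud.C1 h.ud.cc i).mulc (φ := Zi yy i) (Zi_C1 yy i).continuous
  have e1 : ∫ x, ff (d+1) (‖x-yy‖^2) * u x = - ∑ i, ∫ x, Zi yy i x * pd u i x := by
    simp only [ibp h.ud.C1 h.ud.cc (Zi_C1 yy _)]
    rw [Finset.sum_neg_distrib, neg_neg, ← integral_finsetSum _ (fun i _ => (h.ud.cc.mulc (pd_cont (Zi_C1 yy i) i)).int)]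
    congr 1; ext x
    rw [← Finset.sum_mul, Zi_div]
  rw [e1, sub_neg_eq_add, ← integral_finsetSum _ (fun i _ => (cp i).int), ← integral_add cg.int
    (integrable_finsetSum _ (fun i _ => (cp i).int))]
  have hI : Integrable (fun x => ∑ i, (4 * ff1 (τ i) i u x + 24 * (GG (y i) (τ i) (x i) * gn u x))) :=
    integrable_finsetSum _ fun i _ => ((c1 i).int.const_mul 4).add ((c3 i).int.const_mul 24)
  calc _ ≤ ∫ x, ∑ i, (4 * ff1 (τ i) i u x + 24 * (GG (y i) (τ i) (x i) * gn u x)) := by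
        apply integral_mono (cg.int.add (integrable_finsetSum _ (fun i _ => (cp i).int))) hI
        intro x
        have hb : ∀ i, bt (τ i) (x i) ^ 2 = 1 - τ i (x i)^2 := fun i => by
          have := abs_lt.1 (hτ i (x i))
          exact Real.sq_sqrt (by nlinarith)
        have := pt_Z (gn u x) (gn_nonneg u x) (fun i => pd u i x) (fun i => x i - y i) (fun i => τ i (x i))
          (fun i => bt (τ i) (x i)) (fun i => tg i u x) (fun i => x i - y i - τ i (x i)) (fun i => GG (y i) (τ i) (x i))
          (gn_sq u x).symm (fun i => hτ i (x i)) hb (fun i => tg_sq u x) (fun i => by ring)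
          (fun i => by
            have := w_arctan (x i - y i - τ i (x i))
            unfold GG; linarith)
        have e : ‖x - yy‖^2 = ∑ j, (x j - y j)^2 := by
          rw [EuclideanSpace.norm_sq_eq]; simp [hyy]
        refine le_trans (le_of_eq ?_) this
        simp only [Zi, e, Pi.add_apply]
        congr 1
        exact Finset.sum_congr rfl fun i _ => by rw [mul_comm]
    _ = ∑ i, (4 * (∫ x, ff1 (τ i) i u x) + 24 * ∫ x, GG (y i) (τ i) (x i) * gn u x) := by
        have hi : ∀ i, Integrable (fun x => 4 * ff1 (τ i) i u x + 24 * (GG (y i) (τ i) (x i) * gn u x)) :=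
          fun i => ((c1 i).int.const_mul 4).add ((c3 i).int.const_mul 24)
        rw [integral_finsetSum _ (fun i _ => hi i)]
        refine Finset.sum_congr rfl fun i _ => ?_
        rw [integral_add ((c1 i).int.const_mul 4) ((c3 i).int.const_mul 24), integral_const_mul, integral_const_mul]
    _ ≤ ∑ i : Fin (d+1), (4 * DD d u δ η + 24 * ((1 + (d+1) * CD d) * DD d u δ η)) := by
        apply Finset.sum_le_sum
        intro i _
        have := F1 i; have := F3 i
        gcongr
    _ = _ := by simp [CQ]; ring

end
open MeasureTheory Metric Set

noncomputable section

def wk {n : ℕ} (k : ℕ) (x : Eu n) : ℝ := Real.smoothTransition (k * (1 - ‖x‖^2))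
def ck {n : ℕ} (k : ℕ) (x : Eu n) : ℝ := 2 * k * deriv Real.smoothTransition (k * (1 - ‖x‖^2))

theorem sT_C1 : ContDiff ℝ 1 Real.smoothTransition := Real.smoothTransition.contDiff (n := 1)

theorem wk_C1 {n : ℕ} (k : ℕ) : ContDiff ℝ 1 (wk k : Eu n → ℝ) := by
  unfold wk
  exact sT_C1.comp (contDiff_const.mul (contDiff_const.sub (contDiff_id.norm_sq ℝ)))

theorem wk_zero {n : ℕ} (k : ℕ) (x : Eu n) (hx : 1 ≤ ‖x‖) : wk k x = 0 := by
  unfold wk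
  apply Real.smoothTransition.zero_of_nonpos
  have : 0 ≤ (k:ℝ) := Nat.cast_nonneg k
  have : 1 - ‖x‖^2 ≤ 0 := by nlinarith
  nlinarith

theorem wk_CC {n : ℕ} (k : ℕ) : CC (wk k : Eu n → ℝ) :=
  ⟨(wk_C1 k).continuous, 1, one_pos, fun x hx => wk_zero k x hx⟩

theorem wk_pd {n : ℕ} (k : ℕ) (i : Fin n) (x : Eu n) : pd (wk k) i x = - ck k x * x i := by
  have h1 : HasFDerivAt (fun x : Eu n => ‖x‖^2) (2 • innerSL ℝ x) x := (hasStrictFDerivAt_norm_sq x).hasFDerivAt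
  have h2 := (h1.const_sub 1).const_mul (k:ℝ)
  have h3 : HasDerivAt Real.smoothTransition (deriv Real.smoothTransition (k * (1 - ‖x‖^2))) (k * (1 - ‖x‖^2)) :=
    (sT_C1.differentiable one_ne_zero _).hasDerivAt
  have h4 := h3.comp_hasFDerivAt x h2
  have h5 : HasFDerivAt (wk k) _ x := h4
  unfold pd
  rw [h5.fderiv]
  simp [ck, EuclideanSpace.inner_single_right]
  ring

theorem ck_nonneg {n : ℕ} (k : ℕ) (x : Eu n) : 0 ≤ ck k x := by
  unfold ck
  have := Real.smoothTransition.monotone.deriv_nonneg (x := k * (1 - ‖x‖^2))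
  positivity

theorem ck_supp {n : ℕ} (k : ℕ) (x : Eu n) (hx : 1 < k * (1 - ‖x‖^2)) : ck k x = 0 := by
  unfold ck
  have : Real.smoothTransition =ᶠ[nhds (k * (1 - ‖x‖^2))] fun _ => 1 := by
    filter_upwards [lt_mem_nhds hx] with z hz using Real.smoothTransition.one_of_one_le (le_of_lt hz)
  rw [this.deriv_eq]; simp

theorem ck_norm {n : ℕ} {k : ℕ} (hk : 1 ≤ k) (x : Eu n) : (1 - 1/(k:ℝ)) * (ck k x * ‖x‖) ≤ ck k x * ‖x‖^2 := by
  rcases lt_or_ge 1 (k * (1 - ‖x‖^2)) with h | h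
  · rw [ck_supp k x h]; simp
  · have k0 : (0:ℝ) < k := by exact_mod_cast hk
    have h1 : 1 - ‖x‖^2 ≤ 1/k := by rw [le_div_iff₀ k0]; linarith
    have h2 : 1 - 1/(k:ℝ) ≤ ‖x‖ := by
      have : 0 < 1/(k:ℝ) := by positivity
      by_contra hc
      have : ‖x‖ < 1 := by linarith
      have : ‖x‖^2 ≤ ‖x‖ := by nlinarith [norm_nonneg x]
      linarith
    have := mul_nonneg (ck_nonneg k x) (norm_nonneg x)
    nlinarith

theorem cs_le {n : ℕ} {a : Fin n → ℝ} (ha : ∑ i, a i^2 ≤ 1) (x : Eu n) : ∑ i, a i * x i ≤ ‖x‖ := by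
  apply abs_le_of_sq_le_sq' _ (norm_nonneg x) |>.2
  have := Finset.sum_mul_sq_le_sq_mul_sq Finset.univ a (fun i => x i)
  rw [EuclideanSpace.real_norm_sq_eq]
  refine this.trans ?_
  have h0 : 0 ≤ ∑ i, x i^2 := Finset.sum_nonneg fun _ _ => sq_nonneg _
  nlinarith

theorem pd_coord {n : ℕ} (i : Fin n) (x : Eu n) : pd (fun x : Eu n => x i) i x = 1 := by
  unfold pd
  have h1 : HasFDerivAt (fun x : Eu n => x i) (EuclideanSpace.proj i : Eu n →L[ℝ] ℝ) x :=
    (EuclideanSpace.proj i : Eu n →L[ℝ] ℝ).hasFDerivAt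
  rw [h1.fderiv]; simp

theorem coord_C1' {n : ℕ} (j : Fin n) : ContDiff ℝ 1 (fun x : Eu n => x j) :=
  (EuclideanSpace.proj j : Eu n →L[ℝ] ℝ).contDiff

theorem wk_int {n : ℕ} (k : ℕ) : ∫ x : Eu n, wk k x ≤ om n := by
  have h1 : om n = ∫ x : Eu n, (ball (0 : Eu n) 1).indicator (fun _ => (1:ℝ)) x := by
    rw [integral_indicator measurableSet_ball]; simp [om, Measure.real]
  rw [h1]
  apply integral_mono (wk_CC k).int
  · rw [integrable_indicator_iff measurableSet_ball]
    exact integrableOn_const measure_ball_lt_top.ne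
  · intro x
    by_cases hx : x ∈ ball (0 : Eu n) 1
    · rw [indicator_of_mem hx]; exact Real.smoothTransition.le_one _
    · rw [indicator_of_notMem hx]
      rw [wk_zero k x (by simpa using hx)]

theorem div_wk {n : ℕ} {X : Fin n → Eu n → ℝ} (hX : ∀ i, ContDiff ℝ 1 (X i)) (h1 : ∀ x, ∑ i, X i x^2 ≤ 1) {k : ℕ}
    (hk : 1 ≤ k) : (1 - 1/(k:ℝ)) * ∫ x, (∑ i, pd (X i) i x) * wk k x ≤ n * om n := by
  have gen : ∀ Y : Fin n → Eu n → ℝ, (∀ i, ContDiff ℝ 1 (Y i)) →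
      Integrable (fun x => ck k x * ∑ i, Y i x * x i) ∧
      ∫ x, (∑ i, pd (Y i) i x) * wk k x = ∫ x, ck k x * ∑ i, Y i x * x i := by
    intro Y hY
    have e : ∀ x, ck k x * ∑ i, Y i x * x i = - ∑ i, Y i x * pd (wk k) i x := fun x => by
      simp only [wk_pd]
      rw [Finset.mul_sum, ← Finset.sum_neg_distrib]
      exact Finset.sum_congr rfl fun i _ => by ring
    have hi : ∀ i, Integrable (fun x => Y i x * pd (wk k) i x) := fun i =>
      ((pd_CC (wk_C1 k) (wk_CC k) i).mulc (hY i).continuous).int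
    simp only [e]
    refine ⟨(integrable_finsetSum _ fun i _ => hi i).neg, ?_⟩
    rw [integral_neg, integral_finsetSum _ fun i _ => hi i]
    simp only [ibp (wk_C1 k) (wk_CC k) (hY _)]
    rw [Finset.sum_neg_distrib, neg_neg, ← integral_finsetSum _ (fun i _ => ((wk_CC k).mulc (pd_cont (hY i) i)).int)]
    simp only [Finset.sum_mul]
  obtain ⟨i1, e1⟩ := gen X hX
  obtain ⟨i2, e2⟩ := gen (fun i x => x i) (fun i => coord_C1' i)
  simp only [pd_coord] at e2
  have hr : (1 - 1/(k:ℝ)) ≥ 0 := by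
    have : (1:ℝ) ≤ k := by exact_mod_cast hk
    rw [ge_iff_le, sub_nonneg, div_le_one (by linarith)]; exact this
  calc (1 - 1/(k:ℝ)) * ∫ x, (∑ i, pd (X i) i x) * wk k x = ∫ x, (1 - 1/(k:ℝ)) * (ck k x * ∑ i, X i x * x i) := by
        rw [e1, integral_const_mul]
    _ ≤ ∫ x : Eu n, ck k x * ∑ i, x i * x i := by
        apply integral_mono (i1.const_mul _) i2
        intro x
        have a1 := ck_norm hk x
        have a2 := mul_le_mul_of_nonneg_left (cs_le (h1 x) x) (ck_nonneg k x)
        have a3 := mul_le_mul_of_nonneg_left a2 hr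
        have a4 : ‖x‖^2 = ∑ i, x i * x i := by
          rw [EuclideanSpace.real_norm_sq_eq]; simp only [sq]
        simp only [← a4]
        linarith
    _ = n * ∫ x : Eu n, wk k x := by
        rw [← e2, ← integral_const_mul]; simp
    _ ≤ n * om n := by
        have := wk_int (n := n) k
        gcongr

theorem wk_tendsto {n : ℕ} (x : Eu n) :
    Filter.Tendsto (fun k : ℕ => wk k x) Filter.atTop (nhds ((ball (0 : Eu n) 1).indicator (fun _ => (1:ℝ)) x)) := by
  by_cases hx : x ∈ ball (0 : Eu n) 1
  · rw [indicator_of_mem hx]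
    have h : 0 < 1 - ‖x‖^2 := by
      have : ‖x‖ < 1 := by simpa using hx
      nlinarith [norm_nonneg x]
    obtain ⟨K, hK⟩ := exists_nat_gt (1/(1-‖x‖^2))
    apply tendsto_const_nhds.congr'
    filter_upwards [Filter.eventually_ge_atTop K] with k hk
    symm
    apply Real.smoothTransition.one_of_one_le
    rw [div_lt_iff₀ h] at hK
    have : (K:ℝ) ≤ k := by exact_mod_cast hk
    nlinarith
  · rw [indicator_of_notMem hx]
    have : ∀ k : ℕ, wk k x = 0 := fun k => wk_zero k x (by simpa using hx)
    simp [this]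

theorem divBall_le {n : ℕ} {X : Fin n → Eu n → ℝ} (hX : ∀ i, ContDiff ℝ 1 (X i)) (h1 : ∀ x, ∑ i, X i x^2 ≤ 1) :
    ∫ x in ball (0 : Eu n) 1, (∑ i, pd (X i) i x) ≤ n * om n := by
  set g : Eu n → ℝ := fun x => ∑ i, pd (X i) i x with hg
  have cg : Continuous g := by
    have := fun i => pd_cont (hX i) i
    fun_prop
  have lim1 : Filter.Tendsto (fun k : ℕ => ∫ x, g x * wk k x) Filter.atTop
      (nhds (∫ x, g x * (ball (0 : Eu n) 1).indicator (fun _ => (1:ℝ)) x)) := by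
    apply tendsto_integral_of_dominated_convergence (fun x => (closedBall (0 : Eu n) 1).indicator (fun x => |g x|) x)
    · exact fun k => ((wk_CC k).mulc cg).1.aestronglyMeasurable
    · rw [integrable_indicator_iff measurableSet_closedBall]
      exact cg.abs.continuousOn.integrableOn_compact (isCompact_closedBall _ _)
    · intro k
      refine Filter.Eventually.of_forall fun x => ?_
      by_cases hx : x ∈ closedBall (0 : Eu n) 1
      · rw [indicator_of_mem hx, norm_mul, Real.norm_eq_abs, Real.norm_eq_abs]
        apply mul_le_of_le_one_right (abs_nonneg _)
        rw [wk, abs_of_nonneg (Real.smoothTransition.nonneg _)]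
        exact Real.smoothTransition.le_one _
      · rw [indicator_of_notMem hx, wk_zero k x (by simp at hx; exact hx.le)]; simp
    · exact Filter.Eventually.of_forall fun x => (wk_tendsto x).const_mul _
  have lim2 : Filter.Tendsto (fun k : ℕ => 1 - 1/(k:ℝ)) Filter.atTop (nhds (1 - 0)) :=
    tendsto_const_nhds.sub tendsto_one_div_atTop_nhds_zero_nat
  have lim := lim2.mul lim1
  have e : ∫ x in ball (0 : Eu n) 1, g x = (1 - 0) * ∫ x, g x * (ball (0 : Eu n) 1).indicator (fun _ => (1:ℝ)) x := by
    rw [← integral_indicator measurableSet_ball, sub_zero, one_mul]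
    congr 1; ext x
    by_cases hx : x ∈ ball (0 : Eu n) 1
    · rw [indicator_of_mem hx, indicator_of_mem hx, mul_one]
    · rw [indicator_of_notMem hx, indicator_of_notMem hx, mul_zero]
  rw [e]
  apply le_of_tendsto lim
  filter_upwards [Filter.eventually_ge_atTop 1] with k hk using div_wk hX h1 hk

theorem ff_ball (n : ℕ) : ∫ x in ball (0 : Eu n) 1, ff n (‖x‖^2) ≤ n * om n := by
  have := divBall_le (X := fun i => Zi (0 : Eu n) i) (fun i => Zi_C1 0 i) (fun x => by
    unfold Zi
    simp only [sub_zero, div_pow]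
    rw [← Finset.sum_div, div_le_one (by positivity)]
    have e : ∑ i, (2 * (x i - (0 : Eu n) i))^2 = 4 * ‖x‖^2 := by
      rw [EuclideanSpace.real_norm_sq_eq, Finset.mul_sum]
      exact Finset.sum_congr rfl fun i _ => by simp; ring
    rw [e]; nlinarith [sq_nonneg (1 - ‖x‖^2)])
  simpa only [Zi_div, sub_zero] using this

theorem vdiv_eq {n : ℕ} {φ : Eu n → Eu n} (h : ContDiff ℝ 1 φ) (x : Eu n) :
    vdiv φ x = ∑ i, pd (fun x => φ x i) i x := by
  unfold vdiv pd
  refine Finset.sum_congr rfl fun i _ => ?_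
  have h1 : HasFDerivAt (fun x : Eu n => φ x i) ((EuclideanSpace.proj i : Eu n →L[ℝ] ℝ).comp (fderiv ℝ φ x)) x :=
    (EuclideanSpace.proj i : Eu n →L[ℝ] ℝ).hasFDerivAt.comp x (h.differentiable one_ne_zero x).hasFDerivAt
  rw [h1.fderiv]; simp

theorem perimeter_ball (n : ℕ) : perimeter (ball (0 : Eu n) 1) ≤ n * om n := by
  unfold perimeter
  apply csSup_le
  · exact ⟨_, 0, contDiff_const, HasCompactSupport.zero, by simp, rfl⟩
  · rintro r ⟨φ, h1, -, h3, rfl⟩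
    simp only [vdiv_eq h1]
    apply divBall_le
    · exact fun i => (coord_C1' i).comp h1
    · intro x
      rw [← EuclideanSpace.real_norm_sq_eq]
      have := h3 x
      nlinarith [norm_nonneg (φ x)]

end
open MeasureTheory Metric Set

noncomputable section

/-- smooth functions approximating the indicator of a set -/
structure MO {n : ℕ} (E : Set (Eu n)) (v : Eu n → ℝ) : Prop where
  c2 : ContDiff ℝ 2 v
  v0 : ∀ x, 0 ≤ v x
  v1 : ∀ x, v x ≤ 1
  vi : Integrable v
  vI : ∫ x, v x = om n
  vp : ∀ X : Fin n → Eu n → ℝ, (∀ i, ContDiff ℝ 1 (X i)) → (∀ i, CC (X i)) → (∀ x, ∑ i, X i x^2 ≤ 1) →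
    ∫ x, v x * ∑ i, pd (X i) i x ≤ perimeter E

theorem pd_shift {n : ℕ} (X : Eu n → ℝ) (i : Fin n) (t x : Eu n) :
    pd (fun x => X (x + t)) i x = pd X i (x + t) := by
  unfold pd
  rw [fderiv_comp_add_right]

theorem per_shift {n : ℕ} {E : Set (Eu n)} (hE : HasFinitePerimeter E) {X : Fin n → Eu n → ℝ}
    (hX : ∀ i, ContDiff ℝ 1 (X i)) (hC : ∀ i, CC (X i)) (h1 : ∀ x, ∑ i, X i x^2 ≤ 1) (t : Eu n) :
    ∫ x in E, ∑ i, pd (X i) i (x + t) ≤ perimeter E := by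
  apply le_csSup hE.2
  have hc : ContDiff ℝ 1 (fun x : Eu n => (WithLp.toLp 2 (fun i => X i (x + t)) : Eu n)) := by
    rw [contDiff_euclidean]
    intro i
    exact (hX i).comp (contDiff_id.add contDiff_const)
  refine ⟨fun x => WithLp.toLp 2 (fun i => X i (x + t)), hc, ?_, ?_, ?_⟩
  · choose h R hR0 hR using hC
    refine HasCompactSupport.intro (isCompact_closedBall (0 : Eu n) ((∑ i, R i) + ‖t‖)) (fun x hx => ?_)
    ext i
    simp only [PiLp.zero_apply]
    apply hR
    have h1 : R i ≤ ∑ i, R i := Finset.single_le_sum (fun i _ => (hR0 i).le) (Finset.mem_univ i)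
    have h2 : ‖x‖ ≤ ‖x + t‖ + ‖t‖ := by
      have := norm_sub_le (x + t) t; simpa using this
    simp at hx
    linarith
  · intro x
    rw [EuclideanSpace.norm_eq]
    simp only [Real.norm_eq_abs, sq_abs]
    rw [Real.sqrt_le_one]
    exact h1 _
  · refine integral_congr_ae (Filter.Eventually.of_forall fun x => ?_)
    simp only
    rw [vdiv_eq hc]
    exact Finset.sum_congr rfl fun i _ => (pd_shift (X i) i t x).symm

theorem moll {n : ℕ} {E : Set (Eu n)} (hE : HasFinitePerimeter E)
    (hV : volume E = volume (ball (0 : Eu n) 1)) {ε : ℝ} (hε : 0 < ε) :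
    ∃ v, MO E v ∧ ∫ x, |E.indicator 1 x - v x| ≤ ε := by
  set χ : Eu n → ℝ := E.indicator 1 with hχ
  have hVf : volume E ≠ ⊤ := by rw [hV]; exact measure_ball_lt_top.ne
  have χi : Integrable χ := by
    rw [hχ, integrable_indicator_iff hE.1]
    exact integrableOn_const (C := (1:ℝ)) hVf
  have χI : ∫ x, χ x = om n := by
    rw [hχ, integral_indicator hE.1]
    simp [om, Measure.real, hV]
  have χ0 : ∀ x, 0 ≤ χ x := fun x => indicator_nonneg (fun _ _ => zero_le_one) x
  have χ1 : ∀ x, χ x ≤ 1 := fun x => by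
    rw [hχ]; exact indicator_le_self' (fun _ _ => zero_le_one) x
  let φ : ℕ → ContDiffBump (0 : Eu n) := fun k =>
    ⟨1/((k:ℝ)+1), 2/((k:ℝ)+1), by positivity, by gcongr; norm_num⟩
  let v : ℕ → Eu n → ℝ := fun k => convolution ((φ k).normed volume) χ (ContinuousLinearMap.lsmul ℝ ℝ) volume
  have ρi : ∀ k, Integrable ((φ k).normed volume) := fun k => (φ k).integrable_normed
  have ve : ∀ k x, v k x = ∫ t, (φ k).normed volume t * χ (x - t) := fun k x => by
    simp [v, convolution_def]
  have vi : ∀ k, Integrable (v k) := fun k => (ρi k).integrable_convolution _ χi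
  have vI : ∀ k, ∫ x, v k x = om n := fun k => by
    show ∫ x, convolution ((φ k).normed volume) χ (ContinuousLinearMap.lsmul ℝ ℝ) volume x = _
    rw [integral_convolution _ (ρi k) χi, (φ k).integral_normed, χI]; simp
  have hint : ∀ k x, Integrable (fun t => (φ k).normed volume t * χ (x - t)) := fun k x => by
    apply (ρi k).mul_bdd (c := 1)
    · exact (χi.comp_sub_left x).aestronglyMeasurable
    · refine Filter.Eventually.of_forall fun t => ?_
      rw [Real.norm_eq_abs, abs_of_nonneg (χ0 _)]; exact χ1 _
  have v0 : ∀ k x, 0 ≤ v k x := fun k x => by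
    rw [ve]; exact integral_nonneg fun t => mul_nonneg ((φ k).nonneg_normed t) (χ0 _)
  have v1 : ∀ k x, v k x ≤ 1 := fun k x => by
    rw [ve, ← (φ k).integral_normed (μ := volume)]
    refine integral_mono (hint k x) (ρi k) fun t => ?_
    exact mul_le_of_le_one_right ((φ k).nonneg_normed t) (χ1 _)
  have mo : ∀ k, MO E (v k) := by
    intro k
    refine ⟨?_, v0 k, v1 k, vi k, vI k, ?_⟩
    · exact (φ k).hasCompactSupport_normed.contDiff_convolution_left (n := 2) _ (φ k).contDiff_normed χi.locallyIntegrable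
    · intro X hX hC h1
      set D : Eu n → ℝ := fun x => ∑ i, pd (X i) i x with hD
      have cD : Continuous D := by
        have := fun i => pd_cont (hX i) i
        fun_prop
      obtain ⟨B, hB⟩ : ∃ B, ∀ x, ‖D x‖ ≤ B := by
        have : ∀ i, ∃ B, ∀ x, ‖pd (X i) i x‖ ≤ B := fun i =>
          (pd_CC (hX i) (hC i) i).hcs.exists_bound_of_continuous (pd_cont (hX i) i)
        choose B hB using this
        exact ⟨∑ i, B i, fun x => (norm_sum_le _ _).trans (Finset.sum_le_sum fun i _ => hB i x)⟩
      have I2 : Integrable (fun p : Eu n × Eu n => ((φ k).normed volume p.2 * χ (p.1 - p.2)) * D p.1) (volume.prod volume) := by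
        have := (ρi k).convolution_integrand (ContinuousLinearMap.lsmul ℝ ℝ) χi
        simp only [ContinuousLinearMap.lsmul_apply, smul_eq_mul] at this
        apply this.mul_bdd (c := B)
        · exact (cD.comp continuous_fst).aestronglyMeasurable
        · exact Filter.Eventually.of_forall fun p => hB _
      calc ∫ x, v k x * D x = ∫ x, ∫ t, ((φ k).normed volume t * χ (x - t)) * D x := by
            simp only [ve, integral_mul_const]
        _ = ∫ t, ∫ x, ((φ k).normed volume t * χ (x - t)) * D x := integral_integral_swap I2
        _ ≤ ∫ t, (φ k).normed volume t * perimeter E := by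
            apply integral_mono I2.integral_prod_right ((ρi k).mul_const _)
            intro t
            simp only [mul_assoc]
            rw [integral_const_mul]
            apply mul_le_mul_of_nonneg_left _ ((φ k).nonneg_normed t)
            have e : ∫ x, χ (x - t) * D x = ∫ x in E, D (x + t) := by
              rw [← integral_add_right_eq_self _ t, ← integral_indicator hE.1]
              congr 1; ext x
              by_cases hx : x ∈ E <;> simp [hχ, hx]
            rw [e]
            exact per_shift hE hX hC h1 t
        _ = perimeter E := by rw [integral_mul_const, (φ k).integral_normed, one_mul]
  have ae : ∀ᵐ x, Filter.Tendsto (fun k => v k x) Filter.atTop (nhds (χ x)) := by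
    apply ContDiffBump.ae_convolution_tendsto_right_of_locallyIntegrable (K := 2)
    · have : Filter.Tendsto (fun k : ℕ => 2 * (1/((k:ℝ)+1))) Filter.atTop (nhds (2 * 0)) :=
        tendsto_one_div_add_atTop_nhds_zero_nat.const_mul 2
      simpa [φ, div_eq_mul_inv] using this
    · refine Filter.Eventually.of_forall fun k => ?_
      simp only [φ]
      apply le_of_eq; ring
    · exact χi.locallyIntegrable
  have lim : Filter.Tendsto (fun k => ∫ x, max (χ x - v k x) 0) Filter.atTop (nhds (∫ _ : Eu n, (0:ℝ))) := by
    apply tendsto_integral_of_dominated_convergence χ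
    · exact fun k => ((χi.sub (vi k)).pos_part).aestronglyMeasurable
    · exact χi
    · intro k
      refine Filter.Eventually.of_forall fun x => ?_
      rw [Real.norm_eq_abs, abs_of_nonneg (le_max_right _ _)]
      exact max_le (by linarith [v0 k x]) (χ0 x)
    · filter_upwards [ae] with x hx
      have := ((tendsto_const_nhds (x := χ x)).sub hx).max (tendsto_const_nhds (x := (0:ℝ)))
      simpa using this
  rw [integral_zero] at lim
  obtain ⟨k, hk⟩ := (lim.eventually (gt_mem_nhds (half_pos hε))).exists
  refine ⟨v k, mo k, ?_⟩
  have e : ∀ x, |χ x - v k x| = 2 * max (χ x - v k x) 0 - (χ x - v k x) := fun x => by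
    rcases le_total 0 (χ x - v k x) with h | h
    · rw [abs_of_nonneg h, max_eq_left h]; ring
    · rw [abs_of_nonpos h, max_eq_right h]; ring
  simp only [e]
  have i1 : Integrable (fun x => max (χ x - v k x) 0) := (χi.sub (vi k)).pos_part
  have i2 : Integrable (fun x => χ x - v k x) := χi.sub (vi k)
  rw [integral_sub (i1.const_mul 2) i2, integral_const_mul, integral_sub χi (vi k), χI, vI]
  linarith

end
open MeasureTheory Metric Set

noncomputable section

theorem pd_C1 {n : ℕ} {v : Eu n → ℝ} (h : ContDiff ℝ 2 v) (i : Fin n) : ContDiff ℝ 1 (pd v i) := by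
  unfold pd
  exact (h.fderiv_right (m := 1) (by norm_num)).clm_apply contDiff_const

theorem MO.grad {n : ℕ} {E : Set (Eu n)} {v c : Eu n → ℝ} (h : MO E v) (hc : ContDiff ℝ 1 c) (hC : CC c)
    (c0 : ∀ x, 0 ≤ c x) (c1 : ∀ x, c x ≤ 1) : ∫ x, c x * gn v x ≤ perimeter E := by
  have v1 : ContDiff ℝ 1 v := h.c2.of_le (by norm_num)
  have key : ∀ η : ℝ, 0 < η → ∫ x, c x * gn v x ≤ perimeter E + η * ∫ x, c x := by
    intro η hη
    set S : Eu n → ℝ := fun x => ∑ j, pd v j x^2 with hS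
    have S0 : ∀ x, 0 ≤ S x := fun x => Finset.sum_nonneg fun _ _ => sq_nonneg _
    have SC : ContDiff ℝ 1 S := ContDiff.sum fun j _ => (pd_C1 h.c2 j).pow 2
    have q0 : ∀ x, 0 < η^2 + S x := fun x => by have := S0 x; positivity
    set q : Eu n → ℝ := fun x => √(η^2 + S x) with hq
    have qp : ∀ x, 0 < q x := fun x => Real.sqrt_pos.2 (q0 x)
    have q2 : ∀ x, q x^2 = η^2 + S x := fun x => Real.sq_sqrt (q0 x).le
    have qC : ContDiff ℝ 1 q := (contDiff_const.add SC).sqrt fun x => (q0 x).ne'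
    set Y : Fin n → Eu n → ℝ := fun i x => (- pd v i x / q x) with hY
    have YC : ∀ i, ContDiff ℝ 1 (Y i) := fun i => (pd_C1 h.c2 i).neg.div qC fun x => (qp x).ne'
    set X : Fin n → Eu n → ℝ := fun i x => Y i x * c x with hX
    have XC : ∀ i, ContDiff ℝ 1 (X i) := fun i => (YC i).mul hc
    have XCC : ∀ i, CC (X i) := fun i => hC.mulc (YC i).continuous
    have X1 : ∀ x, ∑ i, X i x^2 ≤ 1 := by
      intro x
      have e : ∑ i, X i x^2 = S x / q x^2 * c x^2 := by
        simp only [hX, hY, hS, mul_pow, div_pow, neg_sq]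
        rw [← Finset.sum_mul, ← Finset.sum_div]
      rw [e]
      have a1 : S x / q x^2 ≤ 1 := by
        rw [div_le_one (pow_pos (qp x) 2), q2]; nlinarith
      have a2 : c x^2 ≤ 1 := by have := c0 x; have := c1 x; nlinarith
      exact mul_le_one₀ a1 (sq_nonneg _) a2
    have main := h.vp X XC XCC X1
    have e1 : ∫ x, v x * ∑ i, pd (X i) i x = ∫ x, c x * (S x / q x) := by
      have i1 : ∀ i, Integrable (fun x => v x * pd (X i) i x) := fun i =>
        ((pd_CC (XC i) (XCC i) i).mulc v1.continuous).int
      have i2 : ∀ i, Integrable (fun x => pd v i x * X i x) := fun i =>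
        ((XCC i).mulc (pd_cont v1 i)).int
      simp only [Finset.mul_sum]
      rw [integral_finsetSum _ fun i _ => i1 i]
      simp only [ibp (XC _) (XCC _) v1]
      rw [Finset.sum_neg_distrib, ← integral_finsetSum _ fun i _ => i2 i, ← integral_neg]
      congr 1; ext x
      rw [← Finset.sum_neg_distrib]
      simp only [hS]
      rw [Finset.sum_div, Finset.mul_sum]
      refine Finset.sum_congr rfl fun i _ => ?_
      simp only [hX, hY]; ring
    rw [e1] at main
    have i3 : Integrable (fun x => c x * (S x / q x)) := by
      have : Continuous fun x => S x / q x := SC.continuous.div qC.continuous fun x => (qp x).ne'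
      have := (hC.mulc this).int
      simpa only [mul_comm] using this
    have i4 : Integrable (fun x => c x * gn v x) := by
      have := (hC.mulc (gn_cont v1)).int
      simpa only [mul_comm] using this
    have i5 : Integrable (fun x => η * c x) := hC.int.const_mul η
    calc ∫ x, c x * gn v x ≤ ∫ x, (c x * (S x / q x) + η * c x) := by
          apply integral_mono i4 (i3.add i5)
          intro x
          show c x * gn v x ≤ c x * (S x / q x) + η * c x
          have : gn v x ≤ S x / q x + η := by
            have s0 : 0 ≤ gn v x := Real.sqrt_nonneg _
            have s2 : gn v x^2 = S x := Real.sq_sqrt (S0 x)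
            have Q0 := qp x
            have Q2 := q2 x
            rw [← s2] at Q2 ⊢
            have Q3 : q x ≤ gn v x + η := by
              apply abs_le_of_sq_le_sq' _ (by positivity) |>.2
              nlinarith
            rw [← sub_le_iff_le_add, le_div_iff₀ Q0]
            rcases le_total (gn v x) η with h | h
            · nlinarith
            · nlinarith
          calc c x * gn v x ≤ c x * (S x / q x + η) := mul_le_mul_of_nonneg_left this (c0 x)
            _ = _ := by ring
      _ = (∫ x, c x * (S x / q x)) + η * ∫ x, c x := by rw [integral_add i3 i5, integral_const_mul]
      _ ≤ _ := by linarith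
  have I0 : 0 ≤ ∫ x, c x := integral_nonneg c0
  apply le_of_forall_pos_le_add
  intro ε hε
  have k := key (ε / (1 + ∫ x, c x)) (by positivity)
  refine k.trans ?_
  have : ε / (1 + ∫ x, c x) * ∫ x, c x ≤ ε := by
    rw [div_mul_eq_mul_div, div_le_iff₀ (by positivity)]; nlinarith
  linarith

theorem gn_eq {n : ℕ} (u : Eu n → ℝ) (x : Eu n) : gn u x = ‖(WithLp.toLp 2 (fun j => pd u j x) : Eu n)‖ := by
  rw [EuclideanSpace.norm_eq]
  simp [gn]

theorem gn_mul {n : ℕ} {v c : Eu n → ℝ} (hv : ContDiff ℝ 1 v) (hc : ContDiff ℝ 1 c) (v0 : ∀ x, 0 ≤ v x)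
    (c0 : ∀ x, 0 ≤ c x) (x : Eu n) : gn (fun x => v x * c x) x ≤ c x * gn v x + v x * gn c x := by
  simp only [gn_eq]
  have e : (WithLp.toLp 2 (fun j => pd (fun x => v x * c x) j x) : Eu n)
      = c x • (WithLp.toLp 2 (fun j => pd v j x) : Eu n) + v x • (WithLp.toLp 2 (fun j => pd c j x) : Eu n) := by
    ext j
    simp only [PiLp.add_apply, PiLp.smul_apply, smul_eq_mul]
    unfold pd
    rw [fderiv_fun_mul (hv.differentiable one_ne_zero x) (hc.differentiable one_ne_zero x)]
    simp; ring
  rw [e]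
  refine (norm_add_le _ _).trans ?_
  rw [norm_smul, norm_smul, Real.norm_of_nonneg (v0 x), Real.norm_of_nonneg (c0 x)]

theorem gn_smul {n : ℕ} {v : Eu n → ℝ} (hv : ContDiff ℝ 1 v) {a : ℝ} (ha : 0 ≤ a)
    (x : Eu n) : gn (fun x => a * v x) x = a * gn v x := by
  simp only [gn_eq]
  rw [← Real.norm_of_nonneg ha, ← norm_smul, Real.norm_of_nonneg ha]
  congr 1
  ext j
  simp only [PiLp.smul_apply, smul_eq_mul]
  unfold pd
  rw [fderiv_const_mul (hv.differentiable one_ne_zero x)]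
  simp

def cu {n : ℕ} (x : Eu n) : ℝ := Real.smoothTransition (2 - ‖x‖^2)
def cuR {n : ℕ} (r : ℝ) (x : Eu n) : ℝ := cu (r • x)

theorem cu_C1 {n : ℕ} : ContDiff ℝ 1 (cu : Eu n → ℝ) := by
  unfold cu
  exact sT_C1.comp (contDiff_const.sub (contDiff_id.norm_sq ℝ))

theorem cu_CC {n : ℕ} : CC (cu : Eu n → ℝ) := by
  refine ⟨cu_C1.continuous, 2, two_pos, fun x hx => Real.smoothTransition.zero_of_nonpos ?_⟩
  nlinarith

theorem cuR_C1 {n : ℕ} (r : ℝ) : ContDiff ℝ 1 (cuR r : Eu n → ℝ) :=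
  cu_C1.comp (contDiff_const_smul r)

theorem cuR_CC {n : ℕ} {r : ℝ} (hr : 0 < r) : CC (cuR r : Eu n → ℝ) := by
  obtain ⟨_, R, R0, hR⟩ := cu_CC (n := n)
  refine ⟨(cuR_C1 r).continuous, R / r, by positivity, fun x hx => hR _ ?_⟩
  rw [norm_smul, Real.norm_of_nonneg hr.le]
  rw [div_le_iff₀ hr] at hx; linarith

theorem cuR_gn {n : ℕ} {r : ℝ} (hr : 0 ≤ r) (x : Eu n) : gn (cuR r) x = r * gn cu (r • x) := by
  simp only [gn_eq]
  nth_rw 2 [← Real.norm_of_nonneg hr]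
  rw [← norm_smul]
  congr 1
  ext j
  simp only [PiLp.smul_apply, smul_eq_mul]
  unfold pd cuR
  rw [fderiv_comp_smul]
  simp

theorem cuR0 {n : ℕ} (r : ℝ) (x : Eu n) : 0 ≤ cuR r x := Real.smoothTransition.nonneg _
theorem cuR1 {n : ℕ} (r : ℝ) (x : Eu n) : cuR r x ≤ 1 := Real.smoothTransition.le_one _

theorem cuR_tendsto {n : ℕ} (x : Eu n) :
    Filter.Tendsto (fun k : ℕ => cuR (1/((k:ℝ)+1)) x) Filter.atTop (nhds 1) := by
  have h : Continuous fun r : ℝ => cuR r x := by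
    unfold cuR
    exact cu_C1.continuous.comp (by fun_prop)
  have := (h.tendsto 0).comp (tendsto_one_div_add_atTop_nhds_zero_nat (𝕜 := ℝ))
  have e : cuR 0 x = 1 := by
    unfold cuR cu
    exact Real.smoothTransition.one_of_one_le (by simp)
  rw [e] at this
  exact this

end
open MeasureTheory Metric Set

noncomputable section

theorem approx {d : ℕ} (hd : 1 ≤ d) {E : Set (Eu (d+1))} (hE : HasFinitePerimeter E)
    (hV : volume E = volume (ball (0 : Eu (d+1)) 1)) {ε : ℝ} (hε : 0 < ε) :
    ∃ u R δ, QD d u R δ ∧ ∫ x, |E.indicator 1 x - u x| ≤ ε ∧ δ ≤ ε ∧ ∫ x, gn u x ≤ perimeter E + ε := by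
  obtain ⟨v, mo, hv⟩ := moll hE hV (show 0 < ε/4 by positivity)
  have v1 : ContDiff ℝ 1 v := mo.c2.of_le (by norm_num)
  set χ : Eu (d+1) → ℝ := E.indicator 1 with hχ
  have hVf : volume E ≠ ⊤ := by rw [hV]; exact measure_ball_lt_top.ne
  have χi : Integrable χ := by
    rw [hχ, integrable_indicator_iff hE.1]
    exact integrableOn_const (C := (1:ℝ)) hVf
  have χI : ∫ x, χ x = om (d+1) := by
    rw [hχ, integral_indicator hE.1]
    simp [om, Measure.real, hV]
  have oo := om_pos (d+1)
  obtain ⟨M, hM⟩ : ∃ M, ∀ x : Eu (d+1), ‖gn cu x‖ ≤ M :=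
    (gn_CC cu_C1 cu_CC).hcs.exists_bound_of_continuous (gn_cont cu_C1)
  have M0 : 0 ≤ M := (norm_nonneg _).trans (hM 0)
  have lim1 : Filter.Tendsto (fun k : ℕ => ∫ x, v x * (1 - cuR (1/((k:ℝ)+1)) x)) Filter.atTop (nhds (∫ _ : Eu (d+1), (0:ℝ))) := by
    apply tendsto_integral_of_dominated_convergence v
    · exact fun k => (v1.continuous.mul (continuous_const.sub (cuR_C1 _).continuous)).aestronglyMeasurable
    · exact mo.vi
    · intro k
      refine Filter.Eventually.of_forall fun x => ?_
      have a1 := cuR0 (1/((k:ℝ)+1)) x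
      have a2 := cuR1 (1/((k:ℝ)+1)) x
      rw [Real.norm_of_nonneg (mul_nonneg (mo.v0 x) (by linarith))]
      exact mul_le_of_le_one_right (mo.v0 x) (by linarith)
    · refine Filter.Eventually.of_forall fun x => ?_
      have := ((cuR_tendsto x).const_sub 1).const_mul (v x)
      simpa using this
  rw [integral_zero] at lim1
  have lim2 : Filter.Tendsto (fun k : ℕ => (1/((k:ℝ)+1)) * (M * om (d+1))) Filter.atTop (nhds (0 * (M * om (d+1)))) :=
    tendsto_one_div_add_atTop_nhds_zero_nat.mul_const _
  rw [zero_mul] at lim2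
  obtain ⟨k, hk1, hk2⟩ := ((lim1.eventually (gt_mem_nhds (show 0 < ε/4 by positivity))).and
    (lim2.eventually (gt_mem_nhds hε))).exists
  set r : ℝ := 1/((k:ℝ)+1) with hr
  have r0 : 0 < r := by positivity
  set θ : ℝ := ε / (ε + 4 * om (d+1)) with hθ
  have θ0 : 0 < θ := by positivity
  have θ1 : θ < 1 := by rw [hθ, div_lt_one (by positivity)]; linarith
  have θ2 : θ * om (d+1) ≤ ε/4 := by
    rw [hθ, div_mul_eq_mul_div, div_le_iff₀ (by positivity)]; nlinarith
  set w : Eu (d+1) → ℝ := fun x => v x * cuR r x with hw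
  have wC : ContDiff ℝ 1 w := v1.mul (cuR_C1 r)
  have wCC : CC w := (cuR_CC r0).mulc v1.continuous
  set u : Eu (d+1) → ℝ := fun x => (1 - θ) * w x with hu
  have uC : ContDiff ℝ 1 u := contDiff_const.mul wC
  have uCC : CC u := wCC.mulc continuous_const
  have w0 : ∀ x, 0 ≤ w x := fun x => mul_nonneg (mo.v0 x) (cuR0 r x)
  have wv : ∀ x, w x ≤ v x := fun x => mul_le_of_le_one_right (mo.v0 x) (cuR1 r x)
  have u0 : ∀ x, 0 ≤ u x := fun x => mul_nonneg (by linarith) (w0 x)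
  have uw : ∀ x, u x ≤ w x := fun x => mul_le_of_le_one_left (w0 x) (by linarith)
  have u1 : ∀ x, u x ≤ 1 := fun x => (uw x).trans ((wv x).trans (mo.v1 x))
  have wI : ∫ x, w x ≤ om (d+1) := by
    rw [← mo.vI]; exact integral_mono wCC.int mo.vi wv
  have uI : ∫ x, u x ≤ (1 - θ) * om (d+1) := by
    rw [hu, integral_const_mul]
    exact mul_le_mul_of_nonneg_left wI (by linarith)
  have uI' : ∫ x, u x < om (d+1) := by nlinarith
  obtain ⟨R, ud⟩ := UD.of uC uCC u0
  have dp : (0:ℝ) < d := by exact_mod_cast hd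
  set p : ℝ := 1 + 1/(d:ℝ) with hp
  have p1 : 1 ≤ p := by rw [hp]; have : 0 < 1/(d:ℝ) := by positivity
                        linarith
  have p2 : p ≤ 2 := by
    rw [hp]; have : 1/(d:ℝ) ≤ 1 := by rw [div_le_one dp]; exact_mod_cast hd
    linarith
  have upC : CC (fun x => u x^p) := by
    obtain ⟨hc, R, h0, hR⟩ := uCC
    refine ⟨hc.rpow_const fun x => Or.inr (by linarith), R, h0, fun x hx => ?_⟩
    simp only [hR x hx]
    exact Real.zero_rpow (by linarith)
  have upu : ∀ x, u x^p ≤ u x := fun x => by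
    have := Real.rpow_le_rpow_of_exponent_ge' (u0 x) (u1 x) zero_le_one p1
    simpa using this
  have upI : ∫ x, u x^p < om (d+1) := (integral_mono upC.int uCC.int upu).trans_lt uI'
  set δ : ℝ := (om (d+1) - ∫ x, u x^p)/2 with hδ
  have iA : Integrable (fun x => |χ x - u x|) := (χi.sub uCC.int).abs
  have L1 : ∫ x, |χ x - u x| ≤ ε := by
    have j1 : Integrable (fun x => |χ x - v x|) := (χi.sub mo.vi).abs
    have j2 : Integrable (fun x => θ * v x) := mo.vi.const_mul θ
    have j3 : Integrable (fun x => v x * (1 - cuR r x)) := by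
      have : Integrable (fun x => v x - w x) := mo.vi.sub wCC.int
      refine this.congr (Filter.Eventually.of_forall fun x => ?_)
      simp only [hw]; ring
    have j4 : Integrable (fun x => |χ x - v x| + θ * v x) := j1.add j2
    calc ∫ x, |χ x - u x| ≤ ∫ x, (|χ x - v x| + θ * v x + v x * (1 - cuR r x)) := by
          apply integral_mono iA (j4.add j3)
          intro x
          show |χ x - u x| ≤ |χ x - v x| + θ * v x + v x * (1 - cuR r x)
          have t1 := abs_sub_le (χ x) (v x) (u x)
          have t2 : |v x - u x| = v x - u x := abs_of_nonneg (by linarith [uw x, wv x])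
          have t3 : v x - u x = θ * w x + v x * (1 - cuR r x) := by simp only [hu, hw]; ring
          have t4 : θ * w x ≤ θ * v x := mul_le_mul_of_nonneg_left (wv x) θ0.le
          linarith
      _ = (∫ x, |χ x - v x|) + θ * om (d+1) + ∫ x, v x * (1 - cuR r x) := by
          rw [integral_add j4 j3, integral_add j1 j2, integral_const_mul, mo.vI]
      _ ≤ ε := by linarith
  refine ⟨u, R, δ, ⟨ud, hd, u1, by linarith, by linarith, by rw [hδ]; ring⟩, L1, ?_, ?_⟩
  · have : ∫ x, (χ x - u x^p) ≤ ∫ x, 2 * |χ x - u x| := by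
      have a1 : Integrable (fun x => χ x - u x^p) := χi.sub upC.int
      apply integral_mono a1 (iA.const_mul 2)
      intro x
      show χ x - u x^p ≤ 2 * |χ x - u x|
      by_cases hx : x ∈ E
      · have e : χ x = 1 := by simp [hχ, hx]
        rw [e]
        have b := one_add_mul_self_le_rpow_one_add (s := u x - 1) (by linarith [u0 x]) p1
        rw [add_sub_cancel] at b
        have c := le_abs_self (1 - u x)
        have := u1 x
        nlinarith
      · have e : χ x = 0 := by simp [hχ, hx]
        rw [e]
        have := Real.rpow_nonneg (u0 x) p
        have := abs_nonneg (0 - u x)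
        linarith
    rw [integral_sub χi upC.int, integral_const_mul, χI] at this
    rw [hδ]; linarith
  · have k1 := mo.grad (cuR_C1 r) (cuR_CC r0) (cuR0 r) (cuR1 r)
    have j1 : Integrable (fun x => cuR r x * gn v x) := by
      have := ((cuR_CC r0).mulc (gn_cont v1)).int
      simpa only [mul_comm] using this
    have j2 : Integrable (fun x => r * M * v x) := mo.vi.const_mul _
    calc ∫ x, gn u x ≤ ∫ x, (cuR r x * gn v x + r * M * v x) := by
          apply integral_mono (gn_CC uC uCC).int (j1.add j2)
          intro x
          show gn u x ≤ cuR r x * gn v x + r * M * v x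
          have a1 : gn u x = (1 - θ) * gn w x := gn_smul wC (by linarith) x
          have a2 : gn w x ≤ cuR r x * gn v x + v x * gn (cuR r) x := gn_mul v1 (cuR_C1 r) mo.v0 (cuR0 r) x
          have a3 : gn (cuR r) x ≤ r * M := by
            rw [cuR_gn r0.le]
            exact mul_le_mul_of_nonneg_left ((le_abs_self _).trans (hM _)) r0.le
          have a4 : v x * gn (cuR r) x ≤ v x * (r * M) := mul_le_mul_of_nonneg_left a3 (mo.v0 x)
          have a5 : (1 - θ) * gn w x ≤ gn w x := mul_le_of_le_one_left (Real.sqrt_nonneg _) (by linarith)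
          linarith
      _ = (∫ x, cuR r x * gn v x) + r * M * om (d+1) := by
          rw [integral_add j1 j2, integral_const_mul, mo.vI]
      _ ≤ _ := by linarith

end
open MeasureTheory Metric Set
open scoped ENNReal

noncomputable section

theorem pd_swap {n : ℕ} {W : Type*} [MeasurableSpace W] (μ : Measure W) [SFinite μ] {φ : W → Eu n → ℝ≥0∞}
    (hφ : Measurable (Function.uncurry φ)) {k : Eu n → Eu n → ℝ≥0∞}
    (hk : ∀ x y, x ≠ y → k x y = ∫⁻ w, φ w x * φ w y ∂μ) (A B : Set (Eu n)) [NullSingletonClass (volume : Measure (Eu n))] :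
    ∫⁻ x in A, ∫⁻ y in B, k x y = ∫⁻ w, (∫⁻ x in A, φ w x) * (∫⁻ y in B, φ w y) ∂μ := by
  have m1 : ∀ x, Measurable fun w => φ w x := fun x => hφ.comp (measurable_id.prodMk measurable_const)
  have m2 : ∀ w, Measurable fun x => φ w x := fun w => hφ.comp (measurable_const.prodMk measurable_id)
  have mB : Measurable fun w => ∫⁻ y in B, φ w y := hφ.lintegral_prod_right'
  have e1 : ∀ x, ∫⁻ y in B, k x y = ∫⁻ w, φ w x * (∫⁻ y in B, φ w y) ∂μ := by
    intro x
    have : ∫⁻ y in B, k x y = ∫⁻ y in B, ∫⁻ w, φ w x * φ w y ∂μ := by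
      apply lintegral_congr_ae
      apply ae_restrict_of_ae
      have h : ∀ᵐ y : Eu n, y ≠ x := by
        rw [ae_iff]; simp
      filter_upwards [h] with y hy using hk x y hy.symm
    rw [this, lintegral_lintegral_swap]
    · apply lintegral_congr; intro w
      rw [lintegral_const_mul _ (m2 w)]
    · apply Measurable.aemeasurable
      exact ((m1 x).comp measurable_snd).mul (hφ.comp measurable_swap)
  simp only [e1]
  rw [lintegral_lintegral_swap]
  · apply lintegral_congr; intro w
    rw [lintegral_mul_const _ (m2 w)]
  · apply Measurable.aemeasurable
    exact (hφ.comp measurable_swap).mul (mB.comp measurable_snd)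

theorem pd_ineq {n : ℕ} {W : Type*} [MeasurableSpace W] (μ : Measure W) [SFinite μ] {φ : W → Eu n → ℝ≥0∞}
    (hφ : Measurable (Function.uncurry φ)) {k : Eu n → Eu n → ℝ≥0∞}
    (hk : ∀ x y, x ≠ y → k x y = ∫⁻ w, φ w x * φ w y ∂μ) (A B : Set (Eu n)) [NullSingletonClass (volume : Measure (Eu n))] :
    2 * ∫⁻ x in A, ∫⁻ y in B, k x y ≤ (∫⁻ x in A, ∫⁻ y in A, k x y) + ∫⁻ x in B, ∫⁻ y in B, k x y := by
  have mA : ∀ B : Set (Eu n), Measurable fun w => ∫⁻ y in B, φ w y := fun B => hφ.lintegral_prod_right'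
  have mm : ∀ A B : Set (Eu n), Measurable fun w => (∫⁻ y in A, φ w y) * ∫⁻ y in B, φ w y := fun A B => (mA A).mul (mA B)
  rw [pd_swap μ hφ hk, pd_swap μ hφ hk, pd_swap μ hφ hk, ← lintegral_add_left (mm A A),
    ← lintegral_const_mul _ (mm A B)]
  apply lintegral_mono
  intro w
  show 2 * ((∫⁻ x in A, φ w x) * ∫⁻ x in B, φ w x) ≤ (∫⁻ x in A, φ w x) * (∫⁻ x in A, φ w x) + (∫⁻ x in B, φ w x) * (∫⁻ x in B, φ w x)
  generalize (∫⁻ x in A, φ w x) = a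
  generalize (∫⁻ x in B, φ w x) = b
  rcases eq_or_ne a ⊤ with rfl | ha
  · simp
  rcases eq_or_ne b ⊤ with rfl | hb
  · simp
  lift a to NNReal using ha
  lift b to NNReal using hb
  norm_cast
  have : (2 * (a * b) : ℝ) ≤ a * a + b * b := by nlinarith [sq_nonneg ((a:ℝ) - b)]
  exact_mod_cast this

def Gt (n : ℕ) (t : ℝ) : ℝ := ∫ z : Eu n, Real.exp (-(4*t) * ‖z‖^2)

def ph (n : ℕ) (w : ℝ × Eu n) (x : Eu n) : ℝ :=
  √(w.1 ^ (((n:ℝ)-2)/2 - 1) / (Real.Gamma (((n:ℝ)-2)/2) * (Real.pi/(4*w.1))^((n:ℝ)/2))) * Real.exp (-(2*w.1) * ‖x - w.2‖^2)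

theorem ph_meas (n : ℕ) : Measurable (Function.uncurry fun w x => ENNReal.ofReal (ph n w x)) := by
  unfold ph Function.uncurry
  fun_prop

theorem par4 {n : ℕ} (x y z : Eu n) : 2 * ‖x - z‖^2 + 2 * ‖y - z‖^2 = 4 * ‖z - (1/2:ℝ) • (x + y)‖^2 + ‖x - y‖^2 := by
  have h := parallelogram_law_with_norm ℝ (x - z) (y - z)
  have e1 : x - z - (y - z) = x - y := by abel
  have e2 : x - z + (y - z) = (-2:ℝ) • (z - (1/2:ℝ) • (x + y)) := by module
  have e3 : ‖(-2:ℝ)‖ = 2 := by norm_num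
  rw [e1, e2, norm_smul, e3] at h
  linarith

theorem ph_ker {n : ℕ} (hn : 3 ≤ n) (x y : Eu n) (hxy : x ≠ y) :
    ENNReal.ofReal (‖x - y‖ ^ (2 - (n:ℝ))) =
      ∫⁻ w, ENNReal.ofReal (ph n w x) * ENNReal.ofReal (ph n w y) ∂((volume.restrict (Ioi (0:ℝ))).prod volume) := by
  set s : ℝ := ((n:ℝ)-2)/2 with hs
  have n3 : (3:ℝ) ≤ n := by exact_mod_cast hn
  have s0 : 0 < s := by rw [hs]; linarith
  have r0 : 0 < ‖x - y‖ := norm_pos_iff.2 (sub_ne_zero.2 hxy)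
  have G0 := Real.Gamma_pos_of_pos s0
  have me : Measurable fun w => ENNReal.ofReal (ph n w x) * ENNReal.ofReal (ph n w y) := by
    unfold ph; fun_prop
  rw [lintegral_prod _ me.aemeasurable]
  have inner : ∀ t ∈ Ioi (0:ℝ), ∫⁻ z, ENNReal.ofReal (ph n (t,z) x) * ENNReal.ofReal (ph n (t,z) y)
      = ENNReal.ofReal ((Real.Gamma s)⁻¹ * (t^(s-1) * Real.exp (-(‖x-y‖^2 * t)))) := by
    intro t ht
    have t0 : 0 < t := ht
    set P : ℝ := (Real.pi/(4*t))^((n:ℝ)/2) with hP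
    have P0 : 0 < P := by positivity
    have e1 : ∀ z, ENNReal.ofReal (ph n (t,z) x) * ENNReal.ofReal (ph n (t,z) y)
        = ENNReal.ofReal (t^(s-1) / (Real.Gamma s * P) * Real.exp (-(‖x-y‖^2 * t)) * Real.exp (-(4*t) * ‖z - (1/2:ℝ) • (x + y)‖^2)) := by
      intro z
      unfold ph
      rw [← ENNReal.ofReal_mul (by positivity)]
      congr 1
      simp only
      rw [mul_mul_mul_comm, Real.mul_self_sqrt (by positivity), mul_assoc, ← Real.exp_add, ← Real.exp_add]
      congr 2
      have := par4 x y z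
      linear_combination (-t) * this
    simp only [e1]
    have hi : Integrable (fun z : Eu n => Real.exp (-(4*t) * ‖z‖^2)) :=
      Integrable.of_integral_ne_zero (by
        rw [GaussianFourier.integral_rexp_neg_mul_sq_norm (by positivity)]; positivity)
    rw [← ofReal_integral_eq_lintegral_ofReal]
    · rw [integral_const_mul, integral_sub_right_eq_self (fun z : Eu n => Real.exp (-(4*t) * ‖z‖^2)),
        GaussianFourier.integral_rexp_neg_mul_sq_norm (by positivity)]
      congr 1
      simp only [finrank_euclideanSpace, Fintype.card_fin]
      rw [← hP]
      field_simp
    · exact (hi.comp_sub_right _).const_mul _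
    · exact Filter.Eventually.of_forall fun z => by positivity
  rw [setLIntegral_congr_fun measurableSet_Ioi inner]
  rw [← ofReal_integral_eq_lintegral_ofReal]
  · rw [integral_const_mul, Real.integral_rpow_mul_exp_neg_mul_Ioi s0 (by positivity)]
    congr 1
    rw [mul_comm (_ ^ s), ← mul_assoc, inv_mul_cancel₀ G0.ne', one_mul]
    rw [Real.div_rpow zero_le_one (by positivity), Real.one_rpow, ← Real.rpow_natCast, ← Real.rpow_mul r0.le, one_div,
      ← Real.rpow_neg r0.le]
    congr 1
    rw [hs]; push_cast; ring
  · apply Integrable.const_mul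
    apply Integrable.of_integral_ne_zero
    rw [Real.integral_rpow_mul_exp_neg_mul_Ioi s0 (by positivity)]
    positivity
  · refine (ae_restrict_iff' measurableSet_Ioi).2 (Filter.Eventually.of_forall fun t ht => ?_)
    have t0 : 0 < t := ht
    show 0 ≤ _
    positivity

theorem nl_pd {n : ℕ} (hn : 3 ≤ n) (A B : Set (Eu n)) :
    2 * ∫⁻ x in A, ∫⁻ y in B, ENNReal.ofReal (‖x - y‖ ^ (2 - (n:ℝ)))
    ≤ (∫⁻ x in A, ∫⁻ y in A, ENNReal.ofReal (‖x - y‖ ^ (2 - (n:ℝ)))) + ∫⁻ x in B, ∫⁻ y in B, ENNReal.ofReal (‖x - y‖ ^ (2 - (n:ℝ))) := by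
  have : Nontrivial (Eu n) := by
    have : Nonempty (Fin n) := ⟨⟨0, by omega⟩⟩
    infer_instance
  exact pd_ineq ((volume.restrict (Ioi (0:ℝ))).prod volume) (ph_meas n) (fun x y h => ph_ker hn x y h) A B

end
open MeasureTheory Metric Set
open scoped ENNReal

noncomputable section

theorem kint {n : ℕ} (hn : 1 ≤ n) {a : ℝ} (ha : -(n:ℝ) < a) : IntegrableOn (fun x : Eu n => ‖x‖^a) (ball 0 1) := by
  have : Nonempty (Fin n) := ⟨⟨0, by omega⟩⟩
  have : Nontrivial (Eu n) := inferInstance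
  have := (integrableOn_fun_norm_addHaar (E := Eu n) volume (f := fun r : ℝ => r^a) (r := 1)).2
  apply this
  have h := (intervalIntegral.integrableOn_Ioo_rpow_iff (s := (n:ℝ) - 1 + a) (t := 1) one_pos).2 (by linarith)
  refine h.congr_fun (fun y hy => ?_) measurableSet_Ioo
  simp only [finrank_euclideanSpace, Fintype.card_fin, smul_eq_mul]
  rw [← Real.rpow_natCast, ← Real.rpow_add hy.1]
  congr 1
  rw [Nat.cast_sub hn]; simp

def Ka (n : ℕ) (a : ℝ) : ℝ := ∫ y in ball (0 : Eu n) 1, ‖y‖^a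

theorem Ka_nonneg (n : ℕ) (a : ℝ) : 0 ≤ Ka n a := integral_nonneg fun _ => Real.rpow_nonneg (norm_nonneg _) _

theorem pot {n : ℕ} (hn : 1 ≤ n) {a : ℝ} (ha : -(n:ℝ) < a) (a0 : a ≤ 0) {F : Set (Eu n)} (_ : MeasurableSet F)
    (hf : volume F ≠ ⊤) (x : Eu n) : IntegrableOn (fun y => ‖x - y‖^a) F ∧
      ∫ y in F, ‖x - y‖^a ≤ Ka n a + (volume F).toReal := by
  set g : Eu n → ℝ := (ball (0 : Eu n) 1).indicator (fun y => ‖y‖^a) with hg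
  have gi : Integrable g := (integrable_indicator_iff measurableSet_ball).2 (kint hn ha)
  have g0 : ∀ y, 0 ≤ g y := fun y => indicator_nonneg (fun _ _ => Real.rpow_nonneg (norm_nonneg _) _) y
  have gI : ∫ y, g (x - y) = Ka n a := by
    rw [integral_sub_left_eq_self g volume x, hg, integral_indicator measurableSet_ball]; rfl
  have b : ∀ y, ‖x - y‖^a ≤ g (x - y) + 1 := by
    intro y
    by_cases hy : x - y ∈ ball (0 : Eu n) 1
    · rw [hg, indicator_of_mem hy]; linarith
    · have : 1 ≤ ‖x - y‖ := by simpa using hy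
      have h1 := Real.rpow_le_one_of_one_le_of_nonpos this a0
      linarith [g0 (x - y)]
  have i1 : IntegrableOn (fun y => g (x - y)) F := (gi.comp_sub_left x).integrableOn
  have i2 : IntegrableOn (fun _ : Eu n => (1:ℝ)) F := integrableOn_const hf
  have i3 : IntegrableOn (fun y => g (x - y) + 1) F := i1.add i2
  have i4 : IntegrableOn (fun y => ‖x - y‖^a) F := by
    refine i3.mono' ?_ (Filter.Eventually.of_forall fun y => ?_)
    · apply Measurable.aestronglyMeasurable
      fun_prop
    · rw [Real.norm_of_nonneg (Real.rpow_nonneg (norm_nonneg _) _)]; exact b y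
  refine ⟨i4, ?_⟩
  calc ∫ y in F, ‖x - y‖^a ≤ ∫ y in F, (g (x - y) + 1) := integral_mono i4 i3 b
    _ = (∫ y in F, g (x - y)) + (volume F).toReal := by rw [integral_add i1 i2]; simp [Measure.real]
    _ ≤ (∫ y, g (x - y)) + (volume F).toReal := by
        have := setIntegral_le_integral (s := F) (gi.comp_sub_left x) (Filter.Eventually.of_forall fun y => g0 (x - y))
        linarith
    _ = _ := by rw [gI]

def Un {n : ℕ} (F : Set (Eu n)) (x : Eu n) : ℝ := ∫ y in F, ‖x - y‖^(2 - (n:ℝ))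

theorem Un_nonneg {n : ℕ} (F : Set (Eu n)) (x : Eu n) : 0 ≤ Un F x :=
  integral_nonneg fun _ => Real.rpow_nonneg (norm_nonneg _) _

theorem Un_meas {n : ℕ} (F : Set (Eu n)) : StronglyMeasurable (Un F) := by
  unfold Un
  apply StronglyMeasurable.integral_prod_right' (f := fun p : Eu n × Eu n => ‖p.1 - p.2‖^(2 - (n:ℝ)))
  apply Measurable.stronglyMeasurable
  fun_prop

def KK {n : ℕ} (A B : Set (Eu n)) : ℝ≥0∞ := ∫⁻ x in A, ∫⁻ y in B, ENNReal.ofReal (‖x - y‖ ^ (2 - (n:ℝ)))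

theorem Un_le {n : ℕ} (hn : 3 ≤ n) {F : Set (Eu n)} (hF : MeasurableSet F) (hf : volume F ≠ ⊤) (x : Eu n) :
    Un F x ≤ Ka n (2-(n:ℝ)) + (volume F).toReal := by
  have n3 : (3:ℝ) ≤ n := by exact_mod_cast hn
  exact (pot (by omega) (by linarith) (by linarith) hF hf x).2

theorem Un_int {n : ℕ} (hn : 3 ≤ n) {F A : Set (Eu n)} (hF : MeasurableSet F) (hf : volume F ≠ ⊤) (hA : volume A ≠ ⊤) :
    IntegrableOn (Un F) A := by
  refine (integrableOn_const (C := Ka n (2-(n:ℝ)) + (volume F).toReal) hA).mono' (Un_meas F).aestronglyMeasurable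
    (Filter.Eventually.of_forall fun x => ?_)
  rw [Real.norm_of_nonneg (Un_nonneg F x)]
  exact Un_le hn hF hf x

theorem KK_eq {n : ℕ} (hn : 3 ≤ n) {F A : Set (Eu n)} (hF : MeasurableSet F) (hf : volume F ≠ ⊤) (hA : volume A ≠ ⊤) :
    KK A F = ENNReal.ofReal (∫ x in A, Un F x) := by
  have n3 : (3:ℝ) ≤ n := by exact_mod_cast hn
  rw [ofReal_integral_eq_lintegral_ofReal (Un_int hn hF hf hA) (Filter.Eventually.of_forall fun x => Un_nonneg F x)]
  unfold KK
  apply lintegral_congr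
  intro x
  unfold Un
  rw [ofReal_integral_eq_lintegral_ofReal]
  · exact (pot (by omega) (by linarith) (by linarith) hF hf x).1
  · exact Filter.Eventually.of_forall fun _ => Real.rpow_nonneg (norm_nonneg _) _

theorem NL_pd {n : ℕ} (hn : 3 ≤ n) {A B : Set (Eu n)} (hA : MeasurableSet A) (hB : MeasurableSet B) (fA : volume A ≠ ⊤) (fB : volume B ≠ ⊤) :
    2 * ∫ x in A, Un B x ≤ NL A + NL B := by
  have h : 2 * KK A B ≤ KK A A + KK B B := nl_pd hn A B
  have p : ∀ A B : Set (Eu n), 0 ≤ ∫ x in A, Un B x := fun A B => integral_nonneg fun x => Un_nonneg B x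
  rw [KK_eq hn hB fB fA, KK_eq hn hA fA fA, KK_eq hn hB fB fB, ← ENNReal.ofReal_add (p _ _) (p _ _)] at h
  have e : (2:ℝ≥0∞) = ENNReal.ofReal 2 := by simp
  have e' : 2 * ENNReal.ofReal (∫ x in A, Un B x) = ENNReal.ofReal (2 * ∫ x in A, Un B x) := by
    rw [ENNReal.ofReal_mul zero_le_two, ← e]
  rw [e', ENNReal.ofReal_le_ofReal_iff (add_nonneg (p _ _) (p _ _))] at h
  exact h

def VB {n : ℕ} : Eu n → ℝ := Un (ball (0 : Eu n) 1)

theorem Un_shift {n : ℕ} (y x : Eu n) : Un (ball y 1) x = VB (x - y) := by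
  unfold VB Un
  rw [← integral_indicator measurableSet_ball, ← integral_indicator measurableSet_ball,
    ← integral_add_right_eq_self _ y]
  congr 1; ext z
  have : z + y ∈ ball y 1 ↔ z ∈ ball (0 : Eu n) 1 := by simp
  by_cases hz : z ∈ ball (0 : Eu n) 1
  · rw [indicator_of_mem (this.2 hz), indicator_of_mem hz]
    congr 2; abel
  · rw [indicator_of_notMem (fun h => hz (this.1 h)), indicator_of_notMem hz]

theorem NL_ball_shift {n : ℕ} (y : Eu n) : NL (ball y 1) = ∫ x in ball (0 : Eu n) 1, VB x := by
  show ∫ x in ball y 1, Un (ball y 1) x = _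
  simp only [Un_shift]
  rw [← integral_indicator measurableSet_ball, ← integral_indicator measurableSet_ball,
    ← integral_add_right_eq_self _ y]
  congr 1; ext z
  have : z + y ∈ ball y 1 ↔ z ∈ ball (0 : Eu n) 1 := by simp
  by_cases hz : z ∈ ball (0 : Eu n) 1
  · rw [indicator_of_mem (this.2 hz), indicator_of_mem hz]; simp
  · rw [indicator_of_notMem (fun h => hz (this.1 h)), indicator_of_notMem hz]

theorem NL_diff {n : ℕ} (hn : 3 ≤ n) {E : Set (Eu n)} (hE : MeasurableSet E) (fE : volume E ≠ ⊤) (y : Eu n) :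
    NL (ball (0 : Eu n) 1) - NL E ≤ 2 * ((∫ x in ball (0 : Eu n) 1, VB x) - ∫ x in E, VB (x - y)) := by
  have h := NL_pd hn hE (measurableSet_ball (x := y) (ε := 1)) fE measure_ball_lt_top.ne
  rw [NL_ball_shift y] at h
  simp only [Un_shift] at h
  have h2 := NL_ball_shift (0 : Eu n)
  linarith

theorem VB_rad {n : ℕ} {x y : Eu n} (h : ‖x‖ = ‖y‖) : VB x = VB y := by
  set T : Eu n ≃ₗᵢ[ℝ] Eu n := (ℝ ∙ (x - y))ᗮ.reflection
  have hT : T x = y := Submodule.reflection_sub h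
  unfold VB Un
  rw [← integral_indicator measurableSet_ball, ← integral_indicator measurableSet_ball]
  rw [← T.measurePreserving.integral_comp T.toHomeomorph.measurableEmbedding ((ball (0 : Eu n) 1).indicator fun z => ‖y - z‖^(2 - (n:ℝ)))]
  congr 1; ext z
  have : T z ∈ ball (0 : Eu n) 1 ↔ z ∈ ball (0 : Eu n) 1 := by simp
  by_cases hz : z ∈ ball (0 : Eu n) 1
  · rw [indicator_of_mem (this.2 hz), indicator_of_mem hz, ← hT, ← map_sub, T.norm_map]
  · rw [indicator_of_notMem (fun h => hz (this.1 h)), indicator_of_notMem hz]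

theorem rp_aux {m : ℕ} {a b : ℝ} (ha : 0 < a) (hab : a ≤ b) :
    a^(-(m:ℝ)) - b^(-(m:ℝ)) ≤ m * (b - a) * a^(-(m:ℝ) - 1) := by
  have hb : 0 < b := by linarith
  have h1 : 1 + (m:ℝ) * (a/b - 1) ≤ (1 + (a/b - 1))^m := one_add_mul_le_pow (by
    have : 0 < a/b := by positivity
    linarith) m
  rw [add_sub_cancel, div_pow] at h1
  rw [Real.rpow_sub ha, Real.rpow_neg ha.le, Real.rpow_neg hb.le, Real.rpow_natCast, Real.rpow_natCast, Real.rpow_one]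
  have A : 0 < a^m := by positivity
  have h2 : 1 - a^m/b^m ≤ m * ((b - a)/b) := by
    have : (b-a)/b = 1 - a/b := by field_simp
    rw [this]; linarith
  have h3 : (b - a)/b ≤ (b-a)/a := by
    apply div_le_div_of_nonneg_left (by linarith) ha hab
  calc (a^m)⁻¹ - (b^m)⁻¹ = (a^m)⁻¹ * (1 - a^m/b^m) := by field_simp
    _ ≤ (a^m)⁻¹ * (m * ((b-a)/a)) := by gcongr; exact h2.trans (by gcongr)
    _ = _ := by field_simp

theorem rp_lip {m : ℕ} {a b : ℝ} (ha : 0 < a) (hb : 0 < b) :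
    |a^(-(m:ℝ)) - b^(-(m:ℝ))| ≤ m * |a - b| * (a^(-(m:ℝ) - 1) + b^(-(m:ℝ) - 1)) := by
  wlog hab : a ≤ b generalizing a b
  · have := this hb ha (by linarith)
    rw [abs_sub_comm, abs_sub_comm a b, add_comm]; exact this
  have h := rp_aux (m := m) ha hab
  have h2 : b^(-(m:ℝ)) ≤ a^(-(m:ℝ)) := Real.rpow_le_rpow_of_nonpos ha hab (by simp)
  rw [abs_of_nonneg (by linarith), abs_sub_comm, abs_of_nonneg (by linarith : 0 ≤ b - a)]
  have p := Real.rpow_nonneg hb.le (-(m:ℝ) - 1)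
  have q : 0 ≤ (m:ℝ) * (b - a) := mul_nonneg (by positivity) (by linarith)
  have := mul_nonneg q p
  linarith

def LV (n : ℕ) : ℝ := n * (2 * (Ka n (1-(n:ℝ)) + om n))
def MV (n : ℕ) : ℝ := Ka n (2-(n:ℝ)) + om n

theorem VB_lip {n : ℕ} (hn : 3 ≤ n) (x y : Eu n) : |VB x - VB y| ≤ LV n * ‖x - y‖ := by
  have n3 : (3:ℝ) ≤ n := by exact_mod_cast hn
  have : Nonempty (Fin n) := ⟨⟨0, by omega⟩⟩
  have p1 : ∀ x : Eu n, _ := fun x => pot (by omega) (by linarith) (by linarith) (measurableSet_ball (x := (0 : Eu n)) (ε := 1)) measure_ball_lt_top.ne x (a := 2 - (n:ℝ))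
  have p2 : ∀ x : Eu n, _ := fun x => pot (by omega) (by linarith) (by linarith) (measurableSet_ball (x := (0 : Eu n)) (ε := 1)) measure_ball_lt_top.ne x (a := 1 - (n:ℝ))
  unfold VB Un
  rw [← integral_sub (p1 x).1 (p1 y).1]
  have i1 := (((p2 x).1.add (p2 y).1).const_mul (n * ‖x - y‖))
  simp only [Pi.add_apply] at i1
  calc |∫ z in ball (0 : Eu n) 1, (‖x - z‖^(2 - (n:ℝ)) - ‖y - z‖^(2 - (n:ℝ)))|
      ≤ ∫ z in ball (0 : Eu n) 1, |‖x - z‖^(2 - (n:ℝ)) - ‖y - z‖^(2 - (n:ℝ))| := abs_integral_le_integral_abs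
    _ ≤ ∫ z in ball (0 : Eu n) 1, n * ‖x - y‖ * (‖x - z‖^(1 - (n:ℝ)) + ‖y - z‖^(1 - (n:ℝ))) := by
        apply integral_mono_ae ((p1 x).1.sub (p1 y).1).abs i1
        apply ae_restrict_of_ae
        have h1 : ∀ w : Eu n, ∀ᵐ z : Eu n, z ≠ w := fun w => by rw [ae_iff]; simp
        filter_upwards [h1 x, h1 y] with z hx hy
        have a0 : 0 < ‖x - z‖ := norm_pos_iff.2 (sub_ne_zero.2 hx.symm)
        have b0 : 0 < ‖y - z‖ := norm_pos_iff.2 (sub_ne_zero.2 hy.symm)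
        have r := rp_lip (m := n - 2) a0 b0
        have e1 : -((n - 2 : ℕ):ℝ) = 2 - n := by rw [Nat.cast_sub (by omega)]; push_cast; ring
        have e2 : (2 - (n:ℝ)) - 1 = 1 - n := by ring
        rw [e1, e2] at r
        show |‖x - z‖^(2 - (n:ℝ)) - ‖y - z‖^(2 - (n:ℝ))| ≤ n * ‖x - y‖ * (‖x - z‖^(1 - (n:ℝ)) + ‖y - z‖^(1 - (n:ℝ)))
        refine r.trans ?_
        have t : |‖x - z‖ - ‖y - z‖| ≤ ‖x - y‖ := by
          have := abs_norm_sub_norm_le (x - z) (y - z); simpa using this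
        have c : ((n - 2 : ℕ):ℝ) ≤ n := by exact_mod_cast Nat.sub_le n 2
        gcongr
    _ = n * ‖x - y‖ * ((∫ z in ball (0 : Eu n) 1, ‖x - z‖^(1 - (n:ℝ))) + ∫ z in ball (0 : Eu n) 1, ‖y - z‖^(1 - (n:ℝ))) := by
        rw [integral_const_mul, integral_add (p2 x).1 (p2 y).1]
    _ ≤ n * ‖x - y‖ * ((Ka n (1-(n:ℝ)) + om n) + (Ka n (1-(n:ℝ)) + om n)) := by
        gcongr
        · exact (p2 x).2
        · exact (p2 y).2
    _ = _ := by unfold LV; ring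

theorem VB_le {n : ℕ} (hn : 3 ≤ n) (x : Eu n) : VB x ≤ MV n :=
  Un_le hn measurableSet_ball measure_ball_lt_top.ne x

theorem VB_nonneg {n : ℕ} (x : Eu n) : 0 ≤ VB x := Un_nonneg _ x

end
open MeasureTheory Metric Set

noncomputable section

theorem ff_id (n : ℕ) {t : ℝ} (ht : 0 ≤ t) :
    ff n t - ff n 1 = (1 - t)/(2*(1+t)) * (2*n - 4 + 4/(1+t) + 2) := by
  unfold ff
  have : (1 + t) ≠ 0 := by positivity
  field_simp
  ring

theorem ff_one {n : ℕ} (hn : 3 ≤ n) : 0 ≤ ff n 1 := by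
  have n3 : (3:ℝ) ≤ n := by exact_mod_cast hn
  have : ff n 1 = n - 1 := by unfold ff; ring
  rw [this]; linarith

theorem ff_lo {n : ℕ} (hn : 3 ≤ n) {t : ℝ} (ht : 0 ≤ t) : |1-t|/(1+t) ≤ |ff n t - ff n 1| := by
  have n3 : (3:ℝ) ≤ n := by exact_mod_cast hn
  have p : 0 ≤ 4/(1+t) := by positivity
  rw [ff_id n ht, abs_mul, abs_div, abs_of_pos (by positivity : 0 < 2*(1+t)), abs_of_nonneg (by linarith : 0 ≤ 2*(n:ℝ) - 4 + 4/(1+t) + 2)]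
  calc |1-t|/(1+t) = |1-t|/(2*(1+t)) * 2 := by field_simp
    _ ≤ _ := by gcongr; linarith

theorem ff_in {n : ℕ} (hn : 3 ≤ n) {t : ℝ} (ht : 0 ≤ t) (h1 : t ≤ 1) : 0 ≤ ff n t - ff n 1 := by
  have n3 : (3:ℝ) ≤ n := by exact_mod_cast hn
  have p : 0 ≤ 4/(1+t) := by positivity
  rw [ff_id n ht]
  exact mul_nonneg (div_nonneg (by linarith) (by positivity)) (by linarith)

theorem ff_out {n : ℕ} (hn : 3 ≤ n) {t : ℝ} (h1 : 1 ≤ t) : ff n t - ff n 1 ≤ 0 := by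
  have n3 : (3:ℝ) ≤ n := by exact_mod_cast hn
  have p : 0 ≤ 4/(1+t) := by positivity
  rw [ff_id n (by linarith)]
  exact mul_nonpos_of_nonpos_of_nonneg (div_nonpos_of_nonpos_of_nonneg (by linarith) (by positivity)) (by linarith)

theorem min_lo {r : ℝ} (hr : 0 ≤ r) : min |r-1| 1 ≤ 5 * (|1-r^2|/(1+r^2)) := by
  have e : |1-r^2| = |r-1| * (1+r) := by
    have : 1 - r^2 = -((r-1)*(1+r)) := by ring
    rw [this, abs_neg, abs_mul, abs_of_pos (by linarith : 0 < 1+r)]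
  rw [mul_div_assoc', le_div_iff₀ (by positivity), e]
  rcases le_total r 2 with h | h
  · have h1 : min |r-1| 1 ≤ |r-1| := min_le_left _ _
    have h2 := abs_nonneg (r-1)
    calc min |r-1| 1 * (1+r^2) ≤ |r-1| * (1+r^2) := by gcongr
      _ ≤ |r-1| * (5 * (1+r)) := by gcongr; nlinarith
      _ = _ := by ring
  · have h1 : min |r-1| 1 ≤ 1 := min_le_right _ _
    have h2 : |r-1| = r-1 := abs_of_nonneg (by linarith)
    calc min |r-1| 1 * (1+r^2) ≤ 1 * (1+r^2) := by gcongr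
      _ ≤ _ := by rw [h2]; nlinarith

def CV (n : ℕ) : ℝ := 5 * (LV n + MV n)

theorem LV_nonneg (n : ℕ) : 0 ≤ LV n := by
  have := Ka_nonneg n (1-(n:ℝ)); have := (om_pos n).le; unfold LV; positivity
theorem MV_pos (n : ℕ) : 0 < MV n := by
  have := Ka_nonneg n (2-(n:ℝ)); have := (om_pos n); unfold MV; positivity
theorem CV_pos (n : ℕ) : 0 < CV n := by
  have := LV_nonneg n; have := MV_pos n; unfold CV; positivity

theorem VB_cmp {n : ℕ} (hn : 3 ≤ n) {e : Eu n} (he : ‖e‖ = 1) (x : Eu n) :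
    |VB x - VB e| ≤ CV n * |ff n (‖x‖^2) - ff n 1| := by
  have L := LV_nonneg n
  have M := MV_pos n
  have h1 : VB x = VB (‖x‖ • e) := VB_rad (by rw [norm_smul, he]; simp)
  have h2 : |VB x - VB e| ≤ LV n * |‖x‖ - 1| := by
    rw [h1]
    refine (VB_lip hn _ _).trans ?_
    have : ‖x‖ • e - e = (‖x‖ - 1) • e := by rw [sub_smul, one_smul]
    rw [this, norm_smul, he, mul_one, Real.norm_eq_abs]
  have h3 : |VB x - VB e| ≤ MV n := by
    rw [abs_le]
    have a := VB_le hn x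
    have b := VB_le hn e
    have c := VB_nonneg x
    have d := VB_nonneg e
    constructor <;> linarith
  have h4 : |VB x - VB e| ≤ (LV n + MV n) * min |‖x‖ - 1| 1 := by
    have p := abs_nonneg (‖x‖ - 1)
    rcases le_total |‖x‖ - 1| 1 with h | h
    · rw [min_eq_left h]; nlinarith
    · rw [min_eq_right h]; linarith
  have h5 := (min_lo (norm_nonneg x)).trans (mul_le_mul_of_nonneg_left (ff_lo hn (sq_nonneg ‖x‖)) (by norm_num : (0:ℝ) ≤ 5))
  calc |VB x - VB e| ≤ (LV n + MV n) * min |‖x‖ - 1| 1 := h4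
    _ ≤ (LV n + MV n) * (5 * |ff n (‖x‖^2) - ff n 1|) := by gcongr
    _ = _ := by unfold CV; ring

theorem VB_cont {n : ℕ} (hn : 3 ≤ n) : Continuous (VB : Eu n → ℝ) := by
  have : LipschitzWith (LV n).toNNReal (VB : Eu n → ℝ) := by
    apply LipschitzWith.of_dist_le_mul
    intro x y
    rw [Real.dist_eq, dist_eq_norm, Real.coe_toNNReal _ (LV_nonneg n)]
    exact VB_lip hn x y
  exact this.continuous

theorem cb_int {n : ℕ} {g : Eu n → ℝ} (hg : Continuous g) : IntegrableOn g (ball (0 : Eu n) 1) :=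
  (hg.continuousOn.integrableOn_compact (isCompact_closedBall 0 1)).mono_set ball_subset_closedBall

theorem VB_main {n : ℕ} (hn : 3 ≤ n) {w : Eu n → ℝ} (hw : CC w) (w0 : ∀ x, 0 ≤ w x) (w1 : ∀ x, w x ≤ 1)
    (wI : ∫ x, w x ≤ om n) :
    (∫ x in ball (0 : Eu n) 1, VB x) - ∫ x, VB x * w x ≤
      CV n * ((∫ x in ball (0 : Eu n) 1, ff n (‖x‖^2)) - ∫ x, ff n (‖x‖^2) * w x) + MV n * (om n - ∫ x, w x) := by
  set e : Eu n := EuclideanSpace.single ⟨0, by omega⟩ 1 with he'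
  have he : ‖e‖ = 1 := by simp [he']
  set f : Eu n → ℝ := fun x => ff n (‖x‖^2) with hf
  have fc : Continuous f := by
    have := ff_cont n (0 : Eu n); simpa only [sub_zero] using this
  have vc := VB_cont hn
  set c : ℝ := VB e - CV n * ff n 1 with hc
  set g : Eu n → ℝ := fun x => CV n * f x - VB x + c with hg
  have gc : Continuous g := by fun_prop
  have key : ∫ x, g x * w x ≤ ∫ x in ball (0 : Eu n) 1, g x := by
    rw [← integral_indicator measurableSet_ball]
    apply integral_mono (hw.mulc gc).int
    · exact (integrable_indicator_iff measurableSet_ball).2 (cb_int gc)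
    intro x
    have cm := abs_le.1 (VB_cmp hn he x)
    by_cases hx : x ∈ ball (0 : Eu n) 1
    · rw [indicator_of_mem hx]
      have hx1 : ‖x‖ < 1 := by simpa using hx
      have a := ff_in hn (sq_nonneg ‖x‖) (by nlinarith [norm_nonneg x])
      rw [abs_of_nonneg a] at cm
      apply mul_le_of_le_one_right _ (w1 x)
      simp only [hg, hc, hf]; linarith [cm.2]
    · rw [indicator_of_notMem hx]
      have hx1 : 1 ≤ ‖x‖ := by simpa using hx
      have a := ff_out hn (t := ‖x‖^2) (by nlinarith)
      rw [abs_of_nonpos a] at cm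
      apply mul_nonpos_of_nonpos_of_nonneg _ (w0 x)
      simp only [hg, hc, hf]; linarith [cm.1]
  have i1 : Integrable (fun x => CV n * (f x * w x)) := (hw.mulc fc).int.const_mul _
  have i2 : Integrable (fun x => VB x * w x) := (hw.mulc vc).int
  have i3 : Integrable (fun x => c * w x) := hw.int.const_mul c
  have e1 : ∫ x, g x * w x = CV n * (∫ x, f x * w x) - (∫ x, VB x * w x) + c * ∫ x, w x := by
    have i12 : Integrable (fun x => CV n * (f x * w x) - VB x * w x) := i1.sub i2
    rw [← integral_const_mul, ← integral_const_mul, ← integral_sub i1 i2, ← integral_add i12 i3]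
    congr 1; ext x; simp only [hg]; ring
  have j1 : IntegrableOn (fun x => CV n * f x) (ball (0 : Eu n) 1) := cb_int (by fun_prop)
  have j2 : IntegrableOn (fun x : Eu n => VB x) (ball (0 : Eu n) 1) := cb_int vc
  have j12 : IntegrableOn (fun x => CV n * f x - VB x) (ball (0 : Eu n) 1) := j1.sub j2
  have e2 : ∫ x in ball (0 : Eu n) 1, g x = CV n * (∫ x in ball (0 : Eu n) 1, f x) - (∫ x in ball (0 : Eu n) 1, VB x) + c * om n := by
    simp only [hg]
    rw [integral_add j12 (integrableOn_const measure_ball_lt_top.ne), integral_sub j1 j2, integral_const_mul]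
    congr 1
    simp [om, Measure.real, mul_comm]
  rw [e1, e2] at key
  have c1 : c ≤ MV n := by
    have a := VB_le hn e
    have b := mul_nonneg (CV_pos n).le (ff_one hn)
    rw [hc]; linarith
  have := mul_le_mul_of_nonneg_right c1 (sub_nonneg.2 wI)
  linarith

end
open MeasureTheory Metric Set

noncomputable section

theorem CQ_pos (d : ℕ) : 0 < CQ d := by
  have := CD_nonneg d
  unfold CQ; positivity

def BB (d : ℕ) : ℝ := 2 * (CV (d+1) * (2*((d:ℝ)+1) + CQ d * (1 + 2*((d:ℝ)+1) + 2 + 2 * om d + 2^(d+3))) + 2 * MV (d+1))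

theorem final_eta {d : ℕ} (hd : 2 ≤ d) {E : Set (Eu (d+1))} (hE : HasFinitePerimeter E)
    (hV : volume E = volume (ball (0 : Eu (d+1)) 1)) {η : ℝ} (h0 : 0 < η) (h1 : η ≤ 1) :
    NL (ball (0 : Eu (d+1)) 1) - NL E ≤ 2 * (CV (d+1) * CQ d) * (perimeter E - ((d:ℝ)+1) * om (d+1)) + BB d * η := by
  have hn : 3 ≤ d+1 := by omega
  obtain ⟨u, R, δ, q, L1, δε, gP⟩ := approx (by omega : 1 ≤ d) hE hV (pow_pos h0 2)
  obtain ⟨y, hy⟩ := q.main h0 h1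
  have hVf : volume E ≠ ⊤ := by rw [hV]; exact measure_ball_lt_top.ne
  set χ : Eu (d+1) → ℝ := E.indicator 1 with hχ
  have χi : Integrable χ := by
    rw [hχ, integrable_indicator_iff hE.1]
    exact integrableOn_const (C := (1:ℝ)) hVf
  have χI : ∫ x, χ x = om (d+1) := by
    rw [hχ, integral_indicator hE.1]
    simp [om, Measure.real, hV]
  have ucc : CC u := q.ud.cc
  have u0 := q.ud.u0
  set w : Eu (d+1) → ℝ := fun x => u (x + y) with hw
  have wcc : CC w := by
    obtain ⟨c, r, r0, hr⟩ := ucc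
    refine ⟨c.comp (by fun_prop), r + ‖y‖, by positivity, fun x hx => hr _ ?_⟩
    have := norm_sub_le (x + y) y
    rw [add_sub_cancel_right] at this
    linarith
  have wI : ∫ x, w x = ∫ x, u x := integral_add_right_eq_self u y
  have eF : ∫ x, ff (d+1) (‖x‖^2) * w x = ∫ x, ff (d+1) (‖x - y‖^2) * u x := by
    rw [← integral_add_right_eq_self (fun x => ff (d+1) (‖x - y‖^2) * u x) y]
    simp [hw]
  have eV : ∫ x, VB x * w x = ∫ x, VB (x - y) * u x := by
    rw [← integral_add_right_eq_self (fun x => VB (x - y) * u x) y]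
    simp [hw]
  have m := VB_main hn wcc (fun x => u0 _) (fun x => q.u1 _) (by rw [wI]; exact q.hV)
  rw [eF, eV, wI] at m
  have vc : Continuous fun x : Eu (d+1) => VB (x - y) := (VB_cont hn).comp (by fun_prop)
  have M0 := MV_pos (d+1)
  have nd := NL_diff hn hE.1 hVf y
  have iA : Integrable (fun x => |χ x - u x|) := (χi.sub ucc.int).abs
  have iu : Integrable (fun x => VB (x - y) * u x) := (ucc.mulc vc).int
  have iE : Integrable (E.indicator fun x => VB (x - y)) := by
    rw [integrable_indicator_iff hE.1]
    refine (integrableOn_const (C := MV (d+1)) hVf).mono' vc.aestronglyMeasurable (Filter.Eventually.of_forall fun x => ?_)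
    rw [Real.norm_of_nonneg (VB_nonneg _)]; exact VB_le hn _
  have hEu : (∫ x, VB (x - y) * u x) - ∫ x in E, VB (x - y) ≤ MV (d+1) * ∫ x, |χ x - u x| := by
    rw [← integral_indicator hE.1, ← integral_sub iu iE, ← integral_const_mul]
    apply integral_mono (iu.sub iE) (iA.const_mul _)
    intro x
    show VB (x - y) * u x - E.indicator (fun x => VB (x - y)) x ≤ MV (d+1) * |χ x - u x|
    have e : E.indicator (fun x => VB (x - y)) x = VB (x - y) * χ x := by
      by_cases hx : x ∈ E <;> simp [hχ, hx]
    rw [e, ← mul_sub]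
    calc VB (x - y) * (u x - χ x) ≤ VB (x - y) * |χ x - u x| := by
          apply mul_le_mul_of_nonneg_left _ (VB_nonneg _)
          rw [abs_sub_comm]; exact le_abs_self _
      _ ≤ _ := mul_le_mul_of_nonneg_right (VB_le hn _) (abs_nonneg _)
  have hU : om (d+1) - ∫ x, u x ≤ η^2 := by
    rw [← χI, ← integral_sub χi ucc.int]
    refine le_trans ?_ L1
    exact integral_mono (χi.sub ucc.int) iA fun x => le_abs_self _
  have hNN : ∫ x, NN d u x = om (d+1) - 2*δ := by
    have := q.hT; unfold NN; linarith
  have hG : 0 ≤ (∫ x, gn u x) - (d+1) * ∫ x, NN d u x := by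
    obtain ⟨τ, z, S, -⟩ := q.ex 0
    exact q.Du S
  have fb := ff_ball (d+1)
  push_cast at fb
  have C0 := CV_pos (d+1)
  have Q0 := CQ_pos d
  have η2 : η^2 ≤ η := by nlinarith
  have δη : δ ≤ η := δε.trans η2
  have dd : 2^(d+3) * δ / η ≤ 2^(d+3) * η := by
    rw [div_le_iff₀ h0]
    calc (2:ℝ)^(d+3) * δ ≤ 2^(d+3) * η^2 := by gcongr
      _ = _ := by ring
  have hDD : DD d u δ η ≤ (perimeter E - (d+1) * om (d+1)) + (1 + 2*((d:ℝ)+1) + 2 + 2 * om d + 2^(d+3)) * η := by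
    unfold DD
    rw [hNN]
    have : ((d:ℝ)+1) * δ ≤ (d+1) * η := by gcongr
    linarith
  have hQ := mul_le_mul_of_nonneg_left hDD Q0.le
  rw [hNN] at hG
  have hF : (∫ x in ball (0 : Eu (d+1)) 1, ff (d+1) (‖x‖^2)) - ∫ x, ff (d+1) (‖x - y‖^2) * u x
      ≤ 2*((d:ℝ)+1) * η + CQ d * ((perimeter E - (d+1) * om (d+1)) + (1 + 2*((d:ℝ)+1) + 2 + 2 * om d + 2^(d+3)) * η) := by
    have : ((d:ℝ)+1) * δ ≤ (d+1) * η := by gcongr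
    linarith
  have hCF := mul_le_mul_of_nonneg_left hF C0.le
  have hM1 : MV (d+1) * (om (d+1) - ∫ x, u x) ≤ MV (d+1) * η := mul_le_mul_of_nonneg_left (hU.trans η2) M0.le
  have hM2 : MV (d+1) * (∫ x, |χ x - u x|) ≤ MV (d+1) * η := mul_le_mul_of_nonneg_left (L1.trans η2) M0.le
  unfold BB
  linarith

theorem final_d {d : ℕ} (hd : 2 ≤ d) {E : Set (Eu (d+1))} (hE : HasFinitePerimeter E)
    (hV : volume E = volume (ball (0 : Eu (d+1)) 1)) :
    NL (ball (0 : Eu (d+1)) 1) - NL E ≤ 2 * (CV (d+1) * CQ d) * (perimeter E - perimeter (ball (0 : Eu (d+1)) 1)) := by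
  have C0 := CV_pos (d+1)
  have Q0 := CQ_pos d
  have M0 := MV_pos (d+1)
  have o0 := om_pos d
  have B0 : 0 < BB d := by unfold BB; positivity
  have h1 : NL (ball (0 : Eu (d+1)) 1) - NL E ≤ 2 * (CV (d+1) * CQ d) * (perimeter E - ((d:ℝ)+1) * om (d+1)) := by
    apply le_of_forall_pos_le_add
    intro ε hε
    have h := final_eta hd hE hV (η := min 1 (ε / BB d)) (lt_min one_pos (by positivity)) (min_le_left _ _)
    have : BB d * min 1 (ε / BB d) ≤ ε := by
      calc BB d * min 1 (ε / BB d) ≤ BB d * (ε / BB d) := by gcongr; exact min_le_right _ _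
        _ = ε := by field_simp
    linarith
  have pb := perimeter_ball (d+1)
  push_cast at pb
  refine h1.trans ?_
  apply mul_le_mul_of_nonneg_left _ (by positivity)
  linarith

end

/-- `NL(B_1) - NL(E) ≤ C (P(E) - P(B_1))` for all sets of finite perimeter with the
volume of the unit ball. -/
theorem statement3 (n : ℕ) (hn : 3 ≤ n) :
    ∃ C : ℝ, 0 < C ∧ ∀ E : Set (EuclideanSpace ℝ (Fin n)), HasFinitePerimeter E →
      volume E = volume (ball (0 : EuclideanSpace ℝ (Fin n)) 1) →
      NL (ball (0 : EuclideanSpace ℝ (Fin n)) 1) - NL E ≤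
        C * (perimeter E - perimeter (ball (0 : EuclideanSpace ℝ (Fin n)) 1)) := by
  obtain ⟨d, rfl⟩ : ∃ d, n = d + 1 := ⟨n - 1, by omega⟩
  refine ⟨2 * (CV (d+1) * CQ d), ?_, fun E hE hV => final_d (by omega) hE hV⟩
  have C0 := CV_pos (d+1)
  have Q0 := CQ_pos d
  positivity
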